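/- For every integer N ≥ 5, the third homotopy group π₃(SU(N)/SO(N)) of the coset space SU(N)/SO(N), based at the coset of the identity, is isomorphic to the cyclic group ℤ/2ℤ. -/

import Mathlib

open Matrix
open scoped Topology

noncomputable section

/-- The special unitary group `SU(n)`, i.e. the group of unitary `n×n` complex matrices of
determinant one, as a subgroup of the unitary group (so that its topology is the subspace
topology from the `n×n` complex matrices). -/
def SU (n : ℕ) : Subgroup (Matrix.unitaryGroup (Fin n) ℂ) :=
  (Matrix.detMonoidHom.comp (Matrix.unitaryGroup (Fin n) ℂ).subtype).ker

/-- The special orthogonal group `SO(n)`, regarded as the closed subgroup of `SU(n)` consisting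
of the matrices with real entries (i.e. the image of the real matrices under the entrywise
inclusion `ℝ → ℂ`). -/
def SOinSU (n : ℕ) : Subgroup (SU n) where
  carrier := {A | ∃ B : Matrix (Fin n) (Fin n) ℝ,
    ((A : Matrix.unitaryGroup (Fin n) ℂ) : Matrix (Fin n) (Fin n) ℂ) =
      Complex.ofRealHom.mapMatrix B}
  one_mem' := ⟨1, by simp⟩
  mul_mem' := by
    rintro a b ⟨Ba, hBa⟩ ⟨Bb, hBb⟩
    exact ⟨Ba * Bb, by push_cast [hBa, hBb]; rw [_root_.map_mul]⟩
  inv_mem' := by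
    rintro a ⟨B, hB⟩
    refine ⟨Bᵀ, ?_⟩
    have : ((a⁻¹ : SU n) : Matrix.unitaryGroup (Fin n) ℂ) =
        star (a : Matrix.unitaryGroup (Fin n) ℂ) := rfl
    rw [this]
    ext i j
    have := congrArg (fun M => M j i) hB
    simp only [RingHom.mapMatrix_apply, Matrix.map_apply, Complex.ofRealHom_eq_coe] at this ⊢
    simp [Matrix.conjTranspose_apply, this, Complex.conj_ofReal, Matrix.transpose_apply]

/-!
### Overview

The coset space is identified with the space of symmetric matrices `A Aᵀ` with `A` special unitary.
Loops of such matrices lift to loops of unit quaternions, viewed in a copy of `SU(2)`, and such a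
loop becomes trivial exactly when it is a square up to homotopy. Finally loops of unit quaternions
are classified by their degree, through the suspension of squares in the two-sphere.
-/

set_option linter.unusedSectionVars false

namespace PiThree

open unitInterval

section

/-! ### Relative homotopies of plain functions -/

variable {X Y Z : Type*} [TopologicalSpace X] [TopologicalSpace Y] [TopologicalSpace Z]

/-- `HRel P C f g`: the functions `f` and `g` are homotopic through maps with values in `P`,
relative to `C`. -/
def HRel (P : Set Y) (C : Set X) (f g : X → Y) : Prop :=
  ∃ F : X × I → Y, Continuous F ∧ (∀ x, F (x, 0) = f x) ∧ (∀ x, F (x, 1) = g x) ∧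
    (∀ p, F p ∈ P) ∧ ∀ x ∈ C, ∀ t, F (x, t) = f x

namespace HRel
variable {P : Set Y} {C : Set X} {f g h : X → Y}

theorem refl (hf : Continuous f) (hP : ∀ x, f x ∈ P) : HRel P C f f :=
  ⟨fun p => f p.1, by fun_prop, fun _ => rfl, fun _ => rfl, fun _ => hP _, fun _ _ _ => rfl⟩

theorem eqOn (H : HRel P C f g) : ∀ x ∈ C, g x = f x := by
  obtain ⟨F, -, -, h1, -, hC⟩ := H
  exact fun x hx => (h1 x).symm.trans (hC x hx 1)

theorem continuous_left (H : HRel P C f g) : Continuous f := by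
  obtain ⟨F, hF, h0, -, -, -⟩ := H
  have : f = fun x => F (x, 0) := funext fun x => (h0 x).symm
  rw [this]; fun_prop

theorem continuous_right (H : HRel P C f g) : Continuous g := by
  obtain ⟨F, hF, -, h1, -, -⟩ := H
  have : g = fun x => F (x, 1) := funext fun x => (h1 x).symm
  rw [this]; fun_prop

theorem mem_left (H : HRel P C f g) (x : X) : f x ∈ P := by
  obtain ⟨F, hF, h0, -, hP, -⟩ := H
  exact h0 x ▸ hP _

theorem mem_right (H : HRel P C f g) (x : X) : g x ∈ P := by
  obtain ⟨F, hF, -, h1, hP, -⟩ := H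
  exact h1 x ▸ hP _

theorem symm (H : HRel P C f g) : HRel P C g f := by
  have he := H.eqOn
  obtain ⟨F, hF, h0, h1, hP, hC⟩ := H
  exact ⟨fun p => F (p.1, σ p.2), by fun_prop, by simpa using h1, by simpa using h0,
    fun _ => hP _, fun x hx t => (hC x hx _).trans (he x hx).symm⟩

theorem trans (H : HRel P C f g) (H' : HRel P C g h) : HRel P C f h := by
  have he := H.eqOn
  obtain ⟨F, hF, h0, h1, hP, hC⟩ := H
  obtain ⟨F', hF', h0', h1', hP', hC'⟩ := H'
  let φ : ContinuousMap.Homotopy (⟨fun x => F (x, 0), by fun_prop⟩ : C(X, Y))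
      ⟨fun x => F (x, 1), by fun_prop⟩ :=
    { toFun := fun p => F (p.2, p.1), continuous_toFun := by fun_prop
      map_zero_left := fun _ => rfl, map_one_left := fun _ => rfl }
  let ψ : ContinuousMap.Homotopy (⟨fun x => F (x, 1), by fun_prop⟩ : C(X, Y))
      ⟨fun x => F' (x, 1), by fun_prop⟩ :=
    { toFun := fun p => F' (p.2, p.1), continuous_toFun := by fun_prop
      map_zero_left := fun x => by simp [h0', h1], map_one_left := fun _ => rfl }
  refine ⟨fun p => φ.trans ψ (p.2, p.1), by fun_prop, fun x => ?_, fun x => ?_, fun p => ?_,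
    fun x hx t => ?_⟩
  · simp [h0]
  · simp [h1']
  · beta_reduce
    rw [ContinuousMap.Homotopy.trans_apply]
    split_ifs
    · exact hP _
    · exact hP' _
  · beta_reduce
    rw [ContinuousMap.Homotopy.trans_apply]
    split_ifs
    · exact hC x hx _
    · exact (hC' x hx _).trans (he x hx)

theorem mono {P' : Set Y} {C' : Set X} (H : HRel P C f g) (hP : P ⊆ P') (hC : C' ⊆ C) :
    HRel P' C' f g := by
  obtain ⟨F, hF, h0, h1, hFP, hFC⟩ := H
  exact ⟨F, hF, h0, h1, fun p => hP (hFP p), fun x hx => hFC x (hC hx)⟩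

theorem comp_left {Q : Set Z} (H : HRel P C f g) (u : Y → Z) (hu : ContinuousOn u P)
    (huP : ∀ y ∈ P, u y ∈ Q) : HRel Q C (fun x => u (f x)) (fun x => u (g x)) := by
  obtain ⟨F, hF, h0, h1, hFP, hFC⟩ := H
  exact ⟨fun p => u (F p), hu.comp_continuous hF hFP, fun x => by simp [h0], fun x => by simp [h1],
    fun p => huP _ (hFP p), fun x hx t => by simp [hFC x hx]⟩

theorem comp_right {D : Set Z} (H : HRel P C f g) (u : Z → X) (hu : Continuous u)
    (huC : ∀ z ∈ D, u z ∈ C) : HRel P D (fun x => f (u x)) (fun x => g (u x)) := by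
  obtain ⟨F, hF, h0, h1, hFP, hFC⟩ := H
  exact ⟨fun p => F (u p.1, p.2), by fun_prop, fun x => by simp [h0], fun x => by simp [h1],
    fun p => hFP _, fun x hx t => hFC _ (huC x hx) t⟩

theorem map₂ {W : Type*} [TopologicalSpace W] {P' : Set Z} {f' g' : X → Z} {Q : Set W}
    (H : HRel P C f g) (H' : HRel P' C f' g')
    (u : Y → Z → W) (hu : Continuous (Function.uncurry u))
    (huP : ∀ y ∈ P, ∀ z ∈ P', u y z ∈ Q) :
    HRel Q C (fun x => u (f x) (f' x)) (fun x => u (g x) (g' x)) := by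
  obtain ⟨F, hF, h0, h1, hFP, hFC⟩ := H
  obtain ⟨F', hF', h0', h1', hFP', hFC'⟩ := H'
  exact ⟨fun p => u (F p) (F' p), hu.comp (hF.prodMk hF'), fun x => by simp [h0, h0'],
    fun x => by simp [h1, h1'],
    fun p => huP _ (hFP p) _ (hFP' p), fun x hx t => by simp [hFC x hx, hFC' x hx]⟩

theorem mul [Mul Y] [ContinuousMul Y] {f' g' : X → Y} (H : HRel P C f g) (H' : HRel P C f' g')
    (hP : ∀ y ∈ P, ∀ z ∈ P, y * z ∈ P) :
    HRel P C (fun x => f x * f' x) (fun x => g x * g' x) :=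
  H.map₂ H' (· * ·) continuous_mul hP

end HRel

/-! ### Concatenation along a coordinate of the cube -/

section Cube
variable {n : ℕ}

/-- Reparametrisation of the first half. -/
def firstHalf (t : I) : I := Set.projIcc 0 1 zero_le_one (2 * (t : ℝ))
/-- Reparametrisation of the second half. -/
def secondHalf (t : I) : I := Set.projIcc 0 1 zero_le_one (2 * (t : ℝ) - 1)

@[fun_prop] theorem continuous_firstHalf : Continuous firstHalf := by
  unfold firstHalf; fun_prop
@[fun_prop] theorem continuous_secondHalf : Continuous secondHalf := by
  unfold secondHalf; fun_prop

/-- Concatenation of functions on the cube along the coordinate `i`. -/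
def cc (i : Fin n) (f g : (Fin n → I) → Y) (k : Fin n → I) : Y :=
  if (k i : ℝ) ≤ 1 / 2 then f (Function.update k i (firstHalf (k i)))
  else g (Function.update k i (secondHalf (k i)))

theorem cc_comp (i : Fin n) (f g : (Fin n → I) → Y) (u : Y → Z) (k : Fin n → I) :
    cc i (fun k => u (f k)) (fun k => u (g k)) k = u (cc i f g k) := by
  unfold cc; split_ifs <;> rfl

/-- The boundary of the cube. -/
abbrev bd (n : ℕ) : Set (Fin n → I) := Cube.boundary (Fin n)

theorem firstHalf_zero : firstHalf 0 = 0 := by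
  unfold firstHalf; ext; simp
theorem firstHalf_of_ge {t : I} (h : 1 / 2 ≤ (t : ℝ)) : firstHalf t = 1 := by
  unfold firstHalf; exact Set.projIcc_of_right_le _ (by linarith)
theorem secondHalf_one : secondHalf 1 = 1 := by
  unfold secondHalf; exact Set.projIcc_of_right_le _ (by norm_num)
theorem secondHalf_of_le {t : I} (h : (t : ℝ) ≤ 1 / 2) : secondHalf t = 0 := by
  unfold secondHalf; exact Set.projIcc_of_le_left _ (by linarith)

theorem update_mem_bd {k : Fin n → I} {i : Fin n} {j : Fin n} (hij : j ≠ i) {t : I}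
    (h : k j = 0 ∨ k j = 1) : Function.update k i t ∈ bd n :=
  ⟨j, by simpa [Function.update_of_ne hij] using h⟩

theorem update_mem_bd' {k : Fin n → I} {i : Fin n} {t : I}
    (h : t = 0 ∨ t = 1) : Function.update k i t ∈ bd n :=
  ⟨i, by simpa using h⟩

theorem continuous_cc {i : Fin n} {f g : (Fin n → I) → Y} {y : Y} (hf : Continuous f)
    (hg : Continuous g) (hfy : ∀ k, k i = 1 → f k = y) (hgy : ∀ k, k i = 0 → g k = y) :
    Continuous (cc i f g) := by
  unfold cc
  refine Continuous.if_le (by fun_prop) (by fun_prop) (by fun_prop) (by fun_prop) ?_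
  intro k hk
  rw [hfy _ (by simp [firstHalf_of_ge hk.ge]), hgy _ (by simp [secondHalf_of_le hk.le])]

theorem cc_bd {i : Fin n} {f g : (Fin n → I) → Y} {y : Y}
    (hf : ∀ k ∈ bd n, f k = y) (hg : ∀ k ∈ bd n, g k = y) : ∀ k ∈ bd n, cc i f g k = y := by
  rintro k ⟨j, hj⟩
  unfold cc
  split_ifs with h
  · apply hf
    by_cases hij : j = i
    · subst hij
      rcases hj with hj | hj
      · exact update_mem_bd' (Or.inl (by rw [hj, firstHalf_zero]))
      · rw [hj] at h; norm_num at h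
    · exact update_mem_bd hij hj
  · apply hg
    by_cases hij : j = i
    · subst hij
      rcases hj with hj | hj
      · rw [hj] at h; norm_num at h
      · exact update_mem_bd' (Or.inr (by rw [hj, secondHalf_one]))
    · exact update_mem_bd hij hj

theorem HRel.cc {P : Set Y} {i : Fin n} {f g f' g' : (Fin n → I) → Y} {y : Y}
    (H : HRel P (bd n) f g) (H' : HRel P (bd n) f' g')
    (hf : ∀ k ∈ bd n, f k = y) (hf' : ∀ k ∈ bd n, f' k = y) :
    HRel P (bd n) (cc i f f') (cc i g g') := by
  obtain ⟨F, hF, h0, h1, hFP, hFC⟩ := H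
  obtain ⟨F', hF', h0', h1', hFP', hFC'⟩ := H'
  refine ⟨fun p => PiThree.cc i (fun k => F (k, p.2)) (fun k => F' (k, p.2)) p.1, ?_, ?_, ?_, ?_, ?_⟩
  · unfold PiThree.cc
    refine Continuous.if_le (by fun_prop) (by fun_prop) (by fun_prop) (by fun_prop) ?_
    intro p hp
    have e1 : Function.update p.1 i (firstHalf (p.1 i)) ∈ bd n :=
      update_mem_bd' (Or.inr (firstHalf_of_ge hp.ge))
    have e2 : Function.update p.1 i (secondHalf (p.1 i)) ∈ bd n :=
      update_mem_bd' (Or.inl (secondHalf_of_le hp.le))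
    beta_reduce
    rw [hFC _ e1, hFC' _ e2, hf _ e1, hf' _ e2]
  · intro x; simp only [h0, h0']
  · intro x; simp only [h1, h1']
  · intro p; unfold PiThree.cc; beta_reduce; split_ifs <;> simp [hFP, hFP']
  · intro x hx t
    beta_reduce
    rw [cc_bd hf hf' x hx, cc_bd (y := y) _ _ x hx]
    · intro k hk; rw [hFC k hk, hf k hk]
    · intro k hk; rw [hFC' k hk, hf' k hk]

/-- Concatenating with a constant does not change the homotopy class. -/
theorem HRel.cc_const_left {P : Set Y} {i : Fin n} {f : (Fin n → I) → Y} {y : Y}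
    (hf : Continuous f) (hP : ∀ k, f k ∈ P) (hfy : ∀ k ∈ bd n, f k = y) :
    HRel P (bd n) f (PiThree.cc i (fun _ => y) f) := by
  refine ⟨fun p => f (Function.update p.1 i (Set.projIcc 0 1 zero_le_one
    ((1 - p.2) * (p.1 i : ℝ) + p.2 * (secondHalf (p.1 i) : ℝ)))), by fun_prop, ?_, ?_,
    fun _ => hP _, ?_⟩
  · intro k; simp
  · intro k
    unfold PiThree.cc
    split_ifs with h
    · apply hfy; apply update_mem_bd'; left; simp [secondHalf_of_le h]
    · simp
  · rintro k ⟨j, hj⟩ t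
    rw [hfy k ⟨j, hj⟩]
    apply hfy
    by_cases hij : j = i
    · subst hij
      apply update_mem_bd'
      rcases hj with hj | hj
      · left; simp [hj, secondHalf_of_le]
      · right; simp [hj, secondHalf_one]
    · exact update_mem_bd hij hj

theorem HRel.cc_const_right {P : Set Y} {i : Fin n} {f : (Fin n → I) → Y} {y : Y}
    (hf : Continuous f) (hP : ∀ k, f k ∈ P) (hfy : ∀ k ∈ bd n, f k = y) :
    HRel P (bd n) f (PiThree.cc i f (fun _ => y)) := by
  refine ⟨fun p => f (Function.update p.1 i (Set.projIcc 0 1 zero_le_one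
    ((1 - p.2) * (p.1 i : ℝ) + p.2 * (firstHalf (p.1 i) : ℝ)))), by fun_prop, ?_, ?_,
    fun _ => hP _, ?_⟩
  · intro k; simp
  · intro k
    unfold PiThree.cc
    split_ifs with h
    · simp
    · apply hfy; apply update_mem_bd'; right; simp [firstHalf_of_ge (not_le.1 h).le]
  · rintro k ⟨j, hj⟩ t
    rw [hfy k ⟨j, hj⟩]
    apply hfy
    by_cases hij : j = i
    · subst hij
      apply update_mem_bd'
      rcases hj with hj | hj
      · left; simp [hj, firstHalf_zero]
      · right; simp [hj, firstHalf_of_ge (t := 1) (by norm_num)]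
    · exact update_mem_bd hij hj

/-- In a topological monoid the pointwise product is homotopic to the concatenation. -/
theorem HRel.mul_cc [Monoid Y] [ContinuousMul Y] {P : Set Y} {i : Fin n} {f g : (Fin n → I) → Y}
    (hf : Continuous f) (hfP : ∀ k, f k ∈ P) (hf1 : ∀ k ∈ bd n, f k = 1)
    (hg : Continuous g) (hgP : ∀ k, g k ∈ P) (hg1 : ∀ k ∈ bd n, g k = 1)
    (hP : ∀ y ∈ P, ∀ z ∈ P, y * z ∈ P) :
    HRel P (bd n) (fun k => f k * g k) (PiThree.cc i f g) := by
  have := (HRel.cc_const_right (i := i) hf hfP hf1).mul (HRel.cc_const_left (i := i) hg hgP hg1) hP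
  convert this using 1
  ext k; unfold PiThree.cc; split_ifs <;> simp

end Cube

/-! ### Transport along a local section -/

theorem exists_transport {K G B : Type*} [TopologicalSpace K] [CompactSpace K]
    [TopologicalSpace B] [Monoid G] [TopologicalSpace G] [ContinuousMul G]
    (Act : G → B → B → Prop) (Q : Submonoid G) (T : Set B) (W : Set (B × B)) (hW : IsOpen W)
    (s : B × B → G) (hs : ContinuousOn s W) (hdiag : ∀ x ∈ T, (x, x) ∈ W)
    (hs1 : ∀ x ∈ T, s (x, x) = 1) (hQ : ∀ x ∈ T, ∀ y ∈ T, (x, y) ∈ W → s (x, y) ∈ Q)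
    (hAct : ∀ x ∈ T, ∀ y ∈ T, (x, y) ∈ W → Act (s (x, y)) x y)
    (hA1 : ∀ x ∈ T, Act 1 x x)
    (hAmul : ∀ a b x y z, Act a x y → Act b y z → Act (b * a) x z)
    (h : K × I → B) (hh : Continuous h) (hT : ∀ p, h p ∈ T) :
    ∃ γ : K × I → G, Continuous γ ∧ (∀ k, γ (k, 0) = 1) ∧ (∀ p, γ p ∈ Q) ∧
      (∀ k t, Act (γ (k, t)) (h (k, 0)) (h (k, t))) ∧
      ∀ k, (∀ t, h (k, t) = h (k, 0)) → ∀ t, γ (k, t) = 1 := by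
  let U : Set (I × I) := {p | ∀ k : K, (h (k, p.1), h (k, p.2)) ∈ W}
  have hU : IsOpen U := by
    have : IsOpen {q : K × (I × I) | (h (q.1, q.2.1), h (q.1, q.2.2)) ∈ W} :=
      hW.preimage (by fun_prop)
    have hc : IsClosed (Prod.snd '' {q : K × (I × I) | (h (q.1, q.2.1), h (q.1, q.2.2)) ∈ W}ᶜ) :=
      isClosedMap_snd_of_compactSpace _ this.isClosed_compl
    convert hc.isOpen_compl using 1
    ext p
    constructor
    · rintro hp ⟨⟨k, q⟩, hq, rfl⟩
      exact hq (hp k)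
    · intro hp k
      by_contra hk
      exact hp ⟨(k, p), hk, rfl⟩
  have hUd : ∀ t : I, (t, t) ∈ U := fun t k => hdiag _ (hT _)
  obtain ⟨δ, hδ, hδU⟩ : ∃ δ > 0, ∀ a b : I, dist a b < δ → (a, b) ∈ U := by
    have hcomp : IsCompact (Set.range fun t : I => (t, t)) := isCompact_range (by fun_prop)
    obtain ⟨δ, hδ, hsub⟩ := hcomp.exists_thickening_subset_open hU
      (by rintro _ ⟨t, rfl⟩; exact hUd t)
    refine ⟨δ, hδ, fun a b hab => hsub ?_⟩
    rw [Metric.mem_thickening_iff]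
    exact ⟨(a, a), ⟨a, rfl⟩, by simpa [Prod.dist_eq, hδ, dist_comm] using hab⟩
  obtain ⟨n, hn⟩ := exists_nat_one_div_lt hδ
  have hn0 : (0 : ℝ) < n + 1 := by positivity
  let c : ℕ → I → I := fun i t => Set.projIcc 0 1 zero_le_one (min (t : ℝ) (i / (n + 1)))
  have hc : ∀ i, Continuous (c i) := fun i => by
    show Continuous fun t : I => Set.projIcc (0 : ℝ) 1 zero_le_one (min (t : ℝ) (i / (n + 1)))
    fun_prop
  have hc0 : ∀ t, c 0 t = 0 := fun t => by
    apply Subtype.ext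
    simp [c, t.2.1]
  have hcn : ∀ t, c (n + 1) t = t := fun t => by
    apply Subtype.ext
    simp [c, div_self hn0.ne', t.2.2]
  have hc00 : ∀ i, c i 0 = 0 := fun i => by
    apply Subtype.ext
    have : (0 : ℝ) ≤ i / (n + 1) := by positivity
    simp [c, this]
  have hcd : ∀ i t, dist (c i t) (c (i + 1) t) < δ := fun i t => by
    refine lt_of_le_of_lt ?_ hn
    rw [Subtype.dist_eq, Real.dist_eq]
    have h1 : (0 : ℝ) ≤ i / (n + 1) := by positivity
    have h2 : ((i + 1 : ℕ) : ℝ) / (n + 1) = i / (n + 1) + 1 / (n + 1) := by push_cast; ring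
    have h3 : (0 : ℝ) < 1 / (n + 1) := by positivity
    have ht := t.2.1
    have ht' := t.2.2
    simp only [c, h2]
    rw [Set.coe_projIcc, Set.coe_projIcc, abs_le]
    generalize (i : ℝ) / (n + 1) = a at *
    generalize (1 : ℝ) / (n + 1) = b at *
    generalize (t : ℝ) = u at *
    constructor <;> grind
  have key : ∀ m : ℕ, ∃ γ : K × I → G, Continuous γ ∧ (∀ k, γ (k, 0) = 1) ∧ (∀ p, γ p ∈ Q) ∧
      (∀ k t, Act (γ (k, t)) (h (k, 0)) (h (k, c m t))) ∧
      ∀ k, (∀ t, h (k, t) = h (k, 0)) → ∀ t, γ (k, t) = 1 := by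
    intro m
    induction m with
    | zero =>
      refine ⟨fun _ => 1, continuous_const, fun _ => rfl, fun _ => Q.one_mem, fun k t => ?_,
        fun _ _ _ => rfl⟩
      rw [hc0]; exact hA1 _ (hT _)
    | succ m ih =>
      obtain ⟨γ, hγ, hγ0, hγQ, hγA, hγc⟩ := ih
      have hmem : ∀ p : K × I, (h (p.1, c m p.2), h (p.1, c (m + 1) p.2)) ∈ W :=
        fun p => hδU _ _ (hcd m p.2) p.1
      refine ⟨fun p => s (h (p.1, c m p.2), h (p.1, c (m + 1) p.2)) * γ p, ?_, ?_, ?_, ?_, ?_⟩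
      · refine Continuous.mul (hs.comp_continuous ?_ hmem) hγ
        have := hc m
        have := hc (m + 1)
        fun_prop
      · intro k
        simp only [hc00, hγ0, hs1 _ (hT _), mul_one]
      · exact fun p => Q.mul_mem (hQ _ (hT _) _ (hT _) (hmem p)) (hγQ p)
      · exact fun k t => hAmul _ _ _ _ _ (hγA k t) (hAct _ (hT _) _ (hT _) (hmem (k, t)))
      · intro k hk t
        simp only [hγc k hk t, mul_one]
        rw [hk (c m t), hk (c (m + 1) t), hs1 _ (hT _)]
  obtain ⟨γ, h1, h2, h3, h4, h5⟩ := key (n + 1)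
  exact ⟨γ, h1, h2, h3, fun k t => by simpa [hcn] using h4 k t, h5⟩

/-- Transport along the coordinate `0` of a cube. -/
theorem exists_cube_lift {n : ℕ} {G B : Type*}
    [TopologicalSpace B] [Monoid G] [TopologicalSpace G] [ContinuousMul G]
    (Act : G → B → B → Prop) (Q : Submonoid G) (T : Set B) (W : Set (B × B)) (hW : IsOpen W)
    (s : B × B → G) (hs : ContinuousOn s W) (hdiag : ∀ x ∈ T, (x, x) ∈ W)
    (hs1 : ∀ x ∈ T, s (x, x) = 1) (hQ : ∀ x ∈ T, ∀ y ∈ T, (x, y) ∈ W → s (x, y) ∈ Q)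
    (hAct : ∀ x ∈ T, ∀ y ∈ T, (x, y) ∈ W → Act (s (x, y)) x y)
    (hA1 : ∀ x ∈ T, Act 1 x x)
    (hAmul : ∀ a b x y z, Act a x y → Act b y z → Act (b * a) x z)
    (f : (Fin (n + 1) → I) → B) (hf : Continuous f) (hT : ∀ p, f p ∈ T) (b : B)
    (hb : ∀ k ∈ bd (n + 1), f k = b) :
    ∃ γ : (Fin (n + 1) → I) → G, Continuous γ ∧ (∀ p, γ p ∈ Q) ∧
      (∀ k, Act (γ k) b (f k)) ∧ ∀ k j, (k j = 0 ∨ (j ≠ 0 ∧ k j = 1)) → γ k = 1 := by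
  obtain ⟨γ, h1, h2, h3, h4, h5⟩ := exists_transport Act Q T W hW s hs hdiag hs1 hQ hAct hA1 hAmul
    (fun p : (Fin (n + 1) → I) × I => f (Function.update p.1 0 p.2)) (by fun_prop) (fun _ => hT _)
  refine ⟨fun k => γ (k, k 0), by fun_prop, fun _ => h3 _, fun k => ?_, ?_⟩
  · have := h4 k (k 0)
    simp only [Function.update_eq_self] at this
    rwa [hb _ (update_mem_bd' (Or.inl rfl))] at this
  · intro k j hj
    by_cases hj0 : j = 0
    · subst hj0
      rcases hj with hj | hj
      · simp only [hj, h2]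
      · exact absurd rfl hj.1
    · refine h5 k (fun t => ?_) _
      have hj' : k j = 0 ∨ k j = 1 := hj.imp_right And.right
      rw [hb _ (update_mem_bd hj0 hj'), hb _ (update_mem_bd hj0 hj')]

theorem cons_mem_bd {n : ℕ} {u : Fin n → I} (hu : u ∈ bd n) (t : I) :
    ∃ j, ((Fin.cons t u : Fin (n + 1) → I) j = 0 ∨
      (j ≠ 0 ∧ (Fin.cons t u : Fin (n + 1) → I) j = 1)) := by
  obtain ⟨j, hj⟩ := hu
  exact ⟨j.succ, by simpa using hj⟩

/-- A boundary point of the cube is on the last face or in the union of the other faces. -/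
theorem mem_bd_succ {n : ℕ} {k : Fin (n + 1) → I} (hk : k ∈ bd (n + 1)) :
    (∃ j, k j = 0 ∨ (j ≠ 0 ∧ k j = 1)) ∨ k 0 = 1 := by
  obtain ⟨j, hj⟩ := hk
  by_cases h : j = 0
  · subst h; exact hj.imp (fun h => ⟨0, Or.inl h⟩) id
  · exact Or.inl ⟨j, hj.imp_right fun h' => ⟨h, h'⟩⟩

end

section

/-! ### General position -/

section GeneralPosition
open Module

theorem dense_compl_image_of_finrank_lt {E F : Type*} [NormedAddCommGroup E] [NormedSpace ℝ E]
    [FiniteDimensional ℝ E] [NormedAddCommGroup F] [NormedSpace ℝ F] [FiniteDimensional ℝ F]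
    {Φ : E → F} {U : Set E} (h : ∀ x ∈ U, ContDiffAt ℝ 1 Φ x)
    (hd : finrank ℝ E < finrank ℝ F) : Dense (Φ '' U)ᶜ := by
  apply dense_compl_of_dimH_lt_finrank
  calc dimH (Φ '' U) ≤ dimH U := dimH_image_le_of_locally_lipschitzOn fun x hx => by
        obtain ⟨K, t, ht, hK⟩ := (h x hx).exists_lipschitzOnWith
        exact ⟨K, t, mem_nhdsWithin_of_mem_nhds ht, hK⟩
    _ ≤ dimH (Set.univ : Set E) := dimH_mono (Set.subset_univ _)
    _ = finrank ℝ E := Real.dimH_univ_eq_finrank E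
    _ < finrank ℝ F := by exact_mod_cast hd

variable {X E V : Type*} [TopologicalSpace X] [CompactSpace X]
  [NormedAddCommGroup E] [NormedSpace ℝ E] [FiniteDimensional ℝ E]
  [NormedAddCommGroup V] [NormedSpace ℝ V] [FiniteDimensional ℝ V]

theorem exists_smooth_approx {j : X → E} (hj : Continuous j) (hji : Function.Injective j)
    {f : X → V} (hf : Continuous f) {ε : ℝ} (hε : 0 < ε) :
    ∃ P : E → V, ContDiff ℝ 1 P ∧ ∀ x, ‖P (j x) - f x‖ < ε := by
  have he : Topology.IsClosedEmbedding j := hj.isClosedEmbedding hji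
  obtain ⟨g, hg⟩ := ContinuousMap.exists_extension he ⟨f, hf⟩
  obtain ⟨P, hP, hPg, -⟩ := g.continuous.exists_contDiff_approx 1 (ε := fun _ => ε)
    continuous_const (fun _ => hε)
  refine ⟨P, by exact_mod_cast hP, fun x => ?_⟩
  have := hPg (j x)
  rw [dist_eq_norm] at this
  have h2 : g (j x) = f x := congrArg (fun u : C(X, V) => u x) hg
  rwa [h2] at this

theorem exists_norm_le_of_compact {f : X → V} (hf : Continuous f) : ∃ R > 0, ∀ x, ‖f x‖ ≤ R := by
  obtain ⟨R, hR⟩ := (isCompact_range hf).isBounded.exists_norm_le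
  exact ⟨max R 1, by positivity, fun x => (hR _ ⟨x, rfl⟩).trans (le_max_left _ _)⟩

theorem exists_pos_le_norm {f : X → V} (hf : Continuous f) (h0 : ∀ x, f x ≠ 0) :
    ∃ m > 0, ∀ x, m ≤ ‖f x‖ := by
  obtain ⟨R, hR, h⟩ := exists_norm_le_of_compact (f := fun x => (‖f x‖)⁻¹)
    (hf.norm.inv₀ (fun x => norm_ne_zero_iff.2 (h0 x)))
  refine ⟨R⁻¹, by positivity, fun x => ?_⟩
  have := h x
  have hp : 0 < ‖f x‖ := norm_pos_iff.2 (h0 x)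
  rw [norm_inv, norm_norm] at this
  exact inv_le_of_inv_le₀ hp this

/-- Cutting off a perturbation `g` of `f` near the set where `f = b`. -/
theorem exists_cutoff {f g : X → V} (hf : Continuous f) (hg : Continuous g) (b : V)
    {ε : ℝ} (hε : 0 < ε) (hfg : ∀ x, ‖g x - f x‖ < ε) :
    ∃ f₁ : X → V, Continuous f₁ ∧ (∀ x, ‖f₁ x - f x‖ < ε) ∧ (∀ x, f x = b → f₁ x = b) ∧
      ∀ x, f₁ x = g x ∨ ‖f₁ x - b‖ < 2 * ε := by
  refine ⟨fun x => f x + (min 1 (‖f x - b‖ / ε)) • (g x - f x), by fun_prop, fun x => ?_,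
    fun x hx => by simp [hx], fun x => ?_⟩
  · rw [add_sub_cancel_left, norm_smul]
    have h0 : 0 ≤ min 1 (‖f x - b‖ / ε) := by positivity
    rw [Real.norm_of_nonneg h0]
    calc _ ≤ 1 * ‖g x - f x‖ := by gcongr; exact min_le_left _ _
      _ < ε := by rw [one_mul]; exact hfg x
  · by_cases h : 1 ≤ ‖f x - b‖ / ε
    · left; beta_reduce; rw [min_eq_left h]; simp
    · right
      rw [not_le, div_lt_one hε] at h
      have h0 : 0 ≤ min 1 (‖f x - b‖ / ε) := by positivity
      calc ‖f x + (min 1 (‖f x - b‖ / ε)) • (g x - f x) - b‖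
          = ‖(f x - b) + (min 1 (‖f x - b‖ / ε)) • (g x - f x)‖ := by congr 1; abel
        _ ≤ ‖f x - b‖ + ‖(min 1 (‖f x - b‖ / ε)) • (g x - f x)‖ := norm_add_le _ _
        _ ≤ ‖f x - b‖ + 1 * ‖g x - f x‖ := by
            rw [norm_smul, Real.norm_of_nonneg h0]; gcongr; exact min_le_left _ _
        _ < 2 * ε := by linarith [hfg x]

theorem hrel_segment {f g : X → V} {P : Set V} (hf : Continuous f) (hg : Continuous g)
    (h : ∀ x, ∀ t : I, (1 - (t : ℝ)) • f x + (t : ℝ) • g x ∈ P) :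
    HRel P {x | f x = g x} f g :=
  ⟨fun p => (1 - (p.2 : ℝ)) • f p.1 + (p.2 : ℝ) • g p.1, by fun_prop, by simp, by simp,
    fun p => h _ _, fun x hx t => by
      simp only [Set.mem_ofPred_eq] at hx
      simp only [← hx, ← add_smul, sub_add_cancel, one_smul]⟩

theorem hrel_of_norm_sub_lt {f g : X → V} (hf : Continuous f) (hg : Continuous g)
    (h : ∀ x, ‖g x - f x‖ < ‖f x‖) : HRel {v : V | v ≠ 0} {x | f x = g x} f g := by
  refine hrel_segment hf hg fun x t h0 => ?_
  have h1 : f x = -((t : ℝ) • (g x - f x)) := by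
    rw [eq_neg_iff_add_eq_zero, ← h0]; module
  have h2 : ‖f x‖ ≤ ‖g x - f x‖ := by
    conv_lhs => rw [h1, norm_neg, norm_smul, Real.norm_of_nonneg t.2.1]
    exact mul_le_of_le_one_left (norm_nonneg _) t.2.2
  exact absurd (h x) (not_lt.2 h2)

/-- A map from a low-dimensional compact space to a punctured vector space is nullhomotopic,
relative to the set where it already takes the base value. -/
theorem hrel_const_of_finrank {j : X → E} (hj : Continuous j) (hji : Function.Injective j)
    (hd : finrank ℝ E + 1 < finrank ℝ V) {f : X → V} (hf : Continuous f) (h0 : ∀ x, f x ≠ 0)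
    {b : V} (hb : b ≠ 0) :
    HRel {v : V | v ≠ 0} {x | f x = b} f (fun _ => b) := by
  obtain ⟨l, hl⟩ := SeparatingDual.exists_eq_one (R := ℝ) hb
  obtain ⟨m₀, hm₀, hfm₀⟩ := exists_pos_le_norm hf h0
  obtain ⟨m, hm, hfm, hbm⟩ : ∃ m > 0, (∀ x, m ≤ ‖f x‖) ∧ m ≤ ‖b‖ :=
    ⟨min m₀ ‖b‖, lt_min hm₀ (norm_pos_iff.2 hb), fun x => (min_le_left _ _).trans (hfm₀ x),
      min_le_right _ _⟩
  obtain ⟨P, hP, hPf⟩ := exists_smooth_approx hj hji hf (ε := m / 4) (by positivity)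
  have hP0 : ∀ x, P (j x) ≠ 0 := fun x hx => by
    have := hPf x
    rw [hx, zero_sub, norm_neg] at this
    linarith [hfm x]
  let Φ : E × ℝ → V := fun p => (l (P p.1))⁻¹ • P p.1 + p.2 • b
  have hdense := dense_compl_image_of_finrank_lt (Φ := Φ) (U := {p | l (P p.1) ≠ 0})
    (fun p hp => by
      have h1 : ContDiffAt ℝ 1 (fun p : E × ℝ => P p.1) p := (hP.comp contDiff_fst).contDiffAt
      have h2 : ContDiffAt ℝ 1 (fun p : E × ℝ => l (P p.1)) p := l.contDiff.contDiffAt.comp p h1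
      exact ((h2.inv hp).smul h1).add (contDiff_snd.smul contDiff_const).contDiffAt)
    (by simpa using hd)
  obtain ⟨R, hR, hPR⟩ := exists_norm_le_of_compact (f := fun x => l (P (j x)))
    (l.continuous.comp (hP.continuous.comp hj))
  have hcont : Continuous fun c : V => R * ‖c - l c • b‖ := by fun_prop
  obtain ⟨c, hc, hcm⟩ : ∃ c ∈ (Φ '' {p | l (P p.1) ≠ 0})ᶜ, R * ‖c - l c • b‖ < m / 4 := by
    have ho : IsOpen {c : V | R * ‖c - l c • b‖ < m / 4} := isOpen_lt hcont continuous_const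
    obtain ⟨c, h1, h2⟩ := hdense.inter_open_nonempty _ ho ⟨0, by simp [hm]⟩
    exact ⟨c, h2, h1⟩
  set c' := c - l c • b with hc'
  have hlc' : l c' = 0 := by simp [hc', hl]
  obtain ⟨f₁, hf₁, hff₁, hf₁b, hf₁g⟩ := exists_cutoff hf
    (g := fun x => P (j x) + max (-l (P (j x))) 0 • c')
    (by have := hP.continuous; fun_prop) b (ε := m / 2) (by positivity) (fun x => by
      calc _ = ‖(P (j x) - f x) + max (-l (P (j x))) 0 • c'‖ := by congr 1; abel
        _ ≤ ‖P (j x) - f x‖ + max (-l (P (j x))) 0 * ‖c'‖ := by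
            refine (norm_add_le _ _).trans ?_
            rw [norm_smul, Real.norm_of_nonneg (le_max_right _ _)]
        _ ≤ ‖P (j x) - f x‖ + R * ‖c'‖ := by
            gcongr
            refine max_le ((neg_le_abs _).trans (hPR x)) hR.le
        _ < m / 2 := by linarith [hPf x])
  have hray : ∀ x, ∀ μ : ℝ, 0 ≤ μ → f₁ x ≠ -(μ • b) := by
    intro x μ hμ hx
    rcases hf₁g x with h | h
    · rw [hx] at h
      have hlP : l (P (j x)) = -μ := by
        have := congrArg l h
        simpa [hl, hlc'] using this.symm
      rw [hlP, neg_neg, max_eq_left hμ] at h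
      have hP' : P (j x) = -(μ • (b + c')) := by
        rw [smul_add, neg_add, h]; abel
      rcases hμ.eq_or_lt with rfl | hμ
      · exact hP0 x (by simpa using hP')
      · apply hc
        refine ⟨(j x, l c - 1), ?_, ?_⟩
        · simpa [hlP] using hμ.ne'
        · simp only [Φ, hlP]
          rw [hP', smul_neg, smul_smul, inv_neg, neg_mul, inv_mul_cancel₀ hμ.ne', hc']
          module
    · rw [hx] at h
      have h2 : ‖-(μ • b) - b‖ = (μ + 1) * ‖b‖ := by
        have : -(μ • b) - b = -((μ + 1) • b) := by module
        rw [this, norm_neg, norm_smul, Real.norm_of_nonneg (by linarith)]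
      rw [h2] at h
      nlinarith
  have s1 : HRel {v : V | v ≠ 0} {x | f x = b} f f₁ :=
    (hrel_of_norm_sub_lt hf hf₁ (fun x => by linarith [hff₁ x, hfm x])).mono subset_rfl
      (fun x hx => by
        simp only [Set.mem_ofPred_eq] at hx ⊢
        rw [hx, hf₁b x hx])
  have s2 : HRel {v : V | v ≠ 0} {x | f x = b} f₁ (fun _ => b) := by
    refine (hrel_segment hf₁ continuous_const (P := {v : V | v ≠ 0})
      fun x t h => ?_).mono subset_rfl (fun x hx => hf₁b x hx)
    have ht := t.2.2
    rcases ht.eq_or_lt with ht | ht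
    · simp [ht, hb] at h
    · have h1 : (1 - (t : ℝ)) ≠ 0 := by linarith
      apply hray x ((1 - (t : ℝ))⁻¹ * t) (by have := t.2.1; have : 0 < 1 - (t : ℝ) := by linarith
                                             positivity)
      rw [add_eq_zero_iff_eq_neg] at h
      rw [mul_smul, ← smul_neg, ← h, smul_smul, inv_mul_cancel₀ h1, one_smul]
  exact s1.trans s2

/-- General position for the two opposite rays spanned by `e`. -/
theorem exists_avoid_rays {j : X → E} (hj : Continuous j) (hji : Function.Injective j)
    (hd : finrank ℝ E + 4 < 2 * finrank ℝ V) {f : X × I → V} (hf : Continuous f)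
    (h1 : ∀ x, 1 ≤ ‖f x‖) {e b : V} (he : e ≠ 0) (hb : ∀ μ : ℝ, 1 ≤ ‖μ • e - b‖)
    {ε : ℝ} (hε : 0 < ε) :
    ∃ f₁ : X × I → V, Continuous f₁ ∧ (∀ p, ‖f₁ p - f p‖ < ε) ∧ (∀ p, f p = b → f₁ p = b) ∧
      ∀ u s t, ∀ μ ν : ℝ, 0 ≤ μ → 0 ≤ ν → f₁ (u, s) = μ • e → f₁ (u, t) ≠ -(ν • e) := by
  obtain ⟨l, hl⟩ := SeparatingDual.exists_eq_one (R := ℝ) he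
  obtain ⟨m, hm, hmε, hm1⟩ : ∃ m > 0, m ≤ ε ∧ m ≤ 1 / 2 :=
    ⟨min ε (1 / 2), by positivity, min_le_left _ _, min_le_right _ _⟩
  obtain ⟨P, hP, hPf⟩ := exists_smooth_approx (j := fun p : X × I => (j p.1, (p.2 : ℝ)))
    (by fun_prop) (fun p q h => by
      rw [Prod.mk.injEq] at h
      exact Prod.ext (hji h.1) (Subtype.ext h.2)) hf (ε := m / 4) (by positivity)
  have hP0 : ∀ x t, P (j x, (t : I)) ≠ 0 := fun x t hx => by
    have := hPf (x, t)
    rw [hx, zero_sub, norm_neg] at this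
    linarith [h1 (x, t)]
  let Φ : E × (ℝ × ℝ) × (ℝ × ℝ) → V × V := fun p =>
    ((l (P (p.1, p.2.1.1)))⁻¹ • P (p.1, p.2.1.1) + p.2.2.1 • e,
      (l (P (p.1, p.2.1.2)))⁻¹ • P (p.1, p.2.1.2) + p.2.2.2 • e)
  let U : Set (E × (ℝ × ℝ) × (ℝ × ℝ)) :=
    {p | l (P (p.1, p.2.1.1)) ≠ 0 ∧ l (P (p.1, p.2.1.2)) ≠ 0}
  have hdense := dense_compl_image_of_finrank_lt (Φ := Φ) (U := U)
    (fun p hp => by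
      have h1 : ContDiffAt ℝ 1 (fun p : E × (ℝ × ℝ) × (ℝ × ℝ) => P (p.1, p.2.1.1)) p := by
        fun_prop
      have h2 : ContDiffAt ℝ 1 (fun p : E × (ℝ × ℝ) × (ℝ × ℝ) => P (p.1, p.2.1.2)) p := by
        fun_prop
      have h3 := l.contDiff.contDiffAt.comp p h1
      have h4 := l.contDiff.contDiffAt.comp p h2
      refine ContDiffAt.prodMk (((h3.inv hp.1).smul h1).add ?_) (((h4.inv hp.2).smul h2).add ?_) <;>
        fun_prop)
    (by simp only [finrank_prod, finrank_self]; omega)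
  obtain ⟨R, hR, hPR⟩ := exists_norm_le_of_compact (f := fun x : X × I => l (P (j x.1, x.2)))
    (by have := hP.continuous; fun_prop)
  have hcont : Continuous fun c : V => R * ‖c - l c • e‖ := by fun_prop
  obtain ⟨c, d, hcd, hc, hd'⟩ : ∃ c d, (c, d) ∈ (Φ '' U)ᶜ ∧ R * ‖c - l c • e‖ < m / 8 ∧
      R * ‖d - l d • e‖ < m / 8 := by
    have ho : IsOpen {p : V × V | R * ‖p.1 - l p.1 • e‖ < m / 8 ∧ R * ‖p.2 - l p.2 • e‖ < m / 8} :=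
      (isOpen_lt (hcont.comp continuous_fst) continuous_const).inter
        (isOpen_lt (hcont.comp continuous_snd) continuous_const)
    obtain ⟨c, h1, h2⟩ := hdense.inter_open_nonempty _ ho ⟨0, by simp [hm]⟩
    exact ⟨c.1, c.2, h2, h1⟩
  set c' := c - l c • e with hc'
  set d' := d - l d • e with hd''
  have hlc' : l c' = 0 := by simp [hc', hl]
  have hld' : l d' = 0 := by simp [hd'', hl]
  obtain ⟨f₁, hf₁, hff₁, hf₁b, hf₁g⟩ := exists_cutoff hf
    (g := fun x => P (j x.1, x.2) - max (l (P (j x.1, x.2))) 0 • c' +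
      max (-l (P (j x.1, x.2))) 0 • d')
    (by have := hP.continuous; fun_prop) b (ε := m / 2) (by positivity) (fun x => by
      calc _ = ‖(P (j x.1, x.2) - f x) + (max (-l (P (j x.1, x.2))) 0 • d' +
              -(max (l (P (j x.1, x.2))) 0 • c'))‖ := by congr 1; abel
        _ ≤ ‖P (j x.1, x.2) - f x‖ + (max (-l (P (j x.1, x.2))) 0 * ‖d'‖ +
              max (l (P (j x.1, x.2))) 0 * ‖c'‖) := by
            refine (norm_add_le _ _).trans (add_le_add_right ((norm_add_le _ _).trans ?_) _)
            rw [norm_neg, norm_smul, norm_smul, Real.norm_of_nonneg (le_max_right _ _),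
              Real.norm_of_nonneg (le_max_right _ _)]
        _ ≤ ‖P (j x.1, x.2) - f x‖ + (R * ‖d'‖ + R * ‖c'‖) := by
            gcongr
            · exact max_le ((neg_le_abs _).trans (hPR x)) hR.le
            · exact max_le ((le_abs_self _).trans (hPR x)) hR.le
        _ < m / 2 := by linarith [hPf x])
  have hgood : ∀ x, ∀ μ : ℝ, f₁ x = μ • e → f₁ x = P (j x.1, x.2) - max (l (P (j x.1, x.2))) 0 • c' +
      max (-l (P (j x.1, x.2))) 0 • d' := by
    intro x μ hx
    refine (hf₁g x).resolve_right fun h => ?_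
    rw [hx] at h
    linarith [hb μ]
  refine ⟨f₁, hf₁, fun p => (hff₁ p).trans_le (by linarith), hf₁b, ?_⟩
  intro u s t μ ν hμ hν hs ht
  have es := (hgood _ _ hs).symm.trans hs
  have et := (hgood (u, t) (-ν) (by rw [ht, neg_smul])).symm.trans ht
  have ls : l (P (j u, (s : ℝ))) = μ := by
    have := congrArg l es
    simpa [hl, hlc', hld'] using this
  have lt : l (P (j u, (t : ℝ))) = -ν := by
    have := congrArg l et
    simpa [hl, hlc', hld'] using this
  simp only [ls, lt, neg_neg, max_eq_left hμ, max_eq_left hν, max_eq_right (neg_nonpos.2 hμ),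
    max_eq_right (neg_nonpos.2 hν), zero_smul, add_zero, sub_zero] at es et
  have hμ0 : μ ≠ 0 := by
    rintro rfl
    exact hP0 u s (by simpa using es)
  have hν0 : ν ≠ 0 := by
    rintro rfl
    exact hP0 u t (by simpa using et)
  rw [sub_eq_iff_eq_add] at es
  rw [← eq_sub_iff_add_eq] at et
  apply hcd
  refine ⟨(j u, ((s : ℝ), (t : ℝ)), (l c - 1, l d - 1)), ⟨?_, ?_⟩, ?_⟩
  · simpa [ls] using hμ0
  · simpa [lt] using hν0
  · simp only [Φ, Prod.mk.injEq]
    constructor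
    · rw [ls, es, ← smul_add, smul_smul, inv_mul_cancel₀ hμ0, hc']; module
    · have : -(ν • e) - ν • d' = (-ν) • (e + d') := by module
      rw [lt, et, this, smul_smul, inv_mul_cancel₀ (neg_ne_zero.2 hν0), hd'']; module

end GeneralPosition

end

section

/-! ### Compression of maps into unitary groups -/

section Unitary
open Module
variable {𝕂 : Type*} [RCLike 𝕂] {ι : Type*} [Fintype ι] [DecidableEq ι]

/-- The unitary matrices fixing the basis vectors outside `J`. -/
def Uon (𝕂 : Type*) [RCLike 𝕂] {ι : Type*} [Fintype ι] [DecidableEq ι] (J : Finset ι) :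
    Submonoid (Matrix ι ι 𝕂) where
  carrier := {A | Aᴴ * A = 1 ∧ ∀ i ∉ J, ∀ k, A k i = (1 : Matrix ι ι 𝕂) k i}
  one_mem' := by simp
  mul_mem' := by
    rintro A B ⟨hA, hA'⟩ ⟨hB, hB'⟩
    refine ⟨?_, fun i hi k => ?_⟩
    · rw [conjTranspose_mul, Matrix.mul_assoc, ← Matrix.mul_assoc Aᴴ, hA, Matrix.one_mul, hB]
    · rw [Matrix.mul_apply]
      simp_rw [hB' i hi]
      rw [← Matrix.mul_apply, Matrix.mul_one, hA' i hi]

/-- The special unitary matrices fixing the basis vectors outside `J`. -/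
def SUon (𝕂 : Type*) [RCLike 𝕂] {ι : Type*} [Fintype ι] [DecidableEq ι] (J : Finset ι) :
    Submonoid (Matrix ι ι 𝕂) where
  carrier := {A | A ∈ Uon 𝕂 J ∧ A.det = 1}
  one_mem' := ⟨(Uon 𝕂 J).one_mem, det_one⟩
  mul_mem' := by
    rintro A B ⟨hA, hA'⟩ ⟨hB, hB'⟩
    exact ⟨(Uon 𝕂 J).mul_mem hA hB, by rw [det_mul, hA', hB', one_mul]⟩

theorem mem_SUon_iff {J : Finset ι} {A : Matrix ι ι 𝕂} :
    A ∈ SUon 𝕂 J ↔ (Aᴴ * A = 1 ∧ ∀ i ∉ J, ∀ k, A k i = (1 : Matrix ι ι 𝕂) k i) ∧ A.det = 1 :=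
  Iff.rfl

theorem Uon_mono {J J' : Finset ι} (h : J ⊆ J') : Uon 𝕂 J ≤ Uon 𝕂 J' :=
  fun _ hA => ⟨hA.1, fun i hi => hA.2 i (fun hJ => hi (h hJ))⟩

theorem SUon_mono {J J' : Finset ι} (h : J ⊆ J') : SUon 𝕂 J ≤ SUon 𝕂 J' :=
  fun _ hA => ⟨Uon_mono h hA.1, hA.2⟩

/-- A unitary matrix carrying the unit vector `x` to the unit vector `y ≠ -x`. -/
def rot (p : (ι → 𝕂) × (ι → 𝕂)) : Matrix ι ι 𝕂 :=
  1 - (1 + star p.2 ⬝ᵥ p.1)⁻¹ • vecMulVec (p.1 + p.2) (star (p.1 + p.2)) +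
    (2 : 𝕂) • vecMulVec p.2 (star p.1)

theorem rot_self {x : ι → 𝕂} (hx : star x ⬝ᵥ x = 1) : rot (x, x) = 1 := by
  unfold rot
  simp only [hx, star_add, add_vecMulVec, vecMulVec_add]
  have : ((1 : 𝕂) + 1)⁻¹ = 1 / 2 := by norm_num
  rw [this]
  module

theorem rot_mulVec {x y : ι → 𝕂} (hx : star x ⬝ᵥ x = 1)
    (h : 1 + star y ⬝ᵥ x ≠ 0) : rot (x, y) *ᵥ x = y := by
  unfold rot
  simp only [add_mulVec, sub_mulVec, one_mulVec, smul_mulVec, vecMulVec_mulVec, star_add,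
    add_dotProduct, hx]
  simp only [op_smul_eq_smul, smul_smul, inv_mul_cancel₀ h]
  module

theorem star_dot (x y : ι → 𝕂) : star (star y ⬝ᵥ x) = star x ⬝ᵥ y := by
  simp [dotProduct, mul_comm]

theorem rot_unitary {x y : ι → 𝕂} (hx : star x ⬝ᵥ x = 1) (hy : star y ⬝ᵥ y = 1)
    (h : 1 + star y ⬝ᵥ x ≠ 0) : (rot (x, y))ᴴ * rot (x, y) = 1 := by
  have hc : star (star y ⬝ᵥ x) = star x ⬝ᵥ y := star_dot x y
  have h' : 1 + star x ⬝ᵥ y ≠ 0 := by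
    intro h0
    apply h
    have := congrArg star h0
    rw [star_add, star_one, star_dot, star_zero] at this
    exact this
  unfold rot
  simp only [conjTranspose_add, conjTranspose_sub, conjTranspose_one, conjTranspose_smul,
    conjTranspose_vecMulVec, star_star, star_inv₀, star_add, star_one, hc]
  simp only [add_mul, sub_mul, mul_add, mul_sub, one_mul, mul_one, smul_mul_assoc, mul_smul_comm,
    add_vecMulVec, vecMulVec_add, vecMulVec_mul_vecMulVec, smul_add, smul_sub, smul_smul,
    vecMulVec_smul, hx, hy, RCLike.star_def, map_ofNat]
  have e1 : (1 + star y ⬝ᵥ x)⁻¹ * (1 + star y ⬝ᵥ x) = 1 := inv_mul_cancel₀ h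
  have e2 : (1 + star x ⬝ᵥ y)⁻¹ * (1 + star x ⬝ᵥ y) = 1 := inv_mul_cancel₀ h'
  generalize (1 + star y ⬝ᵥ x)⁻¹ = s at *
  generalize (1 + star x ⬝ᵥ y)⁻¹ = r at *
  generalize star y ⬝ᵥ x = c at *
  generalize star x ⬝ᵥ y = d at *
  generalize vecMulVec x (star x) = A
  generalize vecMulVec x (star y) = B
  generalize vecMulVec y (star x) = D
  generalize vecMulVec y (star y) = E
  match_scalars
  · ring
  · linear_combination (r - 2) * e1 + (s - 2) * e2
  · linear_combination r * e1 + (s - 2) * e2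
  · linear_combination (r - 2) * e1 + s * e2
  · linear_combination r * e1 + s * e2

theorem rot_mem_Uon {J : Finset ι} {x y : ι → 𝕂} (hx : star x ⬝ᵥ x = 1) (hy : star y ⬝ᵥ y = 1)
    (h : 1 + star y ⬝ᵥ x ≠ 0) (hxJ : ∀ i ∉ J, x i = 0) (hyJ : ∀ i ∉ J, y i = 0) :
    rot (x, y) ∈ Uon 𝕂 J := by
  refine ⟨rot_unitary hx hy h, fun i hi k => ?_⟩
  simp [rot, vecMulVec_apply, hxJ i hi, hyJ i hi]

/-- The diagonal matrix with entry `d` at `a` and `1` elsewhere. -/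
def diagAt (a : ι) (d : 𝕂) : Matrix ι ι 𝕂 := diagonal (Function.update 1 a d)

theorem det_diagAt (a : ι) (d : 𝕂) : (diagAt a d).det = d := by
  rw [diagAt, det_diagonal, Finset.prod_update_of_mem (Finset.mem_univ a)]
  simp

theorem diagAt_one (a : ι) : diagAt a (1 : 𝕂) = 1 := by
  rw [diagAt, ← Pi.one_apply (M := fun _ : ι => 𝕂) a, Function.update_eq_self]
  exact diagonal_one

theorem continuous_diagAt (a : ι) : Continuous (diagAt (𝕂 := 𝕂) a) := by
  unfold diagAt
  fun_prop

theorem diagAt_mem_Uon {J : Finset ι} {a : ι} (ha : a ∈ J) {d : 𝕂} (hd : star d * d = 1) :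
    diagAt a d ∈ Uon 𝕂 J := by
  refine ⟨?_, fun i hi k => ?_⟩
  · rw [diagAt, diagonal_conjTranspose, diagonal_mul_diagonal, ← diagonal_one]
    congr 1
    ext i
    by_cases h : i = a
    · subst h; simpa using hd
    · simp [h]
  · have : i ≠ a := fun h => hi (h ▸ ha)
    by_cases hk : k = i
    · subst hk; simp [diagAt, this]
    · simp [diagAt, hk]

theorem diagAt_mulVec_single {a m : ι} (h : m ≠ a) (d : 𝕂) :
    diagAt a d *ᵥ Pi.single m 1 = Pi.single m 1 := by
  ext k
  by_cases hk : k = m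
  · subst hk; simp [diagAt, h]
  · simp [diagAt, hk]

theorem Uon_apply_eq_zero {J : Finset ι} {A : Matrix ι ι 𝕂} (hA : A ∈ Uon 𝕂 J) {i m : ι}
    (hi : i ∉ J) (hm : m ∈ J) : A i m = 0 := by
  have h := congrFun (congrFun hA.1 i) m
  have him : i ≠ m := fun h => hi (h ▸ hm)
  rw [mul_apply, one_apply_ne him] at h
  simp only [conjTranspose_apply, hA.2 i hi] at h
  rw [Finset.sum_eq_single i] at h
  · simpa using h
  · intro b _ hb; simp [hb]
  · simp

theorem star_mulVec_dot {A : Matrix ι ι 𝕂} (hA : Aᴴ * A = 1) (x y : ι → 𝕂) :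
    star (A *ᵥ x) ⬝ᵥ (A *ᵥ y) = star x ⬝ᵥ y := by
  rw [star_mulVec, dotProduct_mulVec, vecMul_vecMul, hA, vecMul_one]

theorem star_det_mul_det {A : Matrix ι ι 𝕂} (hA : Aᴴ * A = 1) : star A.det * A.det = 1 := by
  rw [← det_conjTranspose, ← det_mul, hA, det_one]

/-- Normalisation of a vector. -/
def nrm (v : ι → 𝕂) : ι → 𝕂 := ((√(∑ i, ‖v i‖ ^ 2))⁻¹ : ℝ) • v

theorem star_dot_self (v : ι → 𝕂) : star v ⬝ᵥ v = ((∑ i, ‖v i‖ ^ 2 : ℝ) : 𝕂) := by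
  simp [dotProduct, RCLike.conj_mul]

theorem sum_norm_sq_pos {v : ι → 𝕂} (hv : v ≠ 0) : 0 < ∑ i, ‖v i‖ ^ 2 := by
  obtain ⟨i, hi⟩ := Function.ne_iff.1 hv
  exact Finset.sum_pos' (fun _ _ => by positivity) ⟨i, Finset.mem_univ _, by
    have := norm_pos_iff.2 hi; positivity⟩

theorem star_nrm_dot_nrm {v : ι → 𝕂} (hv : v ≠ 0) : star (nrm v) ⬝ᵥ nrm v = 1 := by
  have h := sum_norm_sq_pos hv
  rw [star_dot_self]
  simp only [nrm, Pi.smul_apply, norm_smul, mul_pow, ← Finset.mul_sum]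
  rw [Real.norm_of_nonneg (by positivity), inv_pow, Real.sq_sqrt h.le, inv_mul_cancel₀ h.ne']
  simp

theorem nrm_eq_self {v : ι → 𝕂} (hv : star v ⬝ᵥ v = 1) : nrm v = v := by
  rw [star_dot_self] at hv
  have : ∑ i, ‖v i‖ ^ 2 = 1 := by exact_mod_cast hv
  simp [nrm, this]

theorem continuousOn_nrm : ContinuousOn (nrm (𝕂 := 𝕂) (ι := ι)) {v | v ≠ 0} := by
  have h1 : Continuous fun v : ι → 𝕂 => √(∑ i, ‖v i‖ ^ 2) := by fun_prop
  unfold nrm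
  refine ContinuousOn.smul (ContinuousOn.inv₀ h1.continuousOn ?_) continuousOn_id
  intro v hv
  exact (Real.sqrt_pos.2 (sum_norm_sq_pos hv)).ne'

theorem exists_compress_step {X E : Type*} [TopologicalSpace X] [CompactSpace X]
    [NormedAddCommGroup E] [NormedSpace ℝ E] [FiniteDimensional ℝ E] {j : X → E}
    (hj : Continuous j) (hji : Function.Injective j) {J : Finset ι} {m a : ι} (hm : m ∉ J)
    (ha : a ∈ J) (hd : finrank ℝ E + 1 < (J.card + 1) * finrank ℝ 𝕂) {g : X → Matrix ι ι 𝕂}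
    (hg : Continuous g) (hgJ : ∀ x, g x ∈ SUon 𝕂 (insert m J)) :
    ∃ g' : X → Matrix ι ι 𝕂, (∀ x, g' x ∈ SUon 𝕂 J) ∧
      HRel (SUon 𝕂 (insert m J) : Set (Matrix ι ι 𝕂)) {x | g x ∈ SUon 𝕂 J} g g' := by
  have ham : m ≠ a := fun h => hm (h ▸ ha)
  have hmJ : m ∈ insert m J := Finset.mem_insert_self _ _
  let V := ↥(insert m J) → 𝕂
  have hV : finrank ℝ V = (J.card + 1) * finrank ℝ 𝕂 := by
    simp only [V]
    rw [finrank_pi_fintype]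
    rw [Finset.sum_const, Finset.card_univ, Fintype.card_coe, Finset.card_insert_of_notMem hm,
      smul_eq_mul]
  let ex : V → ι → 𝕂 := fun v i => if h : i ∈ insert m J then v ⟨i, h⟩ else 0
  have hex : Continuous ex := by
    refine continuous_pi fun i => ?_
    by_cases h : i ∈ insert m J
    · simp only [ex, h, dite_true]; fun_prop
    · simp only [ex, h, dite_false]; fun_prop
  have hex0 : ∀ v : V, v ≠ 0 → ex v ≠ 0 := by
    intro v hv h0
    apply hv
    ext i
    have := congrFun h0 i
    simp only [ex] at this
    rwa [dif_pos i.2] at this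
  let f : X → V := fun x i => g x i m
  have hexf : ∀ x, ex (f x) = g x *ᵥ Pi.single m 1 := by
    intro x
    ext i
    by_cases h : i ∈ insert m J
    · simp only [ex]; rw [dif_pos h]; simp [f]
    · simp only [ex]; rw [dif_neg h]; simp [Uon_apply_eq_zero (hgJ x).1 h hmJ]
  have hu1 : star (Pi.single m 1 : ι → 𝕂) ⬝ᵥ Pi.single m 1 = 1 := by simp
  have hunit : ∀ x, star (ex (f x)) ⬝ᵥ ex (f x) = 1 := by
    intro x
    rw [hexf, star_mulVec_dot (hgJ x).1.1, hu1]
  let b : V := fun i => (Pi.single m 1 : ι → 𝕂) i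
  have hexb : ex b = Pi.single m 1 := by
    ext i
    by_cases h : i ∈ insert m J
    · simp only [ex]; rw [dif_pos h]
    · have : i ≠ m := fun h' => h (h' ▸ hmJ)
      simp only [ex, h, dite_false]; rw [Pi.single_eq_of_ne this]
  have hb : b ≠ 0 := by
    intro h
    have : (Pi.single m 1 : ι → 𝕂) m = 0 := congrFun h ⟨m, hmJ⟩
    simp at this
  obtain ⟨F, hF, hF0, hF1, hFn, hFC⟩ := hrel_const_of_finrank hj hji (hV ▸ hd) (f := f)
    (by fun_prop) (fun x h => by
      have := hunit x
      rw [h] at this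
      have e0 : ex 0 = 0 := by
        ext i
        by_cases hi : i ∈ insert m J
        · simp only [ex]; rw [dif_pos hi]; rfl
        · simp only [ex]; rw [dif_neg hi]; rfl
      simp [e0] at this) hb
  let h : X × I → ι → 𝕂 := fun p => nrm (ex (F p))
  have hh : Continuous h :=
    continuousOn_nrm.comp_continuous (hex.comp hF) (fun p => hex0 _ (hFn p))
  have hh0 : ∀ x, h (x, 0) = g x *ᵥ Pi.single m 1 := by
    intro x
    simp only [h, hF0]; rw [nrm_eq_self (hunit x), hexf]
  have hh1 : ∀ x, h (x, 1) = Pi.single m 1 := by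
    intro x
    simp only [h, hF1, hexb, nrm_eq_self hu1]
  obtain ⟨γ, hγ, hγ0, hγQ, hγA, hγC⟩ := exists_transport
    (fun (A : Matrix ι ι 𝕂) (x y : ι → 𝕂) => A *ᵥ x = y) (Uon 𝕂 (insert m J))
    {x | star x ⬝ᵥ x = 1 ∧ ∀ i ∉ insert m J, x i = 0} {p | 1 + star p.2 ⬝ᵥ p.1 ≠ 0}
    (isOpen_ne_fun (by fun_prop) (by fun_prop)) rot
    (by
      unfold rot
      refine ContinuousOn.add (ContinuousOn.sub (by fun_prop) (ContinuousOn.smul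
        (ContinuousOn.inv₀ (by fun_prop) fun p hp => hp) ?_)) ?_
      all_goals
        refine Continuous.continuousOn ?_
        refine continuous_matrix fun i j => ?_
        simp only [vecMulVec_apply, Matrix.smul_apply]
        fun_prop)
    (by
      rintro x ⟨hx, -⟩
      change 1 + star x ⬝ᵥ x ≠ 0
      rw [hx]; norm_num)
    (fun x hx => rot_self hx.1)
    (fun x hx y hy hxy => rot_mem_Uon hx.1 hy.1 hxy hx.2 hy.2)
    (fun x hx y hy hxy => rot_mulVec hx.1 hxy)
    (fun x hx => one_mulVec x)
    (fun A B x y z hA hB => by rw [← mulVec_mulVec, hA, hB])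
    h hh (fun p => ⟨star_nrm_dot_nrm (hex0 _ (hFn p)), fun i hi => by simp [h, nrm, ex, hi, -Finset.mem_insert]⟩)
  have hmem : ∀ p : X × I, γ p * g p.1 * diagAt a (star (γ p).det) ∈ SUon 𝕂 (insert m J) := by
    intro p
    have hdet := star_det_mul_det (hγQ p).1
    refine ⟨(Uon 𝕂 _).mul_mem ((Uon 𝕂 _).mul_mem (hγQ p) (hgJ p.1).1) (diagAt_mem_Uon
      (Finset.mem_insert_of_mem ha) (by rw [star_star, mul_comm, hdet])), ?_⟩
    rw [det_mul, det_mul, det_diagAt, (hgJ p.1).2, mul_one, mul_comm, hdet]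
  refine ⟨fun x => γ (x, 1) * g x * diagAt a (star (γ (x, 1)).det), fun x => ?_,
    fun p => γ p * g p.1 * diagAt a (star (γ p).det), ?_, ?_, fun x => rfl, hmem, ?_⟩
  · have H := hmem (x, 1)
    refine ⟨⟨H.1.1, fun i hi k => ?_⟩, H.2⟩
    by_cases him : i = m
    · have e : (γ (x, 1) * g x * diagAt a (star (γ (x, 1)).det)) *ᵥ Pi.single m 1
          = Pi.single m 1 := by
        rw [← mulVec_mulVec, diagAt_mulVec_single ham, ← mulVec_mulVec, ← hh0, ← hh1 x]
        exact hγA x 1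
      have e' := congrFun e k
      rw [mulVec_single_one] at e'
      subst him
      rw [one_apply]
      simpa [Pi.single_apply] using e'
    · exact H.1.2 i (by simp [him, hi]) k
  · have := continuous_diagAt (𝕂 := 𝕂) a
    refine (hγ.mul (hg.comp continuous_fst)).mul (this.comp ?_)
    exact hγ.matrix_det.star
  · intro x; simp [hγ0, diagAt_one]
  · intro x hx t
    have hfb : f x = b := by
      ext i
      simp only [f, b]
      rw [hx.1.2 m hm, one_apply, Pi.single_apply]
    have : ∀ t, h (x, t) = h (x, 0) := fun t => by simp only [h, hFC x hfb t, hF0]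
    simp [hγC x this t, diagAt_one]

theorem exists_compress {X E : Type*} [TopologicalSpace X] [CompactSpace X]
    [NormedAddCommGroup E] [NormedSpace ℝ E] [FiniteDimensional ℝ E] {j : X → E}
    (hj : Continuous j) (hji : Function.Injective j) {J₀ J : Finset ι} (hJ : J₀ ⊆ J)
    (h₀ : J₀.Nonempty) (hd : finrank ℝ E + 1 < (J₀.card + 1) * finrank ℝ 𝕂)
    {g : X → Matrix ι ι 𝕂} (hg : Continuous g) (hgJ : ∀ x, g x ∈ SUon 𝕂 J) :
    ∃ g' : X → Matrix ι ι 𝕂, (∀ x, g' x ∈ SUon 𝕂 J₀) ∧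
      HRel (SUon 𝕂 J : Set (Matrix ι ι 𝕂)) {x | g x ∈ SUon 𝕂 J₀} g g' := by
  obtain ⟨a, ha⟩ := h₀
  suffices ∀ K : Finset ι, Disjoint J₀ K → ∀ g : X → Matrix ι ι 𝕂, Continuous g →
      (∀ x, g x ∈ SUon 𝕂 (J₀ ∪ K)) → ∃ g' : X → Matrix ι ι 𝕂, (∀ x, g' x ∈ SUon 𝕂 J₀) ∧
      HRel (SUon 𝕂 (J₀ ∪ K) : Set (Matrix ι ι 𝕂)) {x | g x ∈ SUon 𝕂 J₀} g g' by
    have := this (J \ J₀) Finset.disjoint_sdiff g hg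
    rw [Finset.union_sdiff_of_subset hJ] at this
    exact this hgJ
  intro K
  induction K using Finset.induction with
  | empty =>
    intro _ g hg hgJ
    rw [Finset.union_empty] at *
    exact ⟨g, hgJ, HRel.refl hg hgJ⟩
  | insert m K hmK ih =>
    intro hdis g hg hgJ
    rw [Finset.disjoint_insert_right] at hdis
    rw [Finset.union_insert] at *
    have hm : m ∉ J₀ ∪ K := by simp [hdis.1, hmK]
    obtain ⟨g₁, hg₁, H₁⟩ := exists_compress_step hj hji hm (Finset.mem_union_left _ ha)
      (hd.trans_le (Nat.mul_le_mul_right _ (Nat.add_le_add_right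
        (Finset.card_le_card Finset.subset_union_left) 1))) hg hgJ
    obtain ⟨g₂, hg₂, H₂⟩ := ih hdis.2 g₁ H₁.continuous_right hg₁
    refine ⟨g₂, hg₂, (H₁.mono subset_rfl fun x hx => SUon_mono Finset.subset_union_left hx).trans
      (H₂.mono (SUon_mono (Finset.subset_insert _ _)) fun x hx => ?_)⟩
    have := H₁.eqOn x (SUon_mono Finset.subset_union_left hx)
    change g₁ x ∈ SUon 𝕂 J₀
    rw [this]; exact hx

end Unitary

end

section

/-! ### Square roots and transport of symmetric unitary matrices -/

theorem exists_sqrt_normed (𝔸 : Type*) [NormedRing 𝔸] [NormedAlgebra ℝ 𝔸] [CompleteSpace 𝔸] :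
    ∃ (U V : Set 𝔸) (ρ : 𝔸 → 𝔸), IsOpen U ∧ IsOpen V ∧ 1 ∈ U ∧ ContinuousOn ρ U ∧ ρ 1 = 1 ∧
      (∀ u ∈ U, ρ u ∈ V) ∧ (∀ u ∈ U, ρ u * ρ u = u) ∧
      ∀ a ∈ V, ∀ b ∈ V, a * a = b * b → a = b := by
  let e : 𝔸 ≃L[ℝ] 𝔸 := ContinuousLinearEquiv.smulLeft (Units.mk0 (2 : ℝ) two_ne_zero)
  have h : HasStrictFDerivAt (fun x : 𝔸 => x * x) (e : 𝔸 →L[ℝ] 𝔸) 1 := by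
    have := (hasStrictFDerivAt_id (𝕜 := ℝ) (1 : 𝔸)).mul' (hasStrictFDerivAt_id (𝕜 := ℝ) (1 : 𝔸))
    refine this.congr_fderiv ?_
    ext x
    simp [e, two_smul, Units.smul_def]
  let Φ := h.toOpenPartialHomeomorph
  have h1 : (1 : 𝔸) ∈ Φ.source := h.mem_toOpenPartialHomeomorph_source
  have hΦ : ∀ x, Φ x = x * x := fun x => rfl
  have h2 : Φ 1 = 1 := by rw [hΦ, mul_one]
  refine ⟨Φ.target, Φ.source, Φ.symm, Φ.open_target, Φ.open_source, h2 ▸ Φ.map_source h1,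
    Φ.continuousOn_symm, ?_, fun u hu => Φ.map_target hu, fun u hu => ?_, fun a ha b hb hab => ?_⟩
  · conv_lhs => rw [← h2]
    exact Φ.left_inv h1
  · rw [← hΦ, Φ.right_inv hu]
  · exact Φ.injOn ha hb hab

variable {ι : Type*} [Fintype ι] [DecidableEq ι]

theorem exists_sqrt_matrix :
    ∃ (U V : Set (Matrix ι ι ℂ)) (ρ : Matrix ι ι ℂ → Matrix ι ι ℂ), IsOpen U ∧ IsOpen V ∧ 1 ∈ U ∧
      ContinuousOn ρ U ∧ ρ 1 = 1 ∧ (∀ u ∈ U, ρ u ∈ V) ∧ (∀ u ∈ U, ρ u * ρ u = u) ∧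
      ∀ a ∈ V, ∀ b ∈ V, a * a = b * b → a = b := by
  let e : Matrix ι ι ℂ ≃ₐ[ℂ] (EuclideanSpace ℂ ι →L[ℂ] EuclideanSpace ℂ ι) :=
    (toEuclideanCLM (n := ι) (𝕜 := ℂ)).toAlgEquiv
  have he : Continuous e := e.toLinearMap.continuous_of_finiteDimensional
  have he' : Continuous e.symm := e.symm.toLinearMap.continuous_of_finiteDimensional
  obtain ⟨U, V, ρ, hU, hV, h1, hρ, hρ1, hUV, hsq, hinj⟩ :=
    exists_sqrt_normed (EuclideanSpace ℂ ι →L[ℂ] EuclideanSpace ℂ ι)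
  refine ⟨e ⁻¹' U, e ⁻¹' V, fun x => e.symm (ρ (e x)), hU.preimage he, hV.preimage he, by simpa,
    he'.comp_continuousOn (hρ.comp he.continuousOn fun _ h => h), by simp [hρ1], fun u hu => ?_,
    fun u hu => ?_, fun a ha b hb hab => ?_⟩
  · simpa using hUV _ hu
  · rw [← map_mul, hsq _ hu, e.symm_apply_apply]
  · apply e.injective
    apply hinj _ ha _ hb
    rw [← map_mul, hab, map_mul]

/-- The matrices `A Aᵀ` with `A` special unitary. -/
def SymT (ι : Type*) [Fintype ι] [DecidableEq ι] : Set (Matrix ι ι ℂ) :=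
  {S | ∃ A ∈ SUon ℂ (Finset.univ : Finset ι), S = A * Aᵀ}

theorem mem_SUon_univ {A : Matrix ι ι ℂ} :
    A ∈ SUon ℂ (Finset.univ : Finset ι) ↔ Aᴴ * A = 1 ∧ A.det = 1 := by
  simp [mem_SUon_iff]

theorem transpose_mul_conj {A : Matrix ι ι ℂ} (h : Aᴴ * A = 1) : Aᵀ * Aᵀᴴ = 1 := by
  have := congrArg transpose h
  rw [transpose_mul, transpose_one] at this
  exact this

theorem SymT_props {S : Matrix ι ι ℂ} (h : S ∈ SymT ι) :
    Sᵀ = S ∧ Sᴴ * S = 1 ∧ S * Sᴴ = 1 ∧ S.det = 1 := by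
  obtain ⟨A, hA, rfl⟩ := h
  rw [mem_SUon_univ] at hA
  have h1 : Aᴴ * A = 1 := hA.1
  have h2 : (A * Aᵀ)ᴴ * (A * Aᵀ) = 1 := by
    rw [conjTranspose_mul, Matrix.mul_assoc, ← Matrix.mul_assoc Aᴴ, h1, Matrix.one_mul]
    exact mul_eq_one_comm.1 (transpose_mul_conj h1)
  refine ⟨by rw [transpose_mul, transpose_transpose], h2, mul_eq_one_comm.1 h2, ?_⟩
  rw [det_mul, det_transpose, hA.2, one_mul]

theorem exists_sym_transport (ι : Type*) [Fintype ι] [DecidableEq ι] :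
    ∃ (W : Set (Matrix ι ι ℂ × Matrix ι ι ℂ)) (s : Matrix ι ι ℂ × Matrix ι ι ℂ → Matrix ι ι ℂ),
      IsOpen W ∧ ContinuousOn s W ∧ (∀ S ∈ SymT ι, (S, S) ∈ W) ∧ (∀ S ∈ SymT ι, s (S, S) = 1) ∧
      ∀ S ∈ SymT ι, ∀ S' ∈ SymT ι, (S, S') ∈ W →
        s (S, S') ∈ SUon ℂ (Finset.univ : Finset ι) ∧ s (S, S') * S * (s (S, S'))ᵀ = S' := by
  obtain ⟨U, V, ρ, hU, hV, h1, hρ, hρ1, hUV, hsq, hinj⟩ := exists_sqrt_matrix (ι := ι)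
  have h1V : 1 ∈ V := hρ1 ▸ hUV 1 h1
  let W₀ : Set (Matrix ι ι ℂ × Matrix ι ι ℂ) := {p | p.2 * p.1ᴴ ∈ U}
  have hW₀ : IsOpen W₀ := hU.preimage (by fun_prop)
  let s : Matrix ι ι ℂ × Matrix ι ι ℂ → Matrix ι ι ℂ := fun p => ρ (p.2 * p.1ᴴ)
  have hs : ContinuousOn s W₀ := hρ.comp (by fun_prop) (fun p hp => hp)
  let O : Set (Matrix ι ι ℂ × Matrix ι ι ℂ) :=
    {q | q.2ᴴ ∈ V ∧ q.2 * q.2ᴴ * q.2ᴴ ∈ V ∧ q.1 * q.2ᵀ * q.1ᴴ ∈ V ∧ q.2.det ≠ -1}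
  have hO : IsOpen O := by
    refine IsOpen.inter (hV.preimage (by fun_prop)) (IsOpen.inter (hV.preimage (by fun_prop))
      (IsOpen.inter (hV.preimage (by fun_prop)) (isOpen_ne_fun ?_ continuous_const)))
    exact continuous_snd.matrix_det
  have hpair : ContinuousOn (fun p : Matrix ι ι ℂ × Matrix ι ι ℂ => (p.1, s p)) W₀ :=
    continuousOn_fst.prodMk hs
  have hs1 : ∀ S ∈ SymT ι, s (S, S) = 1 := fun S hS => by
    simp only [s]
    rw [(SymT_props hS).2.2.1, hρ1]
  refine ⟨W₀ ∩ (fun p => (p.1, s p)) ⁻¹' O, s, hpair.isOpen_inter_preimage hW₀ hO,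
    hs.mono Set.inter_subset_left, fun S hS => ?_, hs1, fun S hS S' hS' hW => ?_⟩
  · obtain ⟨-, -, h, -⟩ := SymT_props hS
    refine ⟨by change S * Sᴴ ∈ U; rwa [h], ?_⟩
    change (S, s (S, S)) ∈ O
    rw [hs1 S hS]
    refine ⟨by simpa, by simpa, by simpa [h], ?_⟩
    simp only [det_one]
    norm_num
  · obtain ⟨hW1, hg1, hg2, hg3, hg4⟩ := hW
    have hgV : s (S, S') ∈ V := hUV _ hW1
    have hgg : s (S, S') * s (S, S') = S' * Sᴴ := hsq _ hW1
    beta_reduce at hg1 hg2 hg3 hg4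
    simp only at hg1 hg2 hg3 hg4
    generalize s (S, S') = g at *
    obtain ⟨a1, a2, a3, a4⟩ := SymT_props hS
    obtain ⟨b1, b2, b3, b4⟩ := SymT_props hS'
    have hh : gᴴ * gᴴ = S * S'ᴴ := by
      rw [← conjTranspose_mul, hgg, conjTranspose_mul, conjTranspose_conjTranspose]
    have e1 : gᴴ * gᴴ * (g * g) = 1 := by
      rw [hh, hgg, Matrix.mul_assoc, ← Matrix.mul_assoc S'ᴴ, b2, Matrix.one_mul, a3]
    have e2 : g * g * (gᴴ * gᴴ) = 1 := mul_eq_one_comm.1 e1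
    have e3 : g * gᴴ * gᴴ * g = 1 := by
      apply mul_eq_one_comm.1
      rw [← e2]; simp only [Matrix.mul_assoc]
    have e4 : g * gᴴ * gᴴ = gᴴ := by
      apply hinj _ hg2 _ hg1
      calc g * gᴴ * gᴴ * (g * gᴴ * gᴴ) = (g * gᴴ * gᴴ * g) * (gᴴ * gᴴ) := by
            simp only [Matrix.mul_assoc]
        _ = gᴴ * gᴴ := by rw [e3, Matrix.one_mul]
    have hu : gᴴ * g = 1 := by rw [← e4]; exact e3
    have hSg : S * gᵀ * Sᴴ = g := by
      apply hinj _ hg3 _ hgV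
      calc S * gᵀ * Sᴴ * (S * gᵀ * Sᴴ) = S * gᵀ * (Sᴴ * S) * gᵀ * Sᴴ := by
            simp only [Matrix.mul_assoc]
        _ = S * (g * g)ᵀ * Sᴴ := by
            rw [a2, Matrix.mul_one, transpose_mul]; simp only [Matrix.mul_assoc]
        _ = S * Sᴴᵀ * S' * Sᴴ := by
            rw [hgg, transpose_mul, b1]; simp only [Matrix.mul_assoc]
        _ = g * g := by
            have : S * Sᴴᵀ = 1 := by
              have := congrArg transpose a2
              rw [transpose_mul, a1, transpose_one] at this
              exact this
            rw [this, Matrix.one_mul, hgg]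
    refine ⟨mem_SUon_univ.2 ⟨hu, ?_⟩, ?_⟩
    · have : g.det * g.det = 1 := by
        rw [← det_mul, hgg, det_mul, det_conjTranspose, a4, b4]; simp
      rcases mul_self_eq_one_iff.1 this with h | h
      · exact h
      · exact absurd h hg4
    · calc g * S * gᵀ = g * (S * gᵀ * Sᴴ) * S := by
            simp only [Matrix.mul_assoc]; rw [a2, Matrix.mul_one]
        _ = S' := by rw [hSg, hgg, Matrix.mul_assoc, a2, Matrix.mul_one]

end

section

/-! ### Block embeddings and complexification -/

section Emb
variable {𝕂 : Type*} [RCLike 𝕂] {ι κ μ : Type*} [Fintype ι] [DecidableEq ι] [Fintype κ]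
  [DecidableEq κ] [Fintype μ] [DecidableEq μ]

/-- The block embedding `B ↦ diag(B, 1)`, transported along a bijection of index sets. -/
def emb (e : κ ⊕ μ ≃ ι) : Matrix κ κ 𝕂 →* Matrix ι ι 𝕂 where
  toFun B := (fromBlocks B 0 0 1).submatrix e.symm e.symm
  map_one' := by simp
  map_mul' A B := by
    rw [submatrix_mul_equiv, fromBlocks_multiply]; simp

theorem emb_apply (e : κ ⊕ μ ≃ ι) (B : Matrix κ κ 𝕂) :
    emb e B = (fromBlocks B 0 0 1).submatrix e.symm e.symm := rfl

theorem emb_conjTranspose (e : κ ⊕ μ ≃ ι) (B : Matrix κ κ 𝕂) : emb e Bᴴ = (emb e B)ᴴ := by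
  simp [emb_apply, fromBlocks_conjTranspose]

theorem emb_det (e : κ ⊕ μ ≃ ι) (B : Matrix κ κ 𝕂) : (emb e B).det = B.det := by
  simp [emb_apply, det_submatrix_equiv_self]

@[fun_prop] theorem continuous_emb (e : κ ⊕ μ ≃ ι) : Continuous (emb e (𝕂 := 𝕂)) := by
  change Continuous fun B : Matrix κ κ 𝕂 => (fromBlocks B 0 0 1).submatrix e.symm e.symm
  exact (Continuous.matrix_fromBlocks continuous_id continuous_const continuous_const
    continuous_const).matrix_submatrix _ _

/-- The coordinates of the upper left block. -/
def embCoords (e : κ ⊕ μ ≃ ι) : Finset ι :=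
  Finset.univ.map ⟨fun i : κ => e (Sum.inl i), fun _ _ h => Sum.inl_injective (e.injective h)⟩

theorem card_embCoords (e : κ ⊕ μ ≃ ι) : (embCoords e).card = Fintype.card κ := by
  simp [embCoords]

theorem inr_notMem_embCoords (e : κ ⊕ μ ≃ ι) (j : μ) : e (Sum.inr j) ∉ embCoords e := by
  intro h
  obtain ⟨i, -, hi⟩ := Finset.mem_map.1 h
  exact Sum.inl_ne_inr (e.injective hi)

theorem inl_mem_embCoords (e : κ ⊕ μ ≃ ι) (j : κ) : e (Sum.inl j) ∈ embCoords e :=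
  Finset.mem_map.2 ⟨j, Finset.mem_univ _, rfl⟩

theorem mem_SUon_univ' {A : Matrix ι ι 𝕂} :
    A ∈ SUon 𝕂 (Finset.univ : Finset ι) ↔ Aᴴ * A = 1 ∧ A.det = 1 := by
  simp [mem_SUon_iff]

theorem emb_mem (e : κ ⊕ μ ≃ ι) {B : Matrix κ κ 𝕂} (hB : B ∈ SUon 𝕂 (Finset.univ : Finset κ)) :
    emb e B ∈ SUon 𝕂 (embCoords e) := by
  rw [mem_SUon_univ'] at hB
  refine ⟨⟨?_, fun i hi k => ?_⟩, by rw [emb_det, hB.2]⟩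
  · rw [← emb_conjTranspose, ← map_mul, hB.1, map_one]
  · obtain ⟨i, rfl⟩ := e.surjective i
    obtain ⟨k, rfl⟩ := e.surjective k
    rcases i with i | i
    · exact absurd (inl_mem_embCoords e i) hi
    · rcases k with k | k <;> simp [emb_apply, one_apply]

theorem emb_injective (e : κ ⊕ μ ≃ ι) : Function.Injective (emb e (𝕂 := 𝕂)) := by
  intro A B h
  ext i j
  have := congrFun (congrFun h (e (Sum.inl i))) (e (Sum.inl j))
  simpa [emb_apply] using this

/-- The upper left block. -/
def res (e : κ ⊕ μ ≃ ι) (A : Matrix ι ι 𝕂) : Matrix κ κ 𝕂 :=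
  A.submatrix (fun i => e (Sum.inl i)) (fun i => e (Sum.inl i))

@[fun_prop] theorem continuous_res (e : κ ⊕ μ ≃ ι) : Continuous (res e (𝕂 := 𝕂)) :=
  continuous_id.matrix_submatrix _ _

theorem emb_res (e : κ ⊕ μ ≃ ι) {A : Matrix ι ι 𝕂} (hA : A ∈ SUon 𝕂 (embCoords e)) :
    emb e (res e A) = A := by
  ext i j
  obtain ⟨i, rfl⟩ := e.surjective i
  obtain ⟨j, rfl⟩ := e.surjective j
  rcases j with j | j
  · rcases i with i | i
    · simp [emb_apply, res]
    · rw [Uon_apply_eq_zero hA.1 (inr_notMem_embCoords e i) (inl_mem_embCoords e j)]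
      simp [emb_apply, res]
  · rw [hA.1.2 _ (inr_notMem_embCoords e j)]
    rcases i with i | i <;> simp [emb_apply, one_apply]

theorem res_mem (e : κ ⊕ μ ≃ ι) {A : Matrix ι ι 𝕂} (hA : A ∈ SUon 𝕂 (embCoords e)) :
    res e A ∈ SUon 𝕂 (Finset.univ : Finset κ) := by
  rw [mem_SUon_univ']
  have h := emb_res e hA
  refine ⟨emb_injective e ?_, by rw [← emb_det e, h, hA.2]⟩
  rw [map_mul, emb_conjTranspose, h, map_one, hA.1.1]

theorem SUon_le_univ (J : Finset ι) : SUon 𝕂 J ≤ SUon 𝕂 (Finset.univ : Finset ι) :=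
  SUon_mono (Finset.subset_univ _)

/-- Complexification of real matrices. -/
abbrev cx : Matrix ι ι ℝ →+* Matrix ι ι ℂ := Complex.ofRealHom.mapMatrix

theorem cx_conjTranspose (A : Matrix ι ι ℝ) : cx Aᴴ = (cx A)ᴴ := by
  ext i j; simp

theorem cx_transpose (A : Matrix ι ι ℝ) : cx Aᵀ = (cx A)ᵀ := rfl

@[fun_prop] theorem continuous_cx : Continuous (cx (ι := ι)) :=
  continuous_id.matrix_map Complex.continuous_ofReal

theorem cx_mem {A : Matrix ι ι ℝ} (hA : A ∈ SUon ℝ (Finset.univ : Finset ι)) :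
    cx A ∈ SUon ℂ (Finset.univ : Finset ι) := by
  rw [mem_SUon_univ'] at *
  refine ⟨by rw [← cx_conjTranspose, ← map_mul, hA.1, map_one], ?_⟩
  rw [← RingHom.map_det, hA.2, map_one]

theorem cx_emb (e : κ ⊕ μ ≃ ι) (A : Matrix κ κ ℝ) : cx (emb e A) = emb e (cx A) := by
  ext i j
  obtain ⟨i, rfl⟩ := e.surjective i
  obtain ⟨j, rfl⟩ := e.surjective j
  rcases i with i | i <;> rcases j with j | j <;> simp [emb_apply, one_apply]

/-- A special unitary matrix with `A Aᵀ = 1` is real. -/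
theorem exists_real {A : Matrix ι ι ℂ} (hA : A ∈ SUon ℂ (Finset.univ : Finset ι))
    (h : A * Aᵀ = 1) :
    A.map Complex.re ∈ SUon ℝ (Finset.univ : Finset ι) ∧ cx (A.map Complex.re) = A := by
  rw [mem_SUon_univ'] at *
  have h1 : Aᵀ = Aᴴ := by
    calc Aᵀ = Aᴴ * A * Aᵀ := by rw [hA.1, Matrix.one_mul]
      _ = Aᴴ := by rw [Matrix.mul_assoc, h, Matrix.mul_one]
  have h2 : cx (A.map Complex.re) = A := by
    ext i j
    have := congrFun (congrFun h1 j) i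
    simp only [transpose_apply, conjTranspose_apply] at this
    exact Complex.conj_eq_iff_re.1 this.symm
  have hinj : Function.Injective (cx (ι := ι)) := by
    intro B C hBC
    ext i j
    exact Complex.ofReal_injective (congrFun (congrFun hBC i) j)
  refine ⟨⟨hinj ?_, Complex.ofReal_injective ?_⟩, h2⟩
  · rw [map_mul, cx_conjTranspose, h2, hA.1, map_one]
  · have := RingHom.map_det Complex.ofRealHom (A.map Complex.re)
    change Complex.ofRealHom _ = _
    rw [this, h2, hA.2, Complex.ofReal_one]

theorem cx_mul_transpose {A : Matrix ι ι ℝ} (hA : A ∈ SUon ℝ (Finset.univ : Finset ι)) :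
    cx A * (cx A)ᵀ = 1 := by
  rw [mem_SUon_univ'] at hA
  rw [← cx_transpose, ← map_mul, ← map_one cx]
  exact congrArg cx (mul_eq_one_comm.1 hA.1)

end Emb

end

section

/-! ### Quaternions and the orthogonal group in dimension four -/

open Quaternion

section Involution
variable {ι : Type*} [Fintype ι] [DecidableEq ι]

theorem SUon_conj_mem {U G : Matrix ι ι ℂ} (hU : Uᴴ * U = 1)
    (hG : G ∈ SUon ℂ (Finset.univ : Finset ι)) :
    U * G * Uᴴ ∈ SUon ℂ (Finset.univ : Finset ι) := by
  rw [mem_SUon_univ'] at *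
  have hU' : U * Uᴴ = 1 := mul_eq_one_comm.1 hU
  refine ⟨?_, ?_⟩
  · calc (U * G * Uᴴ)ᴴ * (U * G * Uᴴ) = U * Gᴴ * (Uᴴ * U) * G * Uᴴ := by
          simp only [conjTranspose_mul, conjTranspose_conjTranspose, Matrix.mul_assoc]
      _ = U * (Gᴴ * G) * Uᴴ := by rw [hU, Matrix.mul_one]; simp only [Matrix.mul_assoc]
      _ = 1 := by rw [hG.1, Matrix.mul_one, hU']
  · rw [det_mul, det_mul, hG.2, mul_one, ← det_mul, hU', det_one]

/-- Conjugation by a Hermitian involution is homotopic to the identity. -/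
theorem HRel.conj_involution {X : Type*} [TopologicalSpace X] {C : Set X} {G : X → Matrix ι ι ℂ}
    {V : Matrix ι ι ℂ} (hV : Vᴴ = V) (hVV : V * V = 1) (hG : Continuous G)
    (hGS : ∀ x, G x ∈ SUon ℂ (Finset.univ : Finset ι)) (hGC : ∀ x ∈ C, G x = 1) :
    HRel (SUon ℂ (Finset.univ : Finset ι) : Set (Matrix ι ι ℂ)) C G (fun x => V * G x * V) := by
  let z : I → ℂ := fun t => Complex.exp (Real.pi * t * Complex.I)
  let U : I → Matrix ι ι ℂ := fun t => (1 / 2 : ℂ) • (1 + V) + (z t / 2) • (1 - V)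
  have hz : ∀ t, star (z t) * z t = 1 := by
    intro t
    simp only [z, Complex.star_def, ← Complex.exp_conj]
    simp [← Complex.exp_add]
  have hUU : ∀ t, (U t)ᴴ * U t = 1 := by
    intro t
    have h2 : (2 : ℂ)⁻¹ * 2 = 1 := by norm_num
    simp only [U, conjTranspose_add, conjTranspose_smul, conjTranspose_sub, conjTranspose_one, hV]
    have e1 : (1 + V) * (1 + V) = (2 : ℂ) • (1 + V) := by
      simp only [mul_add, add_mul, hVV, mul_one, one_mul]; module
    have e2 : (1 - V) * (1 - V) = (2 : ℂ) • (1 - V) := by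
      simp only [mul_sub, sub_mul, hVV, mul_one, one_mul]; module
    have e3 : (1 + V) * (1 - V) = 0 := by
      simp only [mul_sub, add_mul, hVV, mul_one, one_mul]; module
    have e4 : (1 - V) * (1 + V) = 0 := by
      simp only [mul_add, sub_mul, hVV, mul_one, one_mul]; module
    simp only [add_mul, mul_add, smul_mul_smul_comm] at *
    simp only [e1, e2, e3, e4]
    have hz' := hz t
    generalize z t = w at *
    simp only [star_div₀, smul_zero, smul_smul, star_one, star_ofNat]
    match_scalars
    · linear_combination (1 / 2) * hz'
    · linear_combination (-1 / 2) * hz'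
  have hUc : Continuous U := by fun_prop
  refine ⟨fun p => U p.2 * G p.1 * (U p.2)ᴴ, by fun_prop, fun x => ?_, fun x => ?_,
    fun p => SUon_conj_mem (hUU _) (hGS _), fun x hx t => ?_⟩
  · have : U 0 = 1 := by
      simp only [U, z]; simp; module
    simp [this]
  · have : U 1 = V := by
      simp only [U, z]; simp; module
    simp [this, hV]
  · simp only [hGC x hx, Matrix.mul_one]
    exact mul_eq_one_comm.1 (hUU t)

end Involution

/-- The quaternion with the given components. -/
def quat (a b c d : ℝ) : ℍ[ℝ] := ⟨a, b, c, d⟩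

@[simp] theorem quat_re (a b c d : ℝ) : (quat a b c d).re = a := rfl
@[simp] theorem quat_imI (a b c d : ℝ) : (quat a b c d).imI = b := rfl
@[simp] theorem quat_imJ (a b c d : ℝ) : (quat a b c d).imJ = c := rfl
@[simp] theorem quat_imK (a b c d : ℝ) : (quat a b c d).imK = d := rfl

/-- The embedding of the quaternions into complex `2 × 2` matrices. -/
def psi : ℍ[ℝ] →* Matrix (Fin 2) (Fin 2) ℂ where
  toFun q := !![⟨q.re, q.imI⟩, ⟨q.imJ, q.imK⟩; ⟨-q.imJ, q.imK⟩, ⟨q.re, -q.imI⟩]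
  map_one' := by
    ext i j; fin_cases i <;> fin_cases j <;> apply Complex.ext <;> simp
  map_mul' p q := by
    ext i j; fin_cases i <;> fin_cases j <;> apply Complex.ext <;>
      simp [Matrix.mul_apply, Fin.sum_univ_two] <;> ring

theorem psi_apply (q : ℍ[ℝ]) :
    psi q = !![⟨q.re, q.imI⟩, ⟨q.imJ, q.imK⟩; ⟨-q.imJ, q.imK⟩, ⟨q.re, -q.imI⟩] := rfl

@[fun_prop] theorem continuous_psi : Continuous psi := by
  have h : ∀ f g : ℍ[ℝ] → ℝ, Continuous f → Continuous g →
      Continuous fun q => (⟨f q, g q⟩ : ℂ) := by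
    intro f g hf hg
    have : (fun q => (⟨f q, g q⟩ : ℂ)) = fun q => (f q : ℂ) + g q * Complex.I := by
      ext q; apply Complex.ext <;> simp
    rw [this]; fun_prop
  refine continuous_matrix fun i j => ?_
  fin_cases i <;> fin_cases j
  · exact h _ _ continuous_re continuous_imI
  · exact h _ _ continuous_imJ continuous_imK
  · exact h _ _ continuous_imJ.neg continuous_imK
  · exact h _ _ continuous_re continuous_imI.neg

theorem psi_star (q : ℍ[ℝ]) : psi (star q) = (psi q)ᴴ := by
  ext i j; fin_cases i <;> fin_cases j <;> apply Complex.ext <;> simp [psi_apply]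

/-- The unit quaternions. -/
def S3 : Submonoid ℍ[ℝ] where
  carrier := {q | ‖q‖ = 1}
  one_mem' := norm_one
  mul_mem' {a b} ha hb := by
    change ‖a * b‖ = 1
    rw [norm_mul, show ‖a‖ = 1 from ha, show ‖b‖ = 1 from hb, mul_one]

theorem mem_S3 {q : ℍ[ℝ]} : q ∈ S3 ↔ ‖q‖ = 1 := Iff.rfl

theorem mem_S3_iff_normSq {q : ℍ[ℝ]} : q ∈ S3 ↔ normSq q = 1 := by
  rw [mem_S3, Quaternion.normSq_eq_norm_mul_self]
  constructor
  · intro h; rw [h, one_mul]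
  · intro h; nlinarith [norm_nonneg q]

theorem S3.star_mul {q : ℍ[ℝ]} (h : q ∈ S3) : star q * q = 1 := by
  rw [star_mul_self, mem_S3_iff_normSq.1 h]; rfl

theorem S3.mul_star {q : ℍ[ℝ]} (h : q ∈ S3) : q * star q = 1 := by
  rw [self_mul_star, mem_S3_iff_normSq.1 h]; rfl

theorem S3.star_mem {q : ℍ[ℝ]} (h : q ∈ S3) : star q ∈ S3 := by
  rw [mem_S3, norm_star]; exact h

theorem psi_mem {q : ℍ[ℝ]} (h : q ∈ S3) : psi q ∈ SUon ℂ (Finset.univ : Finset (Fin 2)) := by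
  rw [mem_SUon_univ', ← psi_star, ← map_mul, S3.star_mul h, map_one]
  refine ⟨rfl, ?_⟩
  have := mem_S3_iff_normSq.1 h
  rw [normSq_def'] at this
  rw [psi_apply, det_fin_two_of]
  apply Complex.ext
  · simp; linarith
  · simp; ring

/-- The inverse of `psi` on special unitary matrices. -/
def psiInv (A : Matrix (Fin 2) (Fin 2) ℂ) : ℍ[ℝ] :=
  quat (A 0 0).re (A 0 0).im (A 0 1).re (A 0 1).im

@[fun_prop] theorem continuous_quat {X : Type*} [TopologicalSpace X] {a b c d : X → ℝ}
    (ha : Continuous a) (hb : Continuous b) (hc : Continuous c) (hd : Continuous d) :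
    Continuous fun x => quat (a x) (b x) (c x) (d x) := by
  have : (fun x => quat (a x) (b x) (c x) (d x)) = fun x => a x • quat 1 0 0 0 +
      b x • quat 0 1 0 0 + c x • quat 0 0 1 0 + d x • quat 0 0 0 1 := by
    funext x
    ext <;> simp
  rw [this]
  fun_prop

@[fun_prop] theorem continuous_psiInv : Continuous psiInv :=
  continuous_quat (by fun_prop) (by fun_prop) (by fun_prop) (by fun_prop)

theorem psiInv_psi (q : ℍ[ℝ]) : psiInv (psi q) = q := by
  ext <;> simp [psiInv, psi_apply]

theorem psi_psiInv {A : Matrix (Fin 2) (Fin 2) ℂ}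
    (hA : A ∈ SUon ℂ (Finset.univ : Finset (Fin 2))) : psi (psiInv A) = A := by
  rw [mem_SUon_univ'] at hA
  obtain ⟨h, hd⟩ := hA
  have hadj : Aᴴ = A.adjugate := by
    calc Aᴴ = Aᴴ * (A * A.adjugate) := by rw [mul_adjugate, hd, one_smul, Matrix.mul_one]
      _ = A.adjugate := by rw [← Matrix.mul_assoc, h, Matrix.one_mul]
  rw [adjugate_fin_two] at hadj
  have h1 := congrFun (congrFun hadj 0) 0
  have h2 := congrFun (congrFun hadj 0) 1
  simp [Complex.ext_iff] at h1 h2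
  rw [psi_apply]
  ext i j
  fin_cases i <;> fin_cases j <;> apply Complex.ext <;> simp [psiInv] <;> linarith

theorem psiInv_mem {A : Matrix (Fin 2) (Fin 2) ℂ}
    (hA : A ∈ SUon ℂ (Finset.univ : Finset (Fin 2))) : psiInv A ∈ S3 := by
  have h := (mem_SUon_univ'.1 hA).2
  rw [← psi_psiInv hA, psi_apply, det_fin_two_of, Complex.ext_iff] at h
  rw [mem_S3_iff_normSq, normSq_def']
  have := h.1
  simp at this
  linarith

end

section

/-! ### Left multiplications as matrices -/

open Quaternion

/-- Four-dimensional real vectors as quaternions. -/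
def toQ (v : Fin 2 ⊕ Fin 2 → ℝ) : ℍ[ℝ] :=
  quat (v (Sum.inl 0)) (v (Sum.inr 0)) (-(v (Sum.inl 1))) (v (Sum.inr 1))

theorem toQ_injective : Function.Injective toQ := by
  intro u v h
  have h0 := congrArg (·.re) h
  have h1 := congrArg (·.imI) h
  have h2 := congrArg (·.imJ) h
  have h3 := congrArg (·.imK) h
  simp [toQ] at h0 h1 h2 h3
  ext i
  rcases i with i | i <;> fin_cases i <;> assumption

theorem toQ_dot (u v : Fin 2 ⊕ Fin 2 → ℝ) : u ⬝ᵥ v = (star (toQ u) * toQ v).re := by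
  simp [toQ, dotProduct, Fintype.sum_sum_type, Fin.sum_univ_two]
  ring

@[fun_prop] theorem continuous_toQ : Continuous toQ := by
  unfold toQ; fun_prop

/-- Left multiplication by a quaternion. -/
def Lq (q : ℍ[ℝ]) : Matrix (Fin 2 ⊕ Fin 2) (Fin 2 ⊕ Fin 2) ℝ :=
  fromBlocks !![q.re, q.imJ; -q.imJ, q.re] (-!![q.imI, q.imK; q.imK, -q.imI])
    !![q.imI, q.imK; q.imK, -q.imI] !![q.re, q.imJ; -q.imJ, q.re]

theorem toQ_Lq (q : ℍ[ℝ]) (v : Fin 2 ⊕ Fin 2 → ℝ) : toQ (Lq q *ᵥ v) = q * toQ v := by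
  ext <;> simp [toQ, Lq, mulVec, dotProduct, Fintype.sum_sum_type, Fin.sum_univ_two] <;> ring

/-- The matrix of quaternionic conjugation. -/
def Kq : Matrix (Fin 2 ⊕ Fin 2) (Fin 2 ⊕ Fin 2) ℝ :=
  diagonal (Sum.elim ![1, -1] ![-1, -1])

theorem toQ_Kq (v : Fin 2 ⊕ Fin 2 → ℝ) : toQ (Kq *ᵥ v) = star (toQ v) := by
  ext <;> simp [toQ, Kq, mulVec_diagonal]

theorem ext_toQ {A B : Matrix (Fin 2 ⊕ Fin 2) (Fin 2 ⊕ Fin 2) ℝ}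
    (h : ∀ v, toQ (A *ᵥ v) = toQ (B *ᵥ v)) : A = B := by
  ext i j
  have := congrFun (toQ_injective (h (Pi.single j 1))) i
  simpa using this

theorem Lq_mul (p q : ℍ[ℝ]) : Lq (p * q) = Lq p * Lq q :=
  ext_toQ fun v => by rw [toQ_Lq, ← mulVec_mulVec, toQ_Lq, toQ_Lq, mul_assoc]

theorem Lq_one : Lq 1 = 1 :=
  ext_toQ fun v => by rw [toQ_Lq, one_mulVec, one_mul]

@[fun_prop] theorem continuous_Lq : Continuous Lq := by
  have h1 : Continuous fun q : ℍ[ℝ] => !![q.re, q.imJ; -q.imJ, q.re] := by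
    have := continuous_re; have := continuous_imJ
    refine continuous_matrix fun i j => ?_
    fin_cases i <;> fin_cases j <;> simp <;> fun_prop
  have h2 : Continuous fun q : ℍ[ℝ] => !![q.imI, q.imK; q.imK, -q.imI] := by
    have := continuous_imI; have := continuous_imK
    refine continuous_matrix fun i j => ?_
    fin_cases i <;> fin_cases j <;> simp <;> fun_prop
  exact Continuous.matrix_fromBlocks h1 h2.neg h2 h1

theorem Kq_mul_Kq : Kq * Kq = 1 :=
  ext_toQ fun v => by rw [← mulVec_mulVec, toQ_Kq, toQ_Kq, star_star, one_mulVec]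

/-- A Hermitian involution diagonalising left multiplications. -/
def Vq : Matrix (Fin 2 ⊕ Fin 2) (Fin 2 ⊕ Fin 2) ℂ :=
  ((√2)⁻¹ : ℂ) • fromBlocks 1 (Complex.I • 1) (-Complex.I • 1) (-1)

theorem sqrt_two_inv_sq : (((√2 : ℝ) : ℂ))⁻¹ * ((√2 : ℝ) : ℂ)⁻¹ = 1 / 2 := by
  rw [← mul_inv, ← Complex.ofReal_mul, Real.mul_self_sqrt (by norm_num)]
  norm_num

theorem Vq_herm : Vqᴴ = Vq := by
  unfold Vq
  rw [conjTranspose_smul, fromBlocks_conjTranspose]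
  simp [conjTranspose_smul]

theorem Vq_mul_Vq : Vq * Vq = 1 := by
  unfold Vq
  rw [smul_mul_smul_comm, sqrt_two_inv_sq, fromBlocks_multiply, ← fromBlocks_one, fromBlocks_smul]
  simp only [Matrix.mul_one, smul_mul_assoc, mul_smul_comm, smul_smul, neg_mul, mul_neg]
  congr 1
  all_goals
    match_scalars <;> first | ring1 | linear_combination (1 / 2) * Complex.I_mul_I |
      linear_combination (-1 / 2) * Complex.I_mul_I

theorem Vq_conj (q : ℍ[ℝ]) :
    Vq * cx (Lq q) * Vq = fromBlocks (psi q) 0 0 ((psi q).map star) := by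
  have e : cx (Lq q) = fromBlocks (cx !![q.re, q.imJ; -q.imJ, q.re])
      (-cx !![q.imI, q.imK; q.imK, -q.imI]) (cx !![q.imI, q.imK; q.imK, -q.imI])
      (cx !![q.re, q.imJ; -q.imJ, q.re]) := by
    rw [← map_neg]
    simp only [cx, RingHom.mapMatrix_apply, Lq, fromBlocks_map]
  have h1 : psi q = cx !![q.re, q.imJ; -q.imJ, q.re] +
      Complex.I • cx !![q.imI, q.imK; q.imK, -q.imI] := by
    ext i j
    fin_cases i <;> fin_cases j <;> apply Complex.ext <;> simp [psi_apply]
  have h2 : (psi q).map star = cx !![q.re, q.imJ; -q.imJ, q.re] -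
      Complex.I • cx !![q.imI, q.imK; q.imK, -q.imI] := by
    ext i j
    fin_cases i <;> fin_cases j <;> apply Complex.ext <;> simp [psi_apply]
  rw [h2, h1, e]
  generalize cx !![q.re, q.imJ; -q.imJ, q.re] = X
  generalize cx !![q.imI, q.imK; q.imK, -q.imI] = Y
  unfold Vq
  rw [smul_mul_assoc, smul_mul_smul_comm, sqrt_two_inv_sq, fromBlocks_multiply,
    fromBlocks_multiply, fromBlocks_smul]
  simp only [Matrix.mul_one, Matrix.one_mul, Matrix.mul_neg, smul_mul_assoc, mul_smul_comm,
    smul_smul, neg_smul, smul_add, smul_neg, add_mul, neg_mul]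
  congr 1
  all_goals
    match_scalars <;> first | ring1 | linear_combination (1 / 2) * Complex.I_mul_I |
      linear_combination (-1 / 2) * Complex.I_mul_I

/-- The involution `diag(1, σ_y)`. -/
def Yq : Matrix (Fin 2 ⊕ Fin 2) (Fin 2 ⊕ Fin 2) ℂ :=
  fromBlocks 1 0 0 !![0, -Complex.I; Complex.I, 0]

theorem Yq_herm : Yqᴴ = Yq := by
  rw [Yq, fromBlocks_conjTranspose]
  congr 1
  · simp
  · simp
  · simp
  · ext i j; fin_cases i <;> fin_cases j <;> simp

theorem Yq_mul_Yq : Yq * Yq = 1 := by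
  rw [Yq, fromBlocks_multiply, ← fromBlocks_one]
  congr 1
  · simp
  · simp
  · simp
  · ext i j; fin_cases i <;> fin_cases j <;> simp

theorem Yq_conj (q : ℍ[ℝ]) :
    Yq * fromBlocks (psi q) 0 0 ((psi q).map star) * Yq = fromBlocks (psi q) 0 0 (psi q) := by
  rw [Yq, fromBlocks_multiply, fromBlocks_multiply]
  congr 1
  · simp
  · simp
  · simp
  · have : (psi q).map star = !![⟨q.re, -q.imI⟩, ⟨q.imJ, -q.imK⟩; ⟨-q.imJ, -q.imK⟩, ⟨q.re, q.imI⟩] := by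
      ext i j
      fin_cases i <;> fin_cases j <;> apply Complex.ext <;> simp [psi_apply]
    rw [this, psi_apply]
    simp only [Matrix.zero_mul, Matrix.mul_zero, zero_add, add_zero]
    rw [mul_fin_two, mul_fin_two]
    ext i j
    fin_cases i <;> fin_cases j <;> apply Complex.ext <;> simp

/-- The block swap. -/
def Sq : Matrix (Fin 2 ⊕ Fin 2) (Fin 2 ⊕ Fin 2) ℂ := fromBlocks 0 1 1 0

theorem Sq_herm : Sqᴴ = Sq := by
  rw [Sq, fromBlocks_conjTranspose]; simp

theorem Sq_mul_Sq : Sq * Sq = 1 := by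
  rw [Sq, fromBlocks_multiply, ← fromBlocks_one]; simp

theorem Sq_conj (A : Matrix (Fin 2) (Fin 2) ℂ) :
    Sq * fromBlocks A 0 0 1 * Sq = fromBlocks 1 0 0 A := by
  rw [Sq, fromBlocks_multiply, fromBlocks_multiply]; simp

end

section

/-! ### Homotopies of left multiplications -/

open Quaternion

theorem Lq_star (q : ℍ[ℝ]) : Lq (star q) = (Lq q)ᴴ := by
  ext i j
  rcases i with i | i <;> rcases j with j | j <;> fin_cases i <;> fin_cases j <;> simp [Lq]

theorem Kq_herm : Kqᴴ = Kq := by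
  rw [Kq, diagonal_conjTranspose]
  congr 1

theorem Lq_mem {q : ℍ[ℝ]} (h : q ∈ S3) : Lq q ∈ SUon ℝ (Finset.univ : Finset (Fin 2 ⊕ Fin 2)) := by
  rw [mem_SUon_univ', ← Lq_star, ← Lq_mul, S3.star_mul h, Lq_one]
  refine ⟨rfl, Complex.ofReal_injective ?_⟩
  have h1 := congrArg det (Vq_conj q)
  have hd := (mem_SUon_univ'.1 (psi_mem h)).2
  have h2 : ((psi q).map star).det = 1 := by
    change ((starRingEnd ℂ).mapMatrix (psi q)).det = 1
    rw [← RingHom.map_det, hd, map_one]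
  rw [det_fromBlocks_zero₂₁, hd, h2, det_mul_comm, ← Matrix.mul_assoc, Vq_mul_Vq,
    Matrix.one_mul, mul_one] at h1
  rw [Complex.ofReal_one, ← h1]
  exact RingHom.map_det Complex.ofRealHom (Lq q)

theorem Kq_conj_mem {A : Matrix (Fin 2 ⊕ Fin 2) (Fin 2 ⊕ Fin 2) ℝ}
    (h : A ∈ SUon ℝ (Finset.univ : Finset (Fin 2 ⊕ Fin 2))) :
    Kq * A * Kq ∈ SUon ℝ (Finset.univ : Finset (Fin 2 ⊕ Fin 2)) := by
  rw [mem_SUon_univ'] at *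
  refine ⟨?_, ?_⟩
  · calc (Kq * A * Kq)ᴴ * (Kq * A * Kq) = Kq * Aᴴ * (Kq * Kq) * A * Kq := by
          simp only [conjTranspose_mul, Kq_herm, Matrix.mul_assoc]
      _ = Kq * (Aᴴ * A) * Kq := by rw [Kq_mul_Kq, Matrix.mul_one]; simp only [Matrix.mul_assoc]
      _ = 1 := by rw [h.1, Matrix.mul_one, Kq_mul_Kq]
  · rw [det_mul_comm, ← Matrix.mul_assoc, Kq_mul_Kq, Matrix.one_mul, h.2]

/-- The upper left embedding of `2 × 2` matrices into `4 × 4` matrices. -/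
abbrev emb24 : Matrix (Fin 2) (Fin 2) ℂ →* Matrix (Fin 2 ⊕ Fin 2) (Fin 2 ⊕ Fin 2) ℂ :=
  emb (Equiv.refl _)

theorem emb24_apply (A : Matrix (Fin 2) (Fin 2) ℂ) : emb24 A = fromBlocks A 0 0 1 := rfl

section
variable {X : Type*} [TopologicalSpace X] {C : Set X}

theorem HRel.Lq_psi {q : X → ℍ[ℝ]} (hq : Continuous q) (hqS : ∀ x, q x ∈ S3)
    (hqC : ∀ x ∈ C, q x = 1) :
    HRel (SUon ℂ (Finset.univ : Finset (Fin 2 ⊕ Fin 2)) : Set (Matrix _ _ ℂ)) C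
      (fun x => cx (Lq (q x))) (fun x => emb24 (psi (q x * q x))) := by
  have hL : ∀ x, cx (Lq (q x)) ∈ SUon ℂ (Finset.univ : Finset (Fin 2 ⊕ Fin 2)) :=
    fun x => cx_mem (Lq_mem (hqS x))
  have h1 := HRel.conj_involution (C := C) Vq_herm Vq_mul_Vq (by fun_prop) hL
    fun x hx => by rw [hqC x hx, Lq_one, map_one]
  have h2 := HRel.conj_involution (C := C) Yq_herm Yq_mul_Yq h1.continuous_right h1.mem_right
    fun x hx => by rw [hqC x hx, Lq_one, map_one, Matrix.mul_one, Vq_mul_Vq]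
  have h12 := h1.trans h2
  have he : ∀ x, emb24 (psi (q x)) ∈ SUon ℂ (Finset.univ : Finset (Fin 2 ⊕ Fin 2)) :=
    fun x => SUon_le_univ _ (emb_mem _ (psi_mem (hqS x)))
  have h3 := HRel.conj_involution (C := C) Sq_herm Sq_mul_Sq (by fun_prop) he
    fun x hx => by rw [hqC x hx, map_one, map_one]
  have h4 := (HRel.refl (C := C) (P := (SUon ℂ (Finset.univ : Finset (Fin 2 ⊕ Fin 2)) :
    Set (Matrix _ _ ℂ))) (f := fun x => emb24 (psi (q x))) (by fun_prop) he).mul h3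
    (fun a ha b hb => Submonoid.mul_mem _ ha hb)
  have h5 : (fun x => Yq * (Vq * cx (Lq (q x)) * Vq) * Yq) =
      fun x => emb24 (psi (q x)) * (Sq * emb24 (psi (q x)) * Sq) := by
    funext x
    rw [Vq_conj, Yq_conj, emb24_apply, Sq_conj, fromBlocks_multiply]
    simp
  rw [h5] at h12
  have h6 := h12.trans h4.symm
  simpa only [map_mul] using h6

/-- A continuous function with values in the square roots of `1` in the quaternions, equal to
`1` somewhere, is `1`. -/
theorem eq_one_of_sq_eq_one [PreconnectedSpace X] {c : X → ℍ[ℝ]} (hc : Continuous c)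
    (h : ∀ x, c x * c x = 1) {x₀ : X} (h₀ : c x₀ = 1) (x : X) : c x = 1 := by
  have hz : ∀ x, c x = 1 ∨ c x = -1 := fun x => mul_self_eq_one_iff.1 (h x)
  have hcl : IsClopen {x | c x = 1} := by
    refine ⟨isClosed_eq hc continuous_const, ?_⟩
    have : {x | c x = 1} = {x | c x = -1}ᶜ := by
      ext x
      simp only [Set.mem_ofPred_eq, Set.mem_compl_iff]
      refine ⟨fun h h' => ?_, fun h' => (hz x).resolve_right h'⟩
      rw [h] at h'
      have := congrArg (·.re) h'
      simp at this
      norm_num at this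
    rw [this]
    exact (isClosed_eq hc continuous_const).isOpen_compl
  have := hcl.eq_univ ⟨x₀, h₀⟩
  exact (Set.eq_univ_iff_forall.1 this) x

end

end

section

/-! ### Lifting anticommuting frames to quaternions -/

open Quaternion

theorem ext_toQ_single {A B : Matrix (Fin 2 ⊕ Fin 2) (Fin 2 ⊕ Fin 2) ℝ}
    (h : ∀ j, toQ (A *ᵥ Pi.single j 1) = toQ (B *ᵥ Pi.single j 1)) : A = B := by
  ext i j
  have := congrFun (toQ_injective (h j)) i
  simpa using this

theorem add_star_eq_zero {a : ℍ[ℝ]} (h : a.re = 0) : a + star a = 0 := by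
  ext <;> simp [h]

theorem star_eq_neg_of_re {a : ℍ[ℝ]} (h : a.re = 0) : star a = -a := by
  ext <;> simp [h]

theorem mul_self_eq_neg_one {a : ℍ[ℝ]} (h : a.re = 0) (ha : a ∈ S3) : a * a = -1 := by
  have := S3.star_mul ha
  rw [star_eq_neg_of_re h, neg_mul] at this
  rw [← this, neg_neg]

/-- The comparison element intertwining two anticommuting pairs of imaginary units. -/
def frameW (z : (ℍ[ℝ] × ℍ[ℝ]) × (ℍ[ℝ] × ℍ[ℝ])) : ℍ[ℝ] :=
  1 - z.2.1 * z.1.1 - z.2.2 * z.1.2 - z.2.1 * z.2.2 * (z.1.1 * z.1.2)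

/-- Anticommuting pairs of square roots of `-1`. -/
def Frames : Set (ℍ[ℝ] × ℍ[ℝ]) := {y | y.1 * y.1 = -1 ∧ y.2 * y.2 = -1 ∧ y.2 * y.1 = -(y.1 * y.2)}

theorem frameW_self {x : ℍ[ℝ] × ℍ[ℝ]} (hx : x ∈ Frames) : frameW (x, x) = 4 := by
  obtain ⟨h1, h2, h3⟩ := hx
  have : x.1 * x.2 * (x.1 * x.2) = -1 := by
    calc x.1 * x.2 * (x.1 * x.2) = x.1 * (x.2 * x.1) * x.2 := by simp only [mul_assoc]
      _ = -((x.1 * x.1) * (x.2 * x.2)) := by rw [h3]; simp only [mul_neg, neg_mul, mul_assoc]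
      _ = -1 := by rw [h1, h2]; simp
  simp only [frameW, h1, h2, this]
  norm_num

theorem frameW_left {x y : ℍ[ℝ] × ℍ[ℝ]} (hx : x ∈ Frames) (hy : y ∈ Frames) :
    y.1 * frameW (x, y) = frameW (x, y) * x.1 := by
  obtain ⟨h1, h2, h3⟩ := hx
  obtain ⟨k1, k2, k3⟩ := hy
  obtain ⟨a, b⟩ := x
  obtain ⟨c, d⟩ := y
  simp only [frameW] at *
  have e1 : c * (1 - c * a - d * b - c * d * (a * b)) =
      c - (c * c) * a - c * d * b - (c * c) * d * (a * b) := by noncomm_ring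
  have e2 : (1 - c * a - d * b - c * d * (a * b)) * a =
      a - c * (a * a) - d * (b * a) - c * d * (a * (b * a)) := by noncomm_ring
  have e3 : a * (b * a) = b := by
    rw [h3, mul_neg, ← mul_assoc, h1, neg_mul, one_mul, neg_neg]
  rw [e1, e2, e3, h1, k1, h3]
  noncomm_ring

theorem frameW_right {x y : ℍ[ℝ] × ℍ[ℝ]} (hx : x ∈ Frames) (hy : y ∈ Frames) :
    y.2 * frameW (x, y) = frameW (x, y) * x.2 := by
  obtain ⟨h1, h2, h3⟩ := hx
  obtain ⟨k1, k2, k3⟩ := hy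
  obtain ⟨a, b⟩ := x
  obtain ⟨c, d⟩ := y
  simp only [frameW] at *
  have e1 : d * (1 - c * a - d * b - c * d * (a * b)) =
      d - (d * c) * a - (d * d) * b - (d * c) * d * (a * b) := by noncomm_ring
  have e2 : (1 - c * a - d * b - c * d * (a * b)) * b =
      b - c * (a * b) - d * (b * b) - c * d * (a * (b * b)) := by noncomm_ring
  rw [e1, e2, k3, k2, h2]
  have e3 : -(c * d) * d = c := by rw [neg_mul, mul_assoc, k2]; simp
  rw [e3]
  noncomm_ring

theorem exists_frame_lift {n : ℕ} (f : (Fin (n + 2) → I) → ℍ[ℝ] × ℍ[ℝ]) (hf : Continuous f)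
    (hT : ∀ k, f k ∈ Frames) (hb : ∀ k ∈ bd (n + 2), f k = (quat 0 1 0 0, quat 0 0 (-1) 0)) :
    ∃ p : (Fin (n + 2) → I) → ℍ[ℝ], Continuous p ∧ (∀ k, p k ∈ S3) ∧ (∀ k ∈ bd (n + 2), p k = 1) ∧
      ∀ k, (f k).1 * p k = p k * quat 0 1 0 0 ∧ (f k).2 * p k = p k * quat 0 0 (-1) 0 := by
  have hwc : Continuous frameW := by unfold frameW; fun_prop
  have h4 : (4 : ℍ[ℝ]) ≠ 0 := by
    rw [show (4 : ℍ[ℝ]) = ((4 : ℝ) : ℍ[ℝ]) by norm_cast]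
    exact fun h => four_ne_zero (coe_injective (h.trans coe_zero.symm))
  obtain ⟨p, hp, hpS, hact, hp1⟩ := exists_cube_lift
    (fun (g : ℍ[ℝ]) (x y : ℍ[ℝ] × ℍ[ℝ]) => y.1 * g = g * x.1 ∧ y.2 * g = g * x.2) S3 Frames
    {z | frameW z ≠ 0} (isOpen_ne_fun hwc continuous_const)
    (fun z => ‖frameW z‖⁻¹ • frameW z)
    ((hwc.norm.continuousOn.inv₀ fun z hz => norm_ne_zero_iff.2 hz).smul hwc.continuousOn)
    (fun x hx => by simpa [frameW_self hx] using h4)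
    (fun x hx => by
      have : (4 : ℍ[ℝ]) = ((4 : ℝ) : ℍ[ℝ]) := by norm_cast
      simp only [frameW_self hx, this, norm_coe]
      ext <;> simp)
    (fun x _ y _ h => by
      rw [mem_S3, norm_smul, norm_inv, norm_norm, inv_mul_cancel₀ (norm_ne_zero_iff.2 h)])
    (fun x hx y hy _ => by
      rw [mul_smul_comm, smul_mul_assoc, mul_smul_comm, smul_mul_assoc, frameW_left hx hy,
        frameW_right hx hy]
      exact ⟨rfl, rfl⟩)
    (fun x _ => by simp)
    (fun a b x y z h h' => by
      refine ⟨?_, ?_⟩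
      · rw [← mul_assoc, h'.1, mul_assoc, h.1, mul_assoc]
      · rw [← mul_assoc, h'.2, mul_assoc, h.2, mul_assoc])
    f hf hT _ hb
  refine ⟨p, hp, hpS, fun k hk => ?_, hact⟩
  rcases mem_bd_succ hk with ⟨j, hj⟩ | h0
  · exact hp1 k j hj
  · have key : ∀ u : Fin (n + 1) → I, p (Fin.cons 1 u) = 1 := by
      refine eq_one_of_sq_eq_one (c := fun u : Fin (n + 1) → I => p (Fin.cons 1 u))
        (x₀ := fun _ => 0) (by fun_prop) (fun u => ?_) (hp1 _ 1 (Or.inl rfl))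
      have h := hact (Fin.cons 1 u)
      rw [hb _ ⟨0, Or.inr rfl⟩] at h
      have hS := mem_S3_iff_normSq.1 (hpS (Fin.cons 1 u))
      rw [normSq_def'] at hS
      generalize p (Fin.cons 1 u) = a at *
      have a1 := congrArg (·.imJ) h.1
      have a2 := congrArg (·.imK) h.1
      have a3 := congrArg (·.imI) h.2
      simp at a1 a2 a3
      have z1 : a.imI = 0 := by
        have := congrArg (·.imK) h.2
        simp at this
        linarith
      have z2 : a.imJ = 0 := by linarith
      have z3 : a.imK = 0 := by linarith
      rw [z1, z2, z3] at hS
      ext <;> simp [z1, z2, z3]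
      nlinarith
    have := key (fun i => k i.succ)
    rwa [show (Fin.cons 1 fun i => k i.succ : Fin (n + 2) → I) = k by
      rw [← h0]; exact Fin.cons_self_tail k] at this

theorem exists_frame {n : ℕ} (h : (Fin (n + 2) → I) → Matrix (Fin 2 ⊕ Fin 2) (Fin 2 ⊕ Fin 2) ℝ)
    (hc : Continuous h) (hS : ∀ k, h k ∈ SUon ℝ (Finset.univ : Finset (Fin 2 ⊕ Fin 2)))
    (h1 : ∀ k ∈ bd (n + 2), h k = 1) :
    ∃ q p : (Fin (n + 2) → I) → ℍ[ℝ], Continuous q ∧ Continuous p ∧ (∀ k, q k ∈ S3) ∧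
      (∀ k, p k ∈ S3) ∧ (∀ k ∈ bd (n + 2), q k = 1) ∧ (∀ k ∈ bd (n + 2), p k = 1) ∧
      ∀ k, h k = Lq (q k) * Lq (p k) * (Kq * Lq (p k) * Kq) := by
  let x : Fin 2 ⊕ Fin 2 → (Fin (n + 2) → I) → ℍ[ℝ] := fun m k => toQ (h k *ᵥ Pi.single m 1)
  let y : Fin 2 ⊕ Fin 2 → (Fin (n + 2) → I) → ℍ[ℝ] := fun m k => star (x (Sum.inl 0) k) * x m k
  have hxc : ∀ m, Continuous (x m) := fun m => by fun_prop
  have hyc : ∀ m, Continuous (y m) := fun m => by fun_prop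
  have horth : ∀ a b k, (star (x a k) * x b k).re = if a = b then 1 else 0 := by
    intro a b k
    rw [← toQ_dot, dotProduct_mulVec, vecMul_mulVec, ← conjTranspose_eq_transpose_of_trivial,
      (mem_SUon_univ'.1 (hS k)).1]
    simp [Pi.single_apply, eq_comm]
  have hx1 : ∀ m, ∀ k ∈ bd (n + 2), x m k = toQ (Pi.single m 1) := fun m k hk => by
    simp only [x, h1 k hk, one_mulVec]
  have hxS : ∀ m k, x m k ∈ S3 := by
    intro m k
    rw [mem_S3_iff_normSq]
    have := horth m m k
    rw [star_mul_self] at this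
    simpa using this
  have hyS : ∀ m k, y m k ∈ S3 := fun m k => mul_mem (S3.star_mem (hxS _ k)) (hxS m k)
  have hyre : ∀ m k, m ≠ Sum.inl 0 → (y m k).re = 0 := fun m k hm => by
    rw [horth, if_neg hm.symm]
  have hyy : ∀ a k, a ≠ Sum.inl 0 → y a k * y a k = -1 := fun a k ha =>
    mul_self_eq_neg_one (hyre a k ha) (hyS a k)
  have hyanti : ∀ a b k, a ≠ Sum.inl 0 → b ≠ Sum.inl 0 → a ≠ b →
      y b k * y a k = -(y a k * y b k) := by
    intro a b k ha hb hab
    have e : star (y a k) * y b k = star (x a k) * x b k := by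
      simp only [y, star_mul, star_star]
      rw [mul_assoc, ← mul_assoc (x (Sum.inl 0) k), S3.mul_star (hxS _ _), one_mul]
    have h0 := horth a b k
    rw [if_neg hab, ← e, star_eq_neg_of_re (hyre a k ha), neg_mul, re_neg, neg_eq_zero] at h0
    have := add_star_eq_zero h0
    rw [star_mul, star_eq_neg_of_re (hyre a k ha), star_eq_neg_of_re (hyre b k hb),
      neg_mul_neg] at this
    exact eq_neg_of_add_eq_zero_right this
  have hq1 : ∀ k ∈ bd (n + 2), x (Sum.inl 0) k = 1 := fun k hk => by
    rw [hx1 _ k hk]; ext <;> simp [toQ]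
  have hyb : ∀ m, ∀ k ∈ bd (n + 2), y m k = toQ (Pi.single m 1) := fun m k hk => by
    simp only [y, hq1 k hk, star_one, one_mul, hx1 m k hk]
  have hi : toQ (Pi.single (Sum.inr 0) 1) = quat 0 1 0 0 := by ext <;> simp [toQ]
  have hj : toQ (Pi.single (Sum.inl 1) 1) = quat 0 0 (-1) 0 := by ext <;> simp [toQ]
  have hk : toQ (Pi.single (Sum.inr 1) 1) = quat 0 0 0 1 := by ext <;> simp [toQ]
  have hone : toQ (Pi.single (Sum.inl 0) 1) = 1 := by ext <;> simp [toQ]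
  obtain ⟨p, hp, hpS, hp1, hact⟩ := exists_frame_lift
    (fun k => (y (Sum.inr 0) k, y (Sum.inl 1) k)) (by fun_prop)
    (fun k => ⟨hyy _ k (by simp), hyy _ k (by simp), hyanti _ _ k (by simp) (by simp) (by simp)⟩)
    (fun k hk' => by simp only [hyb _ k hk', hi, hj])
  have hy3 : ∀ k, y (Sum.inr 1) k = y (Sum.inl 1) k * y (Sum.inr 0) k := by
    have key := eq_one_of_sq_eq_one
      (c := fun k => y (Sum.inr 1) k * (y (Sum.inr 0) k * y (Sum.inl 1) k))
      (x₀ := fun _ => 0) (by fun_prop) (fun k => by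
        have e1 := hyanti (Sum.inr 0) (Sum.inr 1) k (by simp) (by simp) (by simp)
        have e2 := hyanti (Sum.inl 1) (Sum.inr 1) k (by simp) (by simp) (by simp)
        have e3 := hyanti (Sum.inr 0) (Sum.inl 1) k (by simp) (by simp) (by simp)
        have d1 := hyy (Sum.inr 0) k (by simp)
        have d2 := hyy (Sum.inl 1) k (by simp)
        have d3 := hyy (Sum.inr 1) k (by simp)
        generalize y (Sum.inr 1) k = c at *
        generalize y (Sum.inr 0) k = a at *
        generalize y (Sum.inl 1) k = b at *
        calc c * (a * b) * (c * (a * b)) = -(c * a * (-(b * c)) * (-(a * b))) * (-1) := by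
              noncomm_ring
          _ = (c * a) * (c * b) * (b * a) := by rw [← e2, ← e3]; noncomm_ring
          _ = -(c * (-(a * c)) * (b * b) * a) * (-1) * (-1) := by noncomm_ring
          _ = 1 := by
            rw [← e1, d2]
            calc _ = (c * c) * (a * a) := by noncomm_ring
              _ = 1 := by rw [d1, d3]; norm_num) (by
        simp only [hyb _ _ (⟨0, Or.inl rfl⟩ : (fun _ => 0 : Fin (n + 2) → I) ∈ bd (n + 2)),
          hi, hj, hk]
        ext <;> simp)
    intro k
    have e := key k
    have d1 := hyy (Sum.inr 0) k (by simp)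
    have d2 := hyy (Sum.inl 1) k (by simp)
    calc y (Sum.inr 1) k = y (Sum.inr 1) k * (y (Sum.inr 0) k * (y (Sum.inl 1) k *
          y (Sum.inl 1) k) * y (Sum.inr 0) k) := by rw [d2, mul_neg_one, neg_mul, d1]; simp
      _ = y (Sum.inr 1) k * (y (Sum.inr 0) k * y (Sum.inl 1) k) *
          (y (Sum.inl 1) k * y (Sum.inr 0) k) := by simp only [mul_assoc]
      _ = _ := by rw [e, one_mul]
  refine ⟨x (Sum.inl 0), p, hxc _, hp, hxS _, hpS, hq1, hp1, fun k => ext_toQ_single fun m => ?_⟩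
  simp only [← mulVec_mulVec, toQ_Lq, toQ_Kq, star_mul, star_star]
  have hxy : ∀ m, x m k = x (Sum.inl 0) k * y m k := fun m => by
    simp only [y]; rw [← mul_assoc, S3.mul_star (hxS _ _), one_mul]
  change x m k = _
  have hpp := S3.mul_star (hpS k)
  have ha : y (Sum.inr 0) k = p k * quat 0 1 0 0 * star (p k) := by
    rw [← (hact k).1, mul_assoc, hpp, mul_one]
  have hb : y (Sum.inl 1) k = p k * quat 0 0 (-1) 0 * star (p k) := by
    rw [← (hact k).2, mul_assoc, hpp, mul_one]
  have hcc : y (Sum.inr 1) k = p k * quat 0 0 0 1 * star (p k) := by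
    rw [hy3, ha, hb]
    calc _ = p k * quat 0 0 (-1) 0 * (star (p k) * p k) * quat 0 1 0 0 * star (p k) := by
          simp only [mul_assoc]
      _ = p k * (quat 0 0 (-1) 0 * quat 0 1 0 0) * star (p k) := by
          rw [S3.star_mul (hpS k), mul_one]; simp only [mul_assoc]
      _ = _ := by
        congr 2
        ext <;> simp
  rcases m with m | m <;> fin_cases m
  · change x (Sum.inl 0) k = _ * (_ * (toQ (Pi.single (Sum.inl 0) 1) * _))
    rw [hone, one_mul, hpp, mul_one]
  · change x (Sum.inl 1) k = _ * (_ * (toQ (Pi.single (Sum.inl 1) 1) * _))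
    rw [hxy, hb, hj, mul_assoc (p k)]
  · change x (Sum.inr 0) k = _ * (_ * (toQ (Pi.single (Sum.inr 0) 1) * _))
    rw [hxy, ha, hi, mul_assoc (p k)]
  · change x (Sum.inr 1) k = _ * (_ * (toQ (Pi.single (Sum.inr 1) 1) * _))
    rw [hxy, hcc, hk, mul_assoc (p k)]

end

section

/-! ### Compression into `SU(2)` -/

open Quaternion

section
variable {𝕂 : Type*} [RCLike 𝕂] {ι κ μ : Type*} [Fintype ι] [DecidableEq ι] [Fintype κ]
  [DecidableEq κ] [Fintype μ] [DecidableEq μ]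

theorem exists_compress_emb {X E : Type*} [TopologicalSpace X] [CompactSpace X]
    [NormedAddCommGroup E] [NormedSpace ℝ E] [FiniteDimensional ℝ E] {j : X → E}
    (hj : Continuous j) (hji : Function.Injective j) (e : κ ⊕ μ ≃ ι) [Nonempty κ]
    (hd : Module.finrank ℝ E + 1 < (Fintype.card κ + 1) * Module.finrank ℝ 𝕂)
    {g : X → Matrix ι ι 𝕂} (hg : Continuous g) (hgS : ∀ x, g x ∈ SUon 𝕂 (Finset.univ : Finset ι)) :
    ∃ B : X → Matrix κ κ 𝕂, Continuous B ∧ (∀ x, B x ∈ SUon 𝕂 (Finset.univ : Finset κ)) ∧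
      HRel (SUon 𝕂 (Finset.univ : Finset ι) : Set (Matrix ι ι 𝕂))
        {x | g x ∈ SUon 𝕂 (embCoords e)} g (fun x => emb e (B x)) ∧
      ∀ x, ∀ A ∈ SUon 𝕂 (Finset.univ : Finset κ), g x = emb e A → B x = A := by
  obtain ⟨g', hg', H⟩ := exists_compress hj hji (Finset.subset_univ (embCoords e))
    (Finset.card_pos.1 (by rw [card_embCoords]; exact Fintype.card_pos))
    (by rwa [card_embCoords]) hg hgS
  have hc := H.continuous_right
  have he : (fun x => emb e (res e (g' x))) = g' := funext fun x => emb_res e (hg' x)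
  refine ⟨fun x => res e (g' x), (continuous_res e).comp hc, fun x => res_mem e (hg' x),
    by rwa [he], fun x A hA hgA => emb_injective e ?_⟩
  rw [emb_res e (hg' x), ← hgA]
  refine H.eqOn x ?_
  rw [Set.mem_ofPred_eq, hgA]
  exact emb_mem e hA

/-- The inclusion of the cube in Euclidean space. -/
def cubeIncl (n : ℕ) (k : Fin n → I) : Fin n → ℝ := fun i => k i

theorem continuous_cubeIncl (n : ℕ) : Continuous (cubeIncl n) := by
  unfold cubeIncl; fun_prop

theorem cubeIncl_injective (n : ℕ) : Function.Injective (cubeIncl n) := fun _ _ h =>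
  funext fun i => Subtype.ext (congrFun h i)

theorem exists_compress_cube {n : ℕ} (e : κ ⊕ μ ≃ ι) [Nonempty κ]
    (hd : n + 1 < (Fintype.card κ + 1) * Module.finrank ℝ 𝕂)
    {g : (Fin n → I) → Matrix ι ι 𝕂} (hg : Continuous g)
    (hgS : ∀ x, g x ∈ SUon 𝕂 (Finset.univ : Finset ι)) (hg1 : ∀ k ∈ bd n, g k = 1) :
    ∃ B : (Fin n → I) → Matrix κ κ 𝕂, Continuous B ∧
      (∀ x, B x ∈ SUon 𝕂 (Finset.univ : Finset κ)) ∧ (∀ k ∈ bd n, B k = 1) ∧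
      HRel (SUon 𝕂 (Finset.univ : Finset ι) : Set (Matrix ι ι 𝕂)) (bd n) g
        (fun x => emb e (B x)) := by
  obtain ⟨B, hB, hBS, H, h1⟩ := exists_compress_emb (continuous_cubeIncl n) (cubeIncl_injective n) e
    (by simpa using hd) hg hgS
  refine ⟨B, hB, hBS, fun k hk => h1 k 1 (one_mem _) (by rw [hg1 k hk, map_one]),
    H.mono subset_rfl fun k hk => ?_⟩
  rw [Set.mem_ofPred_eq, hg1 k hk]
  exact one_mem _

theorem HRel.emb {X : Type*} [TopologicalSpace X] {C : Set X} {f g : X → Matrix κ κ 𝕂}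
    (e : κ ⊕ μ ≃ ι)
    (H : HRel (SUon 𝕂 (Finset.univ : Finset κ) : Set (Matrix κ κ 𝕂)) C f g) :
    HRel (SUon 𝕂 (Finset.univ : Finset ι) : Set (Matrix ι ι 𝕂)) C (fun x => emb e (f x))
      (fun x => emb e (g x)) :=
  H.comp_left (PiThree.emb e) (continuous_emb e).continuousOn
    fun _ hy => SUon_le_univ _ (emb_mem e hy)

end

theorem HRel.normalize {X V : Type*} [TopologicalSpace X] [NormedAddCommGroup V] [NormedSpace ℝ V]
    {C : Set X} {f g : X → V} (H : HRel {v : V | v ≠ 0} C f g) (hf : ∀ x, ‖f x‖ = 1)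
    (hg : ∀ x, ‖g x‖ = 1) : HRel {v : V | ‖v‖ = 1} C f g := by
  have := H.comp_left (Q := {v : V | ‖v‖ = 1}) (fun v => ‖v‖⁻¹ • v)
    ((continuousOn_id.norm.inv₀ fun v hv => norm_ne_zero_iff.2 hv).smul continuousOn_id)
    (fun v hv => by
      simp only [Set.mem_ofPred_eq, norm_smul, norm_inv, norm_norm]
      exact inv_mul_cancel₀ (norm_ne_zero_iff.2 hv))
  simpa only [hf, hg, inv_one, one_smul] using this

theorem finrank_quat : Module.finrank ℝ ℍ[ℝ] = 4 := Quaternion.finrank_eq_four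

/-- Maps of the square into the three-sphere are nullhomotopic. -/
theorem S3_null {q : (Fin 2 → I) → ℍ[ℝ]} (hq : Continuous q) (hS : ∀ k, q k ∈ S3)
    (h1 : ∀ k ∈ bd 2, q k = 1) : HRel (S3 : Set ℍ[ℝ]) (bd 2) q (fun _ => 1) := by
  have h0 : ∀ k, q k ≠ 0 := fun k h => by
    have := hS k
    rw [h, mem_S3, norm_zero] at this
    exact zero_ne_one this
  have := hrel_const_of_finrank (continuous_cubeIncl 2) (cubeIncl_injective 2)
    (by rw [finrank_quat]; simp) hq h0 one_ne_zero
  exact (this.mono subset_rfl fun k hk => h1 k hk).normalize hS fun _ => norm_one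

theorem SO4_null {h : (Fin 2 → I) → Matrix (Fin 2 ⊕ Fin 2) (Fin 2 ⊕ Fin 2) ℝ} (hc : Continuous h)
    (hS : ∀ k, h k ∈ SUon ℝ (Finset.univ : Finset (Fin 2 ⊕ Fin 2)))
    (h1 : ∀ k ∈ bd 2, h k = 1) :
    HRel (SUon ℝ (Finset.univ : Finset (Fin 2 ⊕ Fin 2)) : Set (Matrix _ _ ℝ)) (bd 2) h
      (fun _ => 1) := by
  obtain ⟨q, p, hq, hp, hqS, hpS, hq1, hp1, he⟩ := exists_frame h hc hS h1
  have H1 := (S3_null hq hqS hq1).comp_left (Q := (SUon ℝ (Finset.univ : Finset (Fin 2 ⊕ Fin 2)) :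
    Set (Matrix _ _ ℝ))) Lq continuous_Lq.continuousOn fun q hq => Lq_mem hq
  have H2 := (S3_null hp hpS hp1).comp_left (Q := (SUon ℝ (Finset.univ : Finset (Fin 2 ⊕ Fin 2)) :
    Set (Matrix _ _ ℝ))) Lq continuous_Lq.continuousOn fun q hq => Lq_mem hq
  have H3 := H2.comp_left (Q := (SUon ℝ (Finset.univ : Finset (Fin 2 ⊕ Fin 2)) :
    Set (Matrix _ _ ℝ))) (fun A => Kq * A * Kq) (by fun_prop) fun A hA => Kq_conj_mem hA
  have := (H1.mul H2 fun a ha b hb => Submonoid.mul_mem _ ha hb).mul H3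
    fun a ha b hb => Submonoid.mul_mem _ ha hb
  simpa only [← he, Lq_one, Matrix.mul_one, Kq_mul_Kq] using this

section
variable {ι μ : Type*} [Fintype ι] [DecidableEq ι] [Fintype μ] [DecidableEq μ]

/-- Maps of the square into the special orthogonal group are nullhomotopic. -/
theorem SO_null (e : (Fin 2 ⊕ Fin 2) ⊕ μ ≃ ι)
    {h : (Fin 2 → I) → Matrix ι ι ℝ} (hc : Continuous h)
    (hS : ∀ k, h k ∈ SUon ℝ (Finset.univ : Finset ι)) (h1 : ∀ k ∈ bd 2, h k = 1) :
    HRel (SUon ℝ (Finset.univ : Finset ι) : Set (Matrix ι ι ℝ)) (bd 2) h (fun _ => 1) := by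
  obtain ⟨B, hB, hBS, hB1, H⟩ := exists_compress_cube e (by simp) hc hS h1
  have := H.trans ((SO4_null hB hBS hB1).emb e)
  simpa using this

/-- The embedding of the first two coordinates. -/
def e2 (e : (Fin 2 ⊕ Fin 2) ⊕ μ ≃ ι) : Fin 2 ⊕ (Fin 2 ⊕ μ) ≃ ι := (Equiv.sumAssoc _ _ _).symm.trans e

theorem emb_emb24 (e : (Fin 2 ⊕ Fin 2) ⊕ μ ≃ ι) (B : Matrix (Fin 2) (Fin 2) ℂ) : emb e (emb24 B) = emb (e2 e) B := by
  ext i j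
  obtain ⟨i, rfl⟩ := e.surjective i
  obtain ⟨j, rfl⟩ := e.surjective j
  rcases i with (i | i) | i <;> rcases j with (j | j) | j <;>
    simp [emb_apply, e2, one_apply]

theorem HRel.cx {X : Type*} [TopologicalSpace X] {C : Set X} {f g : X → Matrix ι ι ℝ}
    (H : HRel (SUon ℝ (Finset.univ : Finset ι) : Set (Matrix ι ι ℝ)) C f g) :
    HRel (SUon ℂ (Finset.univ : Finset ι) : Set (Matrix ι ι ℂ)) C (fun x => cx (f x))
      (fun x => cx (g x)) :=
  H.comp_left PiThree.cx continuous_cx.continuousOn fun _ hy => cx_mem hy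

theorem hrel_emb_Lq (e : (Fin 2 ⊕ Fin 2) ⊕ μ ≃ ι)
    {X : Type*} [TopologicalSpace X] {C : Set X} {q : X → ℍ[ℝ]} (hq : Continuous q)
    (hqS : ∀ x, q x ∈ S3) (hqC : ∀ x ∈ C, q x = 1) :
    HRel (SUon ℂ (Finset.univ : Finset ι) : Set (Matrix ι ι ℂ)) C
      (fun x => cx (emb e (Lq (q x)))) (fun x => emb (e2 e) (psi (q x * q x))) := by
  have := (HRel.Lq_psi (C := C) hq hqS hqC).emb e
  simpa only [emb_emb24, ← cx_emb] using this

/-- The complexification of a real three-dimensional loop is a square. -/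
theorem exists_sq_of_real (e : (Fin 2 ⊕ Fin 2) ⊕ μ ≃ ι)
    {h : (Fin 3 → I) → Matrix ι ι ℝ} (hc : Continuous h)
    (hS : ∀ k, h k ∈ SUon ℝ (Finset.univ : Finset ι)) (h1 : ∀ k ∈ bd 3, h k = 1) :
    ∃ r : (Fin 3 → I) → ℍ[ℝ], Continuous r ∧ (∀ k, r k ∈ S3) ∧ (∀ k ∈ bd 3, r k = 1) ∧
      HRel (SUon ℂ (Finset.univ : Finset ι) : Set (Matrix ι ι ℂ)) (bd 3) (fun k => cx (h k))
        (fun k => emb (e2 e) (psi (r k * r k))) := by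
  obtain ⟨B, hB, hBS, hB1, H⟩ := exists_compress_cube e (by simp) hc hS h1
  obtain ⟨q, p, hq, hp, hqS, hpS, hq1, hp1, he⟩ := exists_frame B hB hBS hB1
  refine ⟨fun k => q k * p k * p k, by fun_prop,
    fun k => mul_mem (mul_mem (hqS k) (hpS k)) (hpS k),
    fun k hk => by simp only [hq1 k hk, hp1 k hk, mul_one], ?_⟩
  refine (H.cx).trans (HRel.trans ?_ (hrel_emb_Lq e (by fun_prop)
    (fun k => mul_mem (mul_mem (hqS k) (hpS k)) (hpS k))
    fun k hk => by simp only [hq1 k hk, hp1 k hk, mul_one]))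
  have hp' : Continuous fun k => cx (Lq (p k)) := by fun_prop
  have hK : (cx Kq)ᴴ = cx Kq := by rw [← cx_conjTranspose, Kq_herm]
  have hKK : cx Kq * cx Kq = 1 := by rw [← map_mul, Kq_mul_Kq, map_one]
  have H1 := (HRel.conj_involution (C := bd 3) hK hKK hp' (fun k => cx_mem (Lq_mem (hpS k)))
    fun k hk => by rw [hp1 k hk, Lq_one, map_one]).symm
  have H2 := (HRel.refl (C := bd 3) (P := (SUon ℂ (Finset.univ : Finset (Fin 2 ⊕ Fin 2)) :
    Set (Matrix _ _ ℂ))) (f := fun k => cx (Lq (q k) * Lq (p k))) (by fun_prop)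
    fun k => cx_mem (mul_mem (Lq_mem (hqS k)) (Lq_mem (hpS k)))).mul H1
    fun a ha b hb => Submonoid.mul_mem _ ha hb
  have H3 := H2.emb e
  simp only [← map_mul] at H3
  simp only [cx_emb]
  convert H3 using 1
  · funext k; rw [he]
  · funext k; rw [Lq_mul, Lq_mul]

end

end

section

/-! ### Loops of symmetric matrices -/

open Quaternion

section
variable {ι μ : Type*} [Fintype ι] [DecidableEq ι] [Fintype μ] [DecidableEq μ]

theorem mul_transpose_mem_SymT {A : Matrix ι ι ℂ} (hA : A ∈ SUon ℂ (Finset.univ : Finset ι)) :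
    A * Aᵀ ∈ SymT ι := ⟨A, hA, rfl⟩

theorem HRel.mul_transpose {X : Type*} [TopologicalSpace X] {C : Set X} {f g : X → Matrix ι ι ℂ}
    (H : HRel (SUon ℂ (Finset.univ : Finset ι) : Set (Matrix ι ι ℂ)) C f g) :
    HRel (SymT ι) C (fun x => f x * (f x)ᵀ) (fun x => g x * (g x)ᵀ) :=
  H.comp_left (fun A => A * Aᵀ) (by fun_prop) fun _ hA => mul_transpose_mem_SymT hA

/-- The loop of symmetric matrices attached to a loop of unit quaternions. -/
def symLoop (e : (Fin 2 ⊕ Fin 2) ⊕ μ ≃ ι) (q : ℍ[ℝ]) : Matrix ι ι ℂ :=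
  emb (e2 e) (psi q) * (emb (e2 e) (psi q))ᵀ

theorem emb_psi_mem (e : (Fin 2 ⊕ Fin 2) ⊕ μ ≃ ι) {q : ℍ[ℝ]} (hq : q ∈ S3) :
    emb (e2 e) (psi q) ∈ SUon ℂ (Finset.univ : Finset ι) :=
  SUon_le_univ _ (emb_mem _ (psi_mem hq))

/-- Every loop of symmetric matrices comes from a loop of unit quaternions. -/
theorem exists_symLoop (e : (Fin 2 ⊕ Fin 2) ⊕ μ ≃ ι) {F : (Fin 3 → I) → Matrix ι ι ℂ}
    (hF : Continuous F) (hFT : ∀ k, F k ∈ SymT ι) (hF1 : ∀ k ∈ bd 3, F k = 1) :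
    ∃ r : (Fin 3 → I) → ℍ[ℝ], Continuous r ∧ (∀ k, r k ∈ S3) ∧ (∀ k ∈ bd 3, r k = 1) ∧
      HRel (SymT ι) (bd 3) F (fun k => symLoop e (r k)) := by
  obtain ⟨W, s, hW, hs, hdiag, hs1, hact⟩ := exists_sym_transport ι
  obtain ⟨γ, hγ, hγS, hγF, hγ1⟩ := exists_cube_lift
    (fun (g S S' : Matrix ι ι ℂ) => g * S * gᵀ = S') (SUon ℂ Finset.univ) (SymT ι) W hW s hs hdiag
    hs1 (fun x hx y hy h => (hact x hx y hy h).1) (fun x hx y hy h => (hact x hx y hy h).2)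
    (fun x _ => by simp)
    (fun a b x y z h h' => by
      rw [← h', ← h, transpose_mul]; simp only [Matrix.mul_assoc])
    F hF hFT 1 hF1
  simp only [Matrix.mul_one] at hγF
  let l : (Fin 2 → I) → Matrix ι ι ℝ := fun u => (γ (Fin.cons 1 u)).map Complex.re
  have hl : ∀ u, l u ∈ SUon ℝ (Finset.univ : Finset ι) ∧ cx (l u) = γ (Fin.cons 1 u) := fun u =>
    exists_real (hγS _) (by rw [hγF, hF1 _ ⟨0, Or.inr rfl⟩])
  have hlc : Continuous l := by
    refine Continuous.matrix_map ?_ Complex.continuous_re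
    fun_prop
  obtain ⟨H, hH, hH0, hH1, hHP, hHC⟩ := (SO_null e hlc (fun u => (hl u).1) fun u hu => by
    obtain ⟨j, hj⟩ := cons_mem_bd hu 1
    simp only [l, hγ1 _ j hj]
    ext a b
    simp [one_apply, apply_ite]).symm
  let δ : (Fin 3 → I) → Matrix ι ι ℝ := fun k => H (fun i => k i.succ, k 0)
  have hδ : ∀ k, δ k ∈ SUon ℝ (Finset.univ : Finset ι) := fun k => hHP _
  have hg1 : ∀ k ∈ bd 3, γ k * (cx (δ k))ᵀ = 1 := by
    intro k hk
    rcases mem_bd_succ hk with ⟨j, hj⟩ | h0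
    · rw [hγ1 k j hj, Matrix.one_mul]
      have : δ k = 1 := by
        rcases Fin.eq_zero_or_eq_succ j with rfl | ⟨j, rfl⟩
        · have : k 0 = 0 := hj.resolve_right fun h => h.1 rfl
          simp only [δ, this, hH0]
        · exact hHC _ ⟨j, hj.imp_right And.right⟩ _
      rw [this, map_one, transpose_one]
    · have h1 : γ k = cx (δ k) := by
        simp only [δ, h0, hH1]
        rw [(hl _).2, ← h0]
        exact congrArg γ (Fin.cons_self_tail k).symm
      rw [h1, cx_mul_transpose (hδ k)]
  have hgS : ∀ k, γ k * (cx (δ k))ᵀ ∈ SUon ℂ (Finset.univ : Finset ι) := by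
    intro k
    refine Submonoid.mul_mem _ (hγS k) ?_
    rw [← cx_transpose]
    refine cx_mem ?_
    have h1 := hδ k
    rw [mem_SUon_univ'] at h1 ⊢
    rw [conjTranspose_eq_transpose_of_trivial] at h1 ⊢
    rw [transpose_transpose, det_transpose]
    exact ⟨mul_eq_one_comm.1 h1.1, h1.2⟩
  have hgc : Continuous fun k => γ k * (cx (δ k))ᵀ := by fun_prop
  have hgF : ∀ k, γ k * (cx (δ k))ᵀ * (γ k * (cx (δ k))ᵀ)ᵀ = F k := by
    intro k
    rw [transpose_mul, transpose_transpose, ← hγF]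
    calc _ = γ k * ((cx (δ k))ᵀ * cx (δ k)) * (γ k)ᵀ := by simp only [Matrix.mul_assoc]
      _ = _ := by rw [mul_eq_one_comm.1 (cx_mul_transpose (hδ k)), Matrix.mul_one]
  obtain ⟨B, hB, hBS, hB1, HB⟩ := exists_compress_cube (e2 e) (by simp) hgc hgS hg1
  refine ⟨fun k => psiInv (B k), by fun_prop, fun k => psiInv_mem (hBS k),
    fun k hk => by beta_reduce; rw [hB1 k hk, ← map_one psi, psiInv_psi], ?_⟩
  have := HB.mul_transpose
  simp only [hgF] at this
  simpa only [symLoop, psi_psiInv (hBS _)] using this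

theorem hrel_of_emb_psi (e : (Fin 2 ⊕ Fin 2) ⊕ μ ≃ ι) {f g : (Fin 3 → I) → ℍ[ℝ]}
    (hf : ∀ k, f k ∈ S3) (hg : ∀ k, g k ∈ S3)
    (H : HRel (SUon ℂ (Finset.univ : Finset ι) : Set (Matrix ι ι ℂ)) (bd 3)
      (fun k => emb (e2 e) (psi (f k))) (fun k => emb (e2 e) (psi (g k)))) :
    HRel (S3 : Set ℍ[ℝ]) (bd 3) f g := by
  obtain ⟨F, hF, h0, h1, hP, hC⟩ := H
  obtain ⟨B, hB, hBS, -, hA⟩ := exists_compress_emb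
    (j := fun p : (Fin 3 → I) × I => (cubeIncl 3 p.1, (p.2 : ℝ)))
    (by have := continuous_cubeIncl 3; fun_prop)
    (fun p q h => by
      rw [Prod.mk.injEq] at h
      exact Prod.ext (cubeIncl_injective 3 h.1) (Subtype.ext h.2)) (e2 e) (by simp) hF hP
  refine ⟨fun p => psiInv (B p), by fun_prop, fun k => ?_, fun k => ?_,
    fun p => psiInv_mem (hBS p), fun k hk t => ?_⟩
  · beta_reduce; rw [hA _ _ (psi_mem (hf k)) (h0 k), psiInv_psi]
  · beta_reduce; rw [hA _ _ (psi_mem (hg k)) (h1 k), psiInv_psi]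
  · beta_reduce; rw [hA _ _ (psi_mem (hf k)) (hC k hk t), psiInv_psi]

/-- A loop of unit quaternions gives a trivial loop of symmetric matrices if and only if it is
homotopic to a square. -/
theorem symLoop_null_iff (e : (Fin 2 ⊕ Fin 2) ⊕ μ ≃ ι) {f : (Fin 3 → I) → ℍ[ℝ]} (hf : Continuous f)
    (hfS : ∀ k, f k ∈ S3) (hf1 : ∀ k ∈ bd 3, f k = 1) :
    HRel (SymT ι) (bd 3) (fun k => symLoop e (f k)) (fun _ => 1) ↔
    ∃ r : (Fin 3 → I) → ℍ[ℝ], Continuous r ∧ (∀ k, r k ∈ S3) ∧ (∀ k ∈ bd 3, r k = 1) ∧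
      HRel (S3 : Set ℍ[ℝ]) (bd 3) f (fun k => r k * r k) := by
  constructor
  · rintro ⟨F, hF, hF0, hF1, hFT, hFC⟩
    obtain ⟨W, s, hW, hs, hdiag, hs1, hact⟩ := exists_sym_transport ι
    obtain ⟨γ, hγ, hγ0, hγS, hγF, hγ1⟩ := exists_transport
      (fun (g S S' : Matrix ι ι ℂ) => g * S * gᵀ = S') (SUon ℂ Finset.univ) (SymT ι) W hW s hs hdiag
      hs1 (fun x hx y hy h => (hact x hx y hy h).1) (fun x hx y hy h => (hact x hx y hy h).2)
      (fun x _ => by simp)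
      (fun a b x y z h h' => by
        rw [← h', ← h, transpose_mul]; simp only [Matrix.mul_assoc])
      F hF hFT
    let A : (Fin 3 → I) → Matrix ι ι ℂ := fun k => γ (k, 1) * emb (e2 e) (psi (f k))
    have hAS : ∀ k, A k ∈ SUon ℂ (Finset.univ : Finset ι) := fun k =>
      Submonoid.mul_mem _ (hγS _) (emb_psi_mem e (hfS k))
    have hA : ∀ k, A k * (A k)ᵀ = 1 := by
      intro k
      have := hγF k 1
      simp only [hF0, hF1, symLoop] at this
      rw [← this, transpose_mul]
      simp only [Matrix.mul_assoc, A]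
    have hγC : ∀ k ∈ bd 3, ∀ t, γ (k, t) = 1 := fun k hk t =>
      hγ1 k (fun t => (hFC k hk t).trans (hF0 k).symm) t
    have hA1 : ∀ k ∈ bd 3, A k = 1 := fun k hk => by
      simp only [A, hγC k hk, hf1 k hk, map_one, Matrix.mul_one]
    have H1 : HRel (SUon ℂ (Finset.univ : Finset ι) : Set (Matrix ι ι ℂ)) (bd 3)
        (fun k => emb (e2 e) (psi (f k))) A :=
      ⟨fun p => γ p * emb (e2 e) (psi (f p.1)), by fun_prop,
        fun k => by simp only [hγ0, Matrix.one_mul], fun k => rfl,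
        fun p => Submonoid.mul_mem _ (hγS _) (emb_psi_mem e (hfS _)),
        fun k hk t => by simp only [hγC k hk, Matrix.one_mul]⟩
    have hAc := H1.continuous_right
    have hre := fun k => exists_real (hAS k) (hA k)
    obtain ⟨r, hr, hrS, hr1, H2⟩ := exists_sq_of_real e
      (h := fun k => (A k).map Complex.re) (hAc.matrix_map Complex.continuous_re)
      (fun k => (hre k).1) (fun k hk => by
        rw [hA1 k hk]; ext a b; simp [one_apply, apply_ite])
    simp only [(hre _).2] at H2
    exact ⟨r, hr, hrS, hr1, hrel_of_emb_psi e hfS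
      (fun k => mul_mem (hrS k) (hrS k)) (H1.trans H2)⟩
  · rintro ⟨r, hr, hrS, hr1, H⟩
    have H1 := H.comp_left (Q := (SUon ℂ (Finset.univ : Finset ι) : Set (Matrix ι ι ℂ)))
      (fun q => emb (e2 e) (psi q)) (by fun_prop) fun q hq => emb_psi_mem e hq
    have H2 := (H1.trans (hrel_emb_Lq e (C := bd 3) hr hrS hr1).symm).mul_transpose
    simpa only [symLoop, cx_mul_transpose (SUon_le_univ _ (emb_mem e (Lq_mem (hrS _))))] using H2

end

end

section

open Quaternion

/-! ### The second homotopy group of the two-sphere of imaginary unit quaternions -/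

/-- The imaginary unit. -/
def qi : ℍ[ℝ] := quat 0 1 0 0

theorem qi_mul_qi : qi * qi = -1 := by ext <;> simp [qi]

theorem star_qi : star qi = -qi := by ext <;> simp [qi]

/-- The circle subgroup of the unit quaternions. -/
def qe (θ : ℝ) : ℍ[ℝ] := quat (Real.cos θ) (Real.sin θ) 0 0

@[fun_prop] theorem continuous_qe : Continuous qe :=
  continuous_quat (by fun_prop) (by fun_prop) (by fun_prop) (by fun_prop)

theorem qe_zero : qe 0 = 1 := by ext <;> simp [qe]

theorem qe_add (a b : ℝ) : qe (a + b) = qe a * qe b := by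
  ext <;> simp [qe, Real.cos_add, Real.sin_add] <;> ring

theorem qe_mul_qi (a : ℝ) : qe a * qi = qi * qe a := by ext <;> simp [qe, qi]

theorem qe_mem (a : ℝ) : qe a ∈ S3 := by
  rw [mem_S3_iff_normSq, normSq_def']; simp [qe]

theorem qe_two_pi (n : ℤ) : qe (2 * Real.pi * n) = 1 := by
  have h : 2 * Real.pi * n = n * (2 * Real.pi) := by ring
  ext <;> simp [qe, h, Real.cos_int_mul_two_pi]
  rw [show (n : ℝ) * (2 * Real.pi) = ((2 * n : ℤ) : ℝ) * Real.pi by push_cast; ring,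
    Real.sin_int_mul_pi]

theorem commute_qi {q : ℍ[ℝ]} (h : q * qi = qi * q) : q.imJ = 0 ∧ q.imK = 0 := by
  have h1 := congrArg (fun x : ℍ[ℝ] => x.imJ) h
  have h2 := congrArg (fun x : ℍ[ℝ] => x.imK) h
  simp [qi] at h1 h2
  constructor <;> linarith

theorem mul_mem_S2 {q x : ℍ[ℝ]} (hq : q ∈ S3) (hx : x * x = -1) :
    (q * x * star q) * (q * x * star q) = -1 := by
  have h := S3.star_mul hq
  calc (q * x * star q) * (q * x * star q) = q * x * (star q * q) * x * star q := by noncomm_ring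
    _ = q * (x * x) * star q := by rw [h]; noncomm_ring
    _ = -1 := by rw [hx, mul_neg, mul_one, neg_mul, S3.mul_star hq]

/-- Lifting of angles. -/
theorem circle_lift {K : Type*} [TopologicalSpace K] [CompactSpace K] {h : K × I → ℍ[ℝ]}
    (hh : Continuous h) (hS : ∀ p, h p ∈ S3) (hc : ∀ p, h p * qi = qi * h p) :
    ∃ θ : K × I → ℝ, Continuous θ ∧ (∀ k, θ (k, 0) = 0) ∧
      (∀ k t, qe (θ (k, t)) * h (k, 0) = h (k, t)) ∧
      ∀ k, (∀ t, h (k, t) = h (k, 0)) → ∀ t, θ (k, t) = 0 := by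
  have hcont : Continuous fun p : ℍ[ℝ] × ℍ[ℝ] =>
      (((p.2 * star p.1).re : ℂ) + (p.2 * star p.1).imI * Complex.I) := by
    have h1 : Continuous fun p : ℍ[ℝ] × ℍ[ℝ] => (p.2 * star p.1).re :=
      Quaternion.continuous_re.comp (by fun_prop)
    have h2 : Continuous fun p : ℍ[ℝ] × ℍ[ℝ] => (p.2 * star p.1).imI :=
      Quaternion.continuous_imI.comp (by fun_prop)
    fun_prop
  have hact : ∀ x : ℍ[ℝ], x ∈ S3 ∧ x * qi = qi * x → ∀ y : ℍ[ℝ], y ∈ S3 ∧ y * qi = qi * y →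
      qe (Complex.arg (((y * star x).re : ℂ) + (y * star x).imI * Complex.I)) * x = y := by
    intro x hx y hy
    obtain ⟨hxS, hxc⟩ := hx
    obtain ⟨hyS, hyc⟩ := hy
    obtain ⟨hx1, hx2⟩ := commute_qi hxc
    obtain ⟨hy1, hy2⟩ := commute_qi hyc
    have hyx : y * star x ∈ S3 := S3.mul_mem hyS (S3.star_mem hxS)
    have e : ∀ q : ℍ[ℝ], q ∈ S3 → q.imJ = 0 → q.imK = 0 →
        qe (Complex.arg ((q.re : ℂ) + q.imI * Complex.I)) = q := by
      intro q hq hJ hK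
      have hn : ‖(q.re : ℂ) + q.imI * Complex.I‖ = 1 := by
        rw [mem_S3_iff_normSq, normSq_def', hJ, hK] at hq
        rw [Complex.norm_add_mul_I, Real.sqrt_eq_one]
        linarith
      have h0 : (q.re : ℂ) + q.imI * Complex.I ≠ 0 := fun h => by rw [h] at hn; simp at hn
      ext
      · simp [qe, Complex.cos_arg h0, hn]
      · simp [qe, Complex.sin_arg, hn]
      · simp [qe, hJ]
      · simp [qe, hK]
    rw [e _ hyx, mul_assoc, S3.star_mul hxS, mul_one]
    · simp [hx1, hx2, hy1, hy2]
    · simp [hx1, hx2, hy1, hy2]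
  obtain ⟨γ, h1, h2, -, h4, h5⟩ := exists_transport (G := Multiplicative ℝ)
    (fun g x y => qe g.toAdd * x = y) ⊤ {q | q ∈ S3 ∧ q * qi = qi * q}
    {p : ℍ[ℝ] × ℍ[ℝ] | 0 < (p.2 * star p.1).re}
    (isOpen_lt continuous_const (Quaternion.continuous_re.comp (by fun_prop)))
    (fun p => Multiplicative.ofAdd (Complex.arg (((p.2 * star p.1).re : ℂ) +
      (p.2 * star p.1).imI * Complex.I)))
    (by
      refine continuous_ofAdd.comp_continuousOn fun p hp => ContinuousAt.continuousWithinAt ?_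
      refine ContinuousAt.comp (f := fun p : ℍ[ℝ] × ℍ[ℝ] =>
        (((p.2 * star p.1).re : ℂ) + (p.2 * star p.1).imI * Complex.I))
        (Complex.continuousAt_arg (Or.inl ?_)) hcont.continuousAt
      simpa using hp)
    (fun x hx => by
      rw [Set.mem_ofPred_eq]
      simp only [S3.mul_star hx.1, Quaternion.re_one, zero_lt_one])
    (fun x hx => by simp only [S3.mul_star hx.1]; simp)
    (fun _ _ _ _ _ => trivial)
    (fun x hx y hy _ => hact x hx y hy)
    (fun x hx => by simp [qe_zero])
    (fun a b x y z ha hb => by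
      rw [toAdd_mul, qe_add, mul_assoc, ha, hb])
    h hh (fun p => ⟨hS p, hc p⟩)
  exact ⟨fun p => (γ p).toAdd, continuous_toAdd.comp h1, fun k => by simp [h2], h4,
    fun k hk t => by simp [h5 k hk t]⟩
/-- The two-sphere of imaginary unit quaternions. -/
def S2 : Set ℍ[ℝ] := {q | q * q = -1}

theorem S2.mem_S3 {q : ℍ[ℝ]} (h : q ∈ S2) : q ∈ S3 := by
  have h1 : ‖q * q‖ = 1 := by rw [show q * q = -1 from h, norm_neg, norm_one]
  rw [norm_mul] at h1
  rw [PiThree.mem_S3]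
  nlinarith [norm_nonneg q]

theorem S2_transport_mul {x y : ℍ[ℝ]} (hx : x ∈ S2) (hy : y ∈ S2) :
    y * (1 - y * x) = (1 - y * x) * x := by
  have hx : x * x = -1 := hx
  have hy : y * y = -1 := hy
  calc y * (1 - y * x) = y - (y * y) * x := by noncomm_ring
    _ = x - y * (x * x) := by rw [hx, hy]; noncomm_ring
    _ = (1 - y * x) * x := by noncomm_ring

/-- The local section of the action of the unit quaternions on the two-sphere. -/
def S2sec (p : ℍ[ℝ] × ℍ[ℝ]) : ℍ[ℝ] := ‖1 - p.2 * p.1‖⁻¹ • (1 - p.2 * p.1)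

theorem continuousOn_S2sec : ContinuousOn S2sec {p | 1 - p.2 * p.1 ≠ 0} := by
  unfold S2sec
  exact ((by fun_prop : Continuous fun p : ℍ[ℝ] × ℍ[ℝ] => ‖1 - p.2 * p.1‖).continuousOn.inv₀
    fun p hp => norm_ne_zero_iff.2 hp).smul (by fun_prop)

theorem S2sec_diag {x : ℍ[ℝ]} (hx : x ∈ S2) : S2sec (x, x) = 1 := by
  have hx : x * x = -1 := hx
  have : (1 : ℍ[ℝ]) - -1 = (2 : ℝ) • 1 := by module
  simp only [S2sec, hx, this, norm_smul, norm_one, smul_smul]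
  norm_num

theorem S2sec_mem {p : ℍ[ℝ] × ℍ[ℝ]} (hp : 1 - p.2 * p.1 ≠ 0) : S2sec p ∈ S3 := by
  rw [mem_S3, S2sec, norm_smul, norm_inv, norm_norm, inv_mul_cancel₀ (norm_ne_zero_iff.2 hp)]

theorem S2sec_act {x y : ℍ[ℝ]} (hx : x ∈ S2) (hy : y ∈ S2) :
    y * S2sec (x, y) = S2sec (x, y) * x := by
  simp only [S2sec, mul_smul_comm, smul_mul_assoc, S2_transport_mul hx hy]

theorem S2_ne {x : ℍ[ℝ]} (hx : x ∈ S2) : 1 - x * x ≠ 0 := by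
  rw [show x * x = -1 from hx]
  intro h
  have := congrArg (fun x : ℍ[ℝ] => x.re) h
  simp at this

/-- `WRel w n`: the square `w` in the two-sphere has winding number `n`. -/
def WRel (w : (Fin 2 → I) → ℍ[ℝ]) (n : ℤ) : Prop :=
  ∃ (f : (Fin 2 → I) → ℍ[ℝ]) (θ : I → ℝ), Continuous f ∧ (∀ k, f k ∈ S3) ∧
    (∀ k j, (k j = 0 ∨ (j ≠ 0 ∧ k j = 1)) → f k = 1) ∧ Continuous θ ∧ θ 0 = 0 ∧
    θ 1 = 2 * Real.pi * n ∧ (∀ k, k 0 = 1 → f k = qe (θ (k 1))) ∧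
    ∀ k, w k = f k * qi * star (f k)

namespace WRel
variable {w w' : (Fin 2 → I) → ℍ[ℝ]} {n m : ℤ}

theorem continuous (h : WRel w n) : Continuous w := by
  obtain ⟨f, θ, hf, -, -, -, -, -, -, hw⟩ := h
  rw [funext hw]; fun_prop

theorem mem (h : WRel w n) (k) : w k ∈ S2 := by
  obtain ⟨f, θ, hf, hS, -, -, -, -, -, hw⟩ := h
  rw [hw]; exact mul_mem_S2 (hS k) qi_mul_qi

theorem conj_qe (a : ℝ) : qe a * qi * star (qe a) = qi := by
  rw [qe_mul_qi, mul_assoc, S3.mul_star (qe_mem a), mul_one]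

theorem bd (h : WRel w n) : ∀ k ∈ bd 2, w k = qi := by
  obtain ⟨f, θ, hf, hS, h1, -, -, -, h2, hw⟩ := h
  intro k hk
  rw [hw]
  rcases mem_bd_succ hk with ⟨j, hj⟩ | h
  · rw [h1 k j hj, star_one, one_mul, mul_one]
  · rw [h2 k h, conj_qe]

theorem total (hw : Continuous w) (hS : ∀ k, w k ∈ S2) (h1 : ∀ k ∈ PiThree.bd 2, w k = qi) :
    ∃ n, WRel w n := by
  obtain ⟨f, hf, hfS, hfA, hf1⟩ := exists_cube_lift
    (fun (g : ℍ[ℝ]) (x y : ℍ[ℝ]) => y * g = g * x) S3 S2 {p | 1 - p.2 * p.1 ≠ 0}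
    (isOpen_ne_fun (by fun_prop) (by fun_prop)) S2sec continuousOn_S2sec (fun x hx => S2_ne hx)
    (fun x hx => S2sec_diag hx) (fun x _ y _ h => S2sec_mem h)
    (fun x hx y hy _ => S2sec_act hx hy) (fun x _ => by simp)
    (fun a b x y z h h' => by rw [← mul_assoc, h', mul_assoc, h, mul_assoc]) w hw hS qi h1
  obtain ⟨θ, hθ, hθ0, hθA, -⟩ := circle_lift (K := Unit) (h := fun p => f ![1, p.2])
    (by
      refine hf.comp (continuous_pi fun i => ?_)
      fin_cases i
      · exact continuous_const
      · exact continuous_snd) (fun _ => hfS _) (fun p => by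
        rw [← hfA, h1 _ ⟨0, Or.inr rfl⟩])
  have h10 : f ![1, 0] = 1 := hf1 _ 1 (Or.inl rfl)
  have h11 : f ![1, 1] = 1 := hf1 _ 1 (Or.inr ⟨one_ne_zero, rfl⟩)
  have h4 := hθA () 1
  rw [h10, h11, mul_one] at h4
  obtain ⟨n, hn⟩ := (Real.cos_eq_one_iff _).1 (congrArg (fun x : ℍ[ℝ] => x.re) h4)
  refine ⟨n, f, fun t => θ ((), t), hf, hfS, hf1, by fun_prop, hθ0 _, by beta_reduce; rw [← hn]; ring, ?_, ?_⟩
  · intro k hk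
    have := hθA () (k 1)
    rw [h10, mul_one] at this
    rw [this]
    congr 1
    ext i; fin_cases i <;> simp [hk]
  · intro k
    rw [← hfA, mul_assoc, S3.mul_star (hfS k), mul_one]

theorem add (h : WRel w n) (h' : WRel w' m) : WRel (cc 1 w w') (n + m) := by
  obtain ⟨f, θ, hf, hfS, hf1, hθ, hθ0, hθ1, hfθ, hw⟩ := h
  obtain ⟨f', θ', hf', hfS', hf1', hθ', hθ0', hθ1', hfθ', hw'⟩ := h'
  refine ⟨cc 1 f f', fun t => θ (firstHalf t) + θ' (secondHalf t), ?_, ?_, ?_, by fun_prop, ?_, ?_,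
    ?_, ?_⟩
  · exact continuous_cc hf hf' (fun k hk => hf1 k 1 (Or.inr ⟨one_ne_zero, hk⟩))
      (fun k hk => hf1' k 1 (Or.inl hk))
  · intro k; unfold cc; split_ifs <;> simp [hfS, hfS']
  · intro k j hj
    unfold cc
    by_cases hj1 : j = 1
    · subst hj1
      split_ifs with h
      · refine hf1 _ 1 (Or.inl ?_)
        rcases hj with hj | ⟨-, hj⟩
        · simp [hj, firstHalf_zero]
        · rw [hj] at h; norm_num at h
      · refine hf1' _ 1 (Or.inr ⟨one_ne_zero, ?_⟩)
        rcases hj with hj | ⟨-, hj⟩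
        · rw [hj] at h; norm_num at h
        · simp [hj, secondHalf_one]
    · split_ifs with h
      · exact hf1 _ j (by rwa [Function.update_of_ne hj1])
      · exact hf1' _ j (by rwa [Function.update_of_ne hj1])
  · beta_reduce; rw [firstHalf_zero, secondHalf_of_le (by norm_num), hθ0, hθ0', add_zero]
  · beta_reduce; rw [secondHalf_one, firstHalf_of_ge (by norm_num), hθ1, hθ1']; push_cast; ring
  · intro k hk
    unfold cc
    beta_reduce
    split_ifs with h
    · rw [hfθ _ (by simpa using hk), secondHalf_of_le h, hθ0', add_zero, Function.update_self]
    · rw [hfθ' _ (by simpa using hk), firstHalf_of_ge (not_le.1 h).le, hθ1, qe_add, qe_two_pi,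
        one_mul, Function.update_self]
  · intro k
    unfold cc; split_ifs <;> simp [hw, hw']

theorem exists_of_int (n : ℤ) : ∃ w, WRel w n := by
  let c : I → ℍ[ℝ] := fun t => qe (2 * Real.pi * n * t)
  have hc : Continuous c := by fun_prop
  have H := (hrel_const_of_finrank (j := fun t : I => (t : ℝ)) (by fun_prop)
    Subtype.val_injective (by rw [finrank_quat]; simp) hc
    (fun t h => by
      have := qe_mem (2 * Real.pi * n * t)
      rw [show qe (2 * Real.pi * n * t) = 0 from h, mem_S3, norm_zero] at this
      exact zero_ne_one this) (one_ne_zero)).normalize (fun t => qe_mem _) fun _ => norm_one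
  obtain ⟨F, hF, hF0, hF1, hFS, hFC⟩ := H
  have hc0 : c 0 = 1 := by simp [c, qe_zero]
  have hc1 : c 1 = 1 := by simp [c, qe_two_pi]
  refine ⟨_, fun k => F (k 1, σ (k 0)), fun t => 2 * Real.pi * n * t, by fun_prop, fun k => hFS _,
    fun k j hj => ?_, by fun_prop, by simp, by simp, fun k hk => ?_, fun k => rfl⟩
  · beta_reduce
    fin_cases j
    · rcases hj with hj | ⟨h, -⟩
      · rw [show k 0 = 0 from hj, symm_zero, hF1]
      · exact absurd rfl h
    · rcases hj with hj | ⟨-, hj⟩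
      · rw [show k 1 = 0 from hj, hFC _ hc0, hc0]
      · rw [show k 1 = 1 from hj, hFC _ hc1, hc1]
  · beta_reduce; rw [hk, symm_one, hF0]

theorem null (h : WRel w 0) : HRel S2 (PiThree.bd 2) w (fun _ => qi) := by
  obtain ⟨f, θ, hf, hfS, hf1, hθ, hθ0, hθ1, hfθ, hw⟩ := h
  have hg := S3_null (q := fun k => f k * qe (-(k 0 * θ (k 1)))) (by fun_prop)
    (fun k => S3.mul_mem (hfS k) (qe_mem _)) (by
      intro k hk
      rcases mem_bd_succ hk with ⟨j, hj⟩ | h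
      · rw [hf1 k j hj, one_mul]
        have : (k 0 : ℝ) * θ (k 1) = 0 := by
          fin_cases j
          · rcases hj with hj | ⟨h, -⟩
            · rw [show k 0 = 0 from hj]; simp
            · exact absurd rfl h
          · rcases hj with hj | ⟨-, hj⟩
            · rw [show k 1 = 0 from hj]; simp [hθ0]
            · rw [show k 1 = 1 from hj]; simp [hθ1]
        rw [this, neg_zero, qe_zero]
      · rw [hfθ k h, h, ← qe_add]; simp [qe_zero])
  have := hg.comp_left (Q := S2) (fun q => q * qi * star q) (by fun_prop)
    (fun q hq => mul_mem_S2 hq qi_mul_qi)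
  convert this using 1
  · funext k
    have := conj_qe (-((k 0 : ℝ) * θ (k 1)))
    calc w k = f k * qi * star (f k) := hw k
      _ = f k * (qe (-((k 0 : ℝ) * θ (k 1))) * qi * star (qe (-((k 0 : ℝ) * θ (k 1))))) *
          star (f k) := by rw [this]
      _ = _ := by rw [star_mul]; simp only [mul_assoc]
  · simp

theorem eq_zero (h : WRel w n) (H : HRel S2 (PiThree.bd 2) w (fun _ => qi)) : n = 0 := by
  have hwb := h.bd
  obtain ⟨f, θ, hf, hfS, hf1, hθ, hθ0, hθ1, hfθ, hw⟩ := h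
  obtain ⟨F, hF, hF0, hF1, hFS, hFC⟩ := H
  obtain ⟨γ, hγ, hγ0, hγS, hγA, hγC⟩ := exists_transport
    (fun (g : ℍ[ℝ]) (x y : ℍ[ℝ]) => y * g = g * x) S3 S2 {p | 1 - p.2 * p.1 ≠ 0}
    (isOpen_ne_fun (by fun_prop) (by fun_prop)) S2sec continuousOn_S2sec (fun x hx => S2_ne hx)
    (fun x hx => S2sec_diag hx) (fun x _ y _ h => S2sec_mem h)
    (fun x hx y hy _ => S2sec_act hx hy) (fun x _ => by simp)
    (fun a b x y z h h' => by rw [← mul_assoc, h', mul_assoc, h, mul_assoc]) F hF hFS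
  have hγb : ∀ k ∈ PiThree.bd 2, γ (k, 1) = 1 := fun k hk =>
    hγC k (fun t => by rw [hFC k hk, hFC k hk]) 1
  let g : (Fin 2 → I) → ℍ[ℝ] := fun k => γ (k, 1) * f k
  have hg : Continuous g := by fun_prop
  have hgc : ∀ k, g k * qi = qi * g k := fun k => by
    have h1 := hγA k 1
    rw [hF1, hF0, hw] at h1
    simp only [g]
    rw [← mul_assoc, h1, ← mul_assoc, ← mul_assoc, mul_assoc _ (star (f k)), S3.star_mul (hfS k), mul_one]
  obtain ⟨φ, hφ, hφ0, hφA, hφC⟩ := circle_lift (K := I) (h := fun p => g ![p.2, p.1])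
    (by
      refine hg.comp (continuous_pi fun i => ?_)
      fin_cases i
      · exact continuous_snd
      · exact continuous_fst) (fun _ => S3.mul_mem (hγS _) (hfS _)) (fun p => hgc _)
  have hg0 : ∀ t, g ![0, t] = 1 := fun t => by
    simp only [g]
    rw [hγb _ ⟨0, Or.inl rfl⟩, hf1 _ 0 (Or.inl rfl), mul_one]
  have hg1 : ∀ t, g ![1, t] = qe (θ t) := fun t => by
    simp only [g]
    rw [hγb _ ⟨0, Or.inr rfl⟩, hfθ _ rfl, one_mul]; rfl
  have hgt0 : ∀ s, g ![s, 0] = 1 := fun t => by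
    simp only [g]
    rw [hγb _ ⟨1, Or.inl rfl⟩, hf1 _ 1 (Or.inl rfl), mul_one]
  have hgt1 : ∀ s, g ![s, 1] = 1 := fun t => by
    simp only [g]
    rw [hγb _ ⟨1, Or.inr rfl⟩, hf1 _ 1 (Or.inr ⟨one_ne_zero, rfl⟩), mul_one]
  have hφ00 : φ (0, 1) = 0 := hφC 0 (fun t => by rw [hgt0, hgt0]) 1
  have hφ11 : φ (1, 1) = 0 := hφC 1 (fun t => by rw [hgt1, hgt1]) 1
  have hcos : ∀ t, Real.cos (θ t - φ (t, 1)) = 1 := fun t => by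
    have h1 := hφA t 1
    rw [hg0, hg1, mul_one] at h1
    have : qe (θ t - φ (t, 1)) = 1 := by
      rw [sub_eq_add_neg, qe_add, ← h1, ← qe_add, add_neg_cancel, qe_zero]
    exact congrArg (fun x : ℍ[ℝ] => x.re) this
  have hd : Continuous fun t => θ t - φ (t, 1) := by fun_prop
  have hpi := Real.pi_pos
  by_contra hn
  rcases lt_or_gt_of_ne hn with hn | hn
  · have hn' : (n : ℝ) ≤ -1 := by exact_mod_cast (by omega : n ≤ -1)
    obtain ⟨t, ht⟩ := mem_range_of_exists_le_of_exists_ge (c := -Real.pi) hd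
      ⟨1, by rw [hφ11, hθ1]; nlinarith⟩ ⟨0, by rw [hφ00, hθ0]; linarith⟩
    have := hcos t
    beta_reduce at ht
    rw [ht, Real.cos_neg, Real.cos_pi] at this
    norm_num at this
  · have hn' : (1 : ℝ) ≤ n := by exact_mod_cast hn
    obtain ⟨t, ht⟩ := mem_range_of_exists_le_of_exists_ge (c := Real.pi) hd
      ⟨0, by rw [hφ00, hθ0]; linarith⟩ ⟨1, by rw [hφ11, hθ1]; nlinarith⟩
    have := hcos t
    beta_reduce at ht
    rw [ht, Real.cos_pi] at this
    norm_num at this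

end WRel

end

section

open Quaternion

/-! ### Stereographic paths on the three-sphere -/

/-- Stereographic projection from `1`. -/
def rho (q : ℍ[ℝ]) : ℍ[ℝ] := (1 - q.re)⁻¹ • q.im

/-- Inverse of the stereographic projection from `1`. -/
def rhoInv (v : ℍ[ℝ]) : ℍ[ℝ] :=
  quat ((normSq v - 1) / (normSq v + 1)) (2 * v.imI / (normSq v + 1))
    (2 * v.imJ / (normSq v + 1)) (2 * v.imK / (normSq v + 1))

theorem normSq_add_one_ne (v : ℍ[ℝ]) : normSq v + 1 ≠ 0 := by
  have := normSq_nonneg (a := v)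
  positivity

@[fun_prop] theorem continuous_re' {X : Type*} [TopologicalSpace X] {f : X → ℍ[ℝ]}
    (hf : Continuous f) : Continuous fun x => (f x).re := Quaternion.continuous_re.comp hf
@[fun_prop] theorem continuous_imI' {X : Type*} [TopologicalSpace X] {f : X → ℍ[ℝ]}
    (hf : Continuous f) : Continuous fun x => (f x).imI := Quaternion.continuous_imI.comp hf
@[fun_prop] theorem continuous_imJ' {X : Type*} [TopologicalSpace X] {f : X → ℍ[ℝ]}
    (hf : Continuous f) : Continuous fun x => (f x).imJ := Quaternion.continuous_imJ.comp hf
@[fun_prop] theorem continuous_imK' {X : Type*} [TopologicalSpace X] {f : X → ℍ[ℝ]}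
    (hf : Continuous f) : Continuous fun x => (f x).imK := Quaternion.continuous_imK.comp hf
@[fun_prop] theorem continuous_im' {X : Type*} [TopologicalSpace X] {f : X → ℍ[ℝ]}
    (hf : Continuous f) : Continuous fun x => (f x).im := Quaternion.continuous_im.comp hf

@[fun_prop] theorem continuous_rhoInv : Continuous rhoInv := by
  have h := normSq_add_one_ne
  have hc : Continuous fun v : ℍ[ℝ] => normSq v := Quaternion.continuous_normSq
  unfold rhoInv
  exact continuous_quat (by fun_prop (disch := exact h)) ((by fun_prop : Continuous _).div
    (by fun_prop) h) ((by fun_prop : Continuous _).div (by fun_prop) h)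
    ((by fun_prop : Continuous _).div (by fun_prop) h)

theorem continuousOn_rho : ContinuousOn rho {q | q.re ≠ 1} := by
  unfold rho
  exact (ContinuousOn.inv₀ (by fun_prop : Continuous fun q : ℍ[ℝ] => 1 - q.re).continuousOn
    fun q hq => sub_ne_zero.2 (Ne.symm hq)).smul (by fun_prop : Continuous _).continuousOn

theorem rho_re (q : ℍ[ℝ]) : (rho q).re = 0 := by simp [rho]

theorem rhoInv_mem {v : ℍ[ℝ]} (hv : v.re = 0) : rhoInv v ∈ S3 := by
  have h := normSq_add_one_ne v
  have h1 := normSq_def' v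
  rw [hv] at h1
  rw [mem_S3_iff_normSq, normSq_def']
  simp only [rhoInv, quat_re, quat_imI, quat_imJ, quat_imK]
  field_simp
  linear_combination (-4) * h1

theorem rhoInv_re_ne (v : ℍ[ℝ]) : (rhoInv v).re ≠ 1 := by
  have h := normSq_add_one_ne v
  simp only [rhoInv, quat_re]
  intro h1
  rw [div_eq_one_iff_eq h] at h1
  linarith

theorem rhoInv_rho {q : ℍ[ℝ]} (hq : q ∈ S3) (h : q.re ≠ 1) : rhoInv (rho q) = q := by
  have h1 : 1 - q.re ≠ 0 := sub_ne_zero.2 h.symm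
  rw [mem_S3_iff_normSq, normSq_def'] at hq
  have h2 : normSq (rho q) = (1 + q.re) / (1 - q.re) := by
    rw [normSq_def']
    simp only [rho, re_smul, imI_smul, imJ_smul, imK_smul, re_im, imI_im, imJ_im, imK_im,
      smul_eq_mul]
    field_simp
    linear_combination hq
  have h3 : normSq (rho q) + 1 = 2 / (1 - q.re) := by rw [h2]; field_simp; ring
  have h4 : normSq (rho q) - 1 = 2 * q.re / (1 - q.re) := by rw [h2]; field_simp; ring
  have h5 : (rho q).imI = q.imI / (1 - q.re) := by simp [rho]; ring
  have h6 : (rho q).imJ = q.imJ / (1 - q.re) := by simp [rho]; ring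
  have h7 : (rho q).imK = q.imK / (1 - q.re) := by simp [rho]; ring
  ext <;> simp only [rhoInv, quat_re, quat_imI, quat_imJ, quat_imK, h3, h4, h5, h6, h7] <;>
    field_simp

/-- The stereographic path from `x` to `y` avoiding `1`. -/
def spath (s : ℝ) (x y : ℍ[ℝ]) : ℍ[ℝ] := rhoInv ((1 - s) • rho x + s • rho y)

theorem spath_mem (s : ℝ) (x y : ℍ[ℝ]) : spath s x y ∈ S3 :=
  rhoInv_mem (by simp [rho_re])

theorem spath_re_ne (s : ℝ) (x y : ℍ[ℝ]) : (spath s x y).re ≠ 1 := rhoInv_re_ne _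

theorem spath_zero {x : ℍ[ℝ]} (y : ℍ[ℝ]) (hx : x ∈ S3) (h : x.re ≠ 1) : spath 0 x y = x := by
  simp [spath, rhoInv_rho hx h]

theorem spath_one (x : ℍ[ℝ]) {y : ℍ[ℝ]} (hy : y ∈ S3) (h : y.re ≠ 1) : spath 1 x y = y := by
  simp [spath, rhoInv_rho hy h]

theorem spath_self (s : ℝ) {x : ℍ[ℝ]} (hx : x ∈ S3) (h : x.re ≠ 1) : spath s x x = x := by
  rw [spath, ← add_smul, sub_add_cancel, one_smul, rhoInv_rho hx h]

theorem continuousOn_spath {X : Type*} [TopologicalSpace X] {s : X → ℝ} {x y : X → ℍ[ℝ]}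
    {A : Set X} (hs : ContinuousOn s A) (hx : ContinuousOn x A) (hy : ContinuousOn y A)
    (hxA : ∀ a ∈ A, (x a).re ≠ 1) (hyA : ∀ a ∈ A, (y a).re ≠ 1) :
    ContinuousOn (fun a => spath (s a) (x a) (y a)) A :=
  continuous_rhoInv.comp_continuousOn
    (((continuousOn_const.sub hs).smul (continuousOn_rho.comp hx hxA)).add
      (hs.smul (continuousOn_rho.comp hy hyA)))

/-- The reflection exchanging `1` and `-1`. -/
def theta (q : ℍ[ℝ]) : ℍ[ℝ] := -star q

@[fun_prop] theorem continuous_theta : Continuous theta := by unfold theta; fun_prop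

@[simp] theorem theta_re (q : ℍ[ℝ]) : (theta q).re = -q.re := by simp [theta]

theorem theta_theta (q : ℍ[ℝ]) : theta (theta q) = q := by simp [theta]

theorem theta_mem {q : ℍ[ℝ]} (h : q ∈ S3) : theta q ∈ S3 := by
  rw [mem_S3, theta, norm_neg, norm_star]; exact h

theorem theta_re_ne {q : ℍ[ℝ]} (h : q.re ≠ -1) : (theta q).re ≠ 1 := by
  rw [theta_re]; contrapose! h; linarith

theorem hrel_of_halves {X : Type*} [TopologicalSpace X] {f g : X → ℍ[ℝ]} (hf : Continuous f)
    (hg : Continuous g) (hfS : ∀ x, f x ∈ S3) (hgS : ∀ x, g x ∈ S3) {a b : X → ℝ}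
    (ha : Continuous a) (hb : Continuous b)
    (hL : ∀ x, a x ≤ b x → (f x).re ≠ 1 ∧ (g x).re ≠ 1)
    (hR : ∀ x, b x ≤ a x → (f x).re ≠ -1 ∧ (g x).re ≠ -1) (h : ∀ x, a x = b x → f x = g x) :
    HRel (S3 : Set ℍ[ℝ]) {x | f x = g x} f g := by
  refine ⟨fun p => if a p.1 ≤ b p.1 then spath p.2 (f p.1) (g p.1)
    else theta (spath p.2 (theta (f p.1)) (theta (g p.1))), ?_, fun x => ?_, fun x => ?_,
    fun p => ?_, fun x hx t => ?_⟩
  · refine continuous_if_le (by fun_prop) (by fun_prop) ?_ ?_ ?_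
    · exact continuousOn_spath (by fun_prop) (by fun_prop) (by fun_prop)
        (fun p hp => (hL _ hp).1) (fun p hp => (hL _ hp).2)
    · exact continuous_theta.comp_continuousOn
        (continuousOn_spath (by fun_prop) (by fun_prop) (by fun_prop)
        (fun p hp => theta_re_ne (hR _ hp).1) (fun p hp => theta_re_ne (hR _ hp).2))
    · intro p hp
      rw [h _ hp, spath_self _ (hgS _) (hL _ hp.le).2,
        spath_self _ (theta_mem (hgS _)) (theta_re_ne (hR _ hp.ge).2), theta_theta]
  · beta_reduce
    split_ifs with hx
    · exact spath_zero _ (hfS x) (hL x hx).1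
    · rw [Set.Icc.coe_zero, spath_zero _ (theta_mem (hfS x)) (theta_re_ne (hR x (not_le.1 hx).le).1), theta_theta]
  · beta_reduce
    split_ifs with hx
    · exact spath_one _ (hgS x) (hL x hx).2
    · rw [Set.Icc.coe_one, spath_one _ (theta_mem (hgS x)) (theta_re_ne (hR x (not_le.1 hx).le).2), theta_theta]
  · beta_reduce
    split_ifs
    · exact spath_mem _ _ _
    · exact theta_mem (spath_mem _ _ _)
  · beta_reduce
    rw [show g x = f x from hx.symm]
    split_ifs with hx
    · exact spath_self _ (hfS x) (hL x hx).1
    · rw [spath_self _ (theta_mem (hfS x)) (theta_re_ne (hR x (not_le.1 hx).le).1), theta_theta]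

/-! ### Suspension -/

/-- The three-sphere minus the poles. -/
def S3Y : Set ℍ[ℝ] := {q | q ∈ S3 ∧ q.re ≠ 1 ∧ q.re ≠ -1}

theorem S3Y_of_im {q : ℍ[ℝ]} (hq : q ∈ S3) (h : q.im ≠ 0) : q ∈ S3Y := by
  have h2 := mem_S3_iff_normSq.1 hq
  rw [normSq_def'] at h2
  refine ⟨hq, fun h1 => h ?_, fun h1 => h ?_⟩ <;>
  · rw [h1] at h2
    ext <;> simp <;> nlinarith [sq_nonneg q.imI, sq_nonneg q.imJ, sq_nonneg q.imK]

theorem im_ne_zero {q : ℍ[ℝ]} (h : q ∈ S3Y) : q.im ≠ 0 := by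
  obtain ⟨hq, h1, h2⟩ := h
  intro h0
  rw [mem_S3_iff_normSq, normSq_def'] at hq
  have hI := congrArg (fun q : ℍ[ℝ] => q.imI) h0
  have hJ := congrArg (fun q : ℍ[ℝ] => q.imJ) h0
  have hK := congrArg (fun q : ℍ[ℝ] => q.imK) h0
  simp only [imI_im, imJ_im, imK_im, imI_zero, imJ_zero, imK_zero] at hI hJ hK
  rw [hI, hJ, hK] at hq
  have : q.re ^ 2 = 1 := by linarith
  rcases sq_eq_one_iff.1 this with h | h
  · exact h1 h
  · exact h2 h

theorem qi_mem_S3Y : qi ∈ S3Y := by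
  refine ⟨?_, ?_, ?_⟩
  · rw [mem_S3_iff_normSq, normSq_def']; simp [qi]
  · simp [qi]
  · simp [qi]

theorem theta_qi : theta qi = qi := by simp [theta, star_qi]

/-- The loop through `w` based at `qi`, avoiding `1` in the first half and `-1` in the second. -/
def sloop (t : I) (w : ℍ[ℝ]) : ℍ[ℝ] :=
  if (t : ℝ) ≤ 1 / 2 then spath (2 * t) qi w else theta (spath (2 - 2 * t) qi (theta w))

theorem sloop_mem (t : I) (w : ℍ[ℝ]) : sloop t w ∈ S3 := by
  unfold sloop; split_ifs
  · exact spath_mem _ _ _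
  · exact theta_mem (spath_mem _ _ _)

theorem sloop_zero (w : ℍ[ℝ]) : sloop 0 w = qi := by
  simp [sloop, spath_zero w qi_mem_S3Y.1 qi_mem_S3Y.2.1]

theorem sloop_one (w : ℍ[ℝ]) : sloop 1 w = qi := by
  have : ¬ ((1 : ℝ) ≤ 1 / 2) := by norm_num
  simp only [sloop, Set.Icc.coe_one, this, if_false]
  norm_num [spath_zero (theta w) qi_mem_S3Y.1 qi_mem_S3Y.2.1, theta_qi]

theorem sloop_qi (t : I) : sloop t qi = qi := by
  simp [sloop, theta_qi, spath_self _ qi_mem_S3Y.1 qi_mem_S3Y.2.1]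

theorem sloop_half {t : I} (ht : (t : ℝ) = 1 / 2) {w : ℍ[ℝ]} (hw : w ∈ S3Y) : sloop t w = w := by
  rw [sloop, if_pos ht.le, ht]
  norm_num [spath_one qi hw.1 hw.2.1]

theorem sloop_re_ne_one {t : I} (ht : (t : ℝ) ≤ 1 / 2) (w : ℍ[ℝ]) : (sloop t w).re ≠ 1 := by
  rw [sloop, if_pos ht]; exact spath_re_ne _ _ _

theorem sloop_re_ne_neg_one {t : I} (ht : 1 / 2 ≤ (t : ℝ)) {w : ℍ[ℝ]} (hw : w ∈ S3Y) :
    (sloop t w).re ≠ -1 := by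
  rcases ht.eq_or_lt with h | h
  · rw [sloop_half h.symm hw]; exact hw.2.2
  · rw [sloop, if_neg (not_le.2 h), theta_re]
    exact fun h => spath_re_ne _ _ _ (neg_injective h)

theorem continuous_sloop {X : Type*} [TopologicalSpace X] {t : X → I} {w : X → ℍ[ℝ]}
    (ht : Continuous t) (hw : Continuous w) (hY : ∀ x, w x ∈ S3Y) :
    Continuous fun x => sloop (t x) (w x) := by
  unfold sloop
  refine continuous_if_le (by fun_prop) (by fun_prop) ?_ ?_ ?_
  · exact continuousOn_spath (by fun_prop) (by fun_prop) (by fun_prop)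
      (fun _ _ => qi_mem_S3Y.2.1) (fun p hp => (hY _).2.1)
  · exact continuous_theta.comp_continuousOn
      (continuousOn_spath (by fun_prop) (by fun_prop) (by fun_prop)
      (fun _ _ => qi_mem_S3Y.2.1) (fun p hp => theta_re_ne (hY _).2.2))
  · intro x hx
    rw [hx]
    norm_num [spath_one qi (hY x).1 (hY x).2.1,
      spath_one qi (theta_mem (hY x).1) (theta_re_ne (hY x).2.2), theta_theta]

/-- The suspension of a map of the square. -/
def susp (w : (Fin 2 → I) → ℍ[ℝ]) (k : Fin 3 → I) : ℍ[ℝ] := sloop (k 0) (w (Fin.tail k))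

theorem bd_succ_cases {n : ℕ} {k : Fin (n + 1) → I} (hk : k ∈ bd (n + 1)) :
    k 0 = 0 ∨ k 0 = 1 ∨ Fin.tail k ∈ bd n := by
  obtain ⟨j, hj⟩ := hk
  cases j using Fin.cases with
  | zero => tauto
  | succ j => exact Or.inr (Or.inr ⟨j, hj⟩)

theorem susp_bd {w : (Fin 2 → I) → ℍ[ℝ]} (h : ∀ k ∈ bd 2, w k = qi) :
    ∀ k ∈ bd 3, susp w k = qi := by
  intro k hk
  rcases bd_succ_cases hk with h0 | h0 | h0
  · rw [susp, h0, sloop_zero]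
  · rw [susp, h0, sloop_one]
  · rw [susp, h _ h0, sloop_qi]

theorem continuous_tail {n : ℕ} : Continuous fun k : Fin (n + 1) → I => Fin.tail k := by
  unfold Fin.tail; fun_prop

theorem HRel.susp {w w' : (Fin 2 → I) → ℍ[ℝ]} (H : HRel S3Y (bd 2) w w') :
    HRel (S3 : Set ℍ[ℝ]) (bd 3) (susp w) (susp w') := by
  obtain ⟨F, hF, hF0, hF1, hFY, hFC⟩ := H
  have := continuous_tail (n := 2)
  refine ⟨fun p => sloop (p.1 0) (F (Fin.tail p.1, p.2)),
    continuous_sloop (by fun_prop) (by fun_prop) fun _ => hFY _, fun k => by simp [hF0, PiThree.susp],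
    fun k => by simp [hF1, PiThree.susp], fun _ => sloop_mem _ _, fun k hk t => ?_⟩
  rw [PiThree.susp]
  beta_reduce
  change sloop (k 0) (F (Fin.tail k, t)) = _
  rcases bd_succ_cases hk with h0 | h0 | h0
  · rw [h0, sloop_zero, sloop_zero]
  · rw [h0, sloop_one, sloop_one]
  · rw [hFC _ h0]

theorem susp_cc (w w' : (Fin 2 → I) → ℍ[ℝ]) : susp (cc 1 w w') = cc 2 (susp w) (susp w') := by
  funext k
  have h : ∀ t, Fin.tail (Function.update k 2 t) = Function.update (Fin.tail k) 1 t := fun t =>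
    Fin.tail_update_succ k 1 t
  have h0 : ∀ t, Function.update k 2 t 0 = k 0 := fun t => Function.update_of_ne (by decide) _ _
  simp only [susp, cc, h, h0]
  rw [show Fin.tail k 1 = k 2 from rfl]
  split_ifs <;> rfl

end

section

open Quaternion

/-! ### General position with respect to the poles -/

theorem eq_one_of_re {q : ℍ[ℝ]} (hq : q ∈ S3) (h : q.re = 1) : q = 1 := by
  rw [mem_S3_iff_normSq, normSq_def', h] at hq
  ext <;> simp [h] <;> nlinarith [sq_nonneg q.imI, sq_nonneg q.imJ, sq_nonneg q.imK]

theorem eq_neg_one_of_re {q : ℍ[ℝ]} (hq : q ∈ S3) (h : q.re = -1) : q = -1 := by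
  rw [← neg_eq_iff_eq_neg]
  exact eq_one_of_re (by rw [mem_S3, norm_neg]; exact hq) (by simp [h])

theorem normalize_mem {q : ℍ[ℝ]} (h : q ≠ 0) : ‖q‖⁻¹ • q ∈ S3 := by
  rw [mem_S3, norm_smul, norm_inv, norm_norm, inv_mul_cancel₀ (norm_ne_zero_iff.2 h)]

theorem normalize_of_mem {q : ℍ[ℝ]} (h : q ∈ S3) : ‖q‖⁻¹ • q = q := by
  rw [mem_S3.1 h, inv_one, one_smul]

theorem exists_split {X E : Type*} [TopologicalSpace X] [CompactSpace X] [T2Space X]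
    [NormedAddCommGroup E] [NormedSpace ℝ E] [FiniteDimensional ℝ E] {j : X → E}
    (hj : Continuous j) (hji : Function.Injective j) (hd : Module.finrank ℝ E < 4)
    {F : X × I → ℍ[ℝ]} (hF : Continuous F) (hS : ∀ p, F p ∈ S3) (h0 : ∀ x, F (x, 0) = qi)
    (h1 : ∀ x, F (x, 1) = qi) {ε : ℝ} (hε : 0 < ε) :
    ∃ (f : X × I → ℍ[ℝ]) (τ : X → I), Continuous f ∧ (∀ p, f p ∈ S3) ∧ (∀ p, ‖f p - F p‖ < ε) ∧
      (∀ p, F p = qi → f p = qi) ∧ HRel (S3 : Set ℍ[ℝ]) {p | F p = qi} F f ∧ Continuous τ ∧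
      (∀ x t, t ≤ τ x → (f (x, t)).re ≠ 1) ∧ ∀ x t, τ x ≤ t → (f (x, t)).re ≠ -1 := by
  obtain ⟨g, hg, hgF, hgi, hgA⟩ := exists_avoid_rays hj hji (by rw [finrank_quat]; omega) hF
    (fun p => (mem_S3.1 (hS p)).ge) (e := (1 : ℍ[ℝ])) (b := qi) one_ne_zero (fun μ => by
      have : normSq (μ • (1 : ℍ[ℝ]) - qi) = μ ^ 2 + 1 := by rw [normSq_def']; simp [qi]
      rw [normSq_eq_norm_mul_self] at this
      nlinarith [norm_nonneg (μ • (1 : ℍ[ℝ]) - qi), sq_nonneg μ])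
    (ε := min (ε / 2) (1 / 2)) (by positivity)
  have hg0 : ∀ p, g p ≠ 0 := fun p h =>
    hgA p.1 p.2 p.2 0 0 le_rfl le_rfl (by rw [zero_smul]; exact h) (by rw [zero_smul, neg_zero]; exact h)
  have hgn : ∀ p, ‖g p‖ ≠ 0 := fun p => norm_ne_zero_iff.2 (hg0 p)
  let f : X × I → ℍ[ℝ] := fun p => ‖g p‖⁻¹ • g p
  have hfc : Continuous f := (hg.norm.inv₀ hgn).smul hg
  have hfS : ∀ p, f p ∈ S3 := fun p => normalize_mem (hg0 p)
  have hfg : ∀ p, g p = ‖g p‖ • f p := fun p => by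
    simp only [f, smul_smul, mul_inv_cancel₀ (hgn p), one_smul]
  have hfi : ∀ p, F p = qi → f p = qi := fun p hp => by
    simp only [f, hgi p hp, normalize_of_mem qi_mem_S3Y.1]
  have hA : IsClosed (Prod.fst '' {p | f p = 1}) :=
    isClosedMap_fst_of_compactSpace _ (isClosed_eq hfc continuous_const)
  have hB : IsClosed (Prod.fst '' {p | f p = -1}) :=
    isClosedMap_fst_of_compactSpace _ (isClosed_eq hfc continuous_const)
  have hAB : Disjoint (Prod.fst '' {p | f p = 1}) (Prod.fst '' {p | f p = -1}) := by
    rw [Set.disjoint_left]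
    rintro _ ⟨⟨x, s⟩, hs, rfl⟩ ⟨⟨x', t⟩, ht, hx⟩
    obtain rfl : x' = x := hx
    refine hgA x' s t _ _ (norm_nonneg (g (x', s))) (norm_nonneg (g (x', t))) ?_ ?_
    · conv_lhs => rw [hfg, show f (x', s) = 1 from hs]
    · conv_lhs => rw [hfg, show f (x', t) = -1 from ht]
      rw [smul_neg]
  obtain ⟨u, hu0, hu1, huI⟩ := exists_continuous_zero_one_of_isClosed hA hB hAB
  have hq1 : qi ≠ 1 := fun h => by
    have := congrArg (fun q : ℍ[ℝ] => q.re) h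
    simp [qi] at this
  have hq2 : qi ≠ -1 := fun h => by
    have := congrArg (fun q : ℍ[ℝ] => q.re) h
    simp [qi] at this
  refine ⟨f, fun x => ⟨u x, huI x⟩, hfc, hfS, fun p => ?_, hfi, ?_, by fun_prop, fun x t ht h => ?_,
    fun x t ht h => ?_⟩
  · have e1 : ‖f p - g p‖ = |1 - ‖g p‖| := by
      conv_lhs => rw [hfg p]
      rw [show f p - ‖g p‖ • f p = (1 - ‖g p‖) • f p by module, norm_smul, mem_S3.1 (hfS p), mul_one,
        Real.norm_eq_abs]
    have e2 : |1 - ‖g p‖| ≤ ‖g p - F p‖ := by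
      have := abs_norm_sub_norm_le (F p) (g p)
      rwa [mem_S3.1 (hS p), norm_sub_rev] at this
    have e3 := (hgF p).trans_le (min_le_left _ _)
    have e4 := norm_add_le (f p - g p) (g p - F p)
    rw [sub_add_sub_cancel] at e4
    linarith
  · have H := hrel_of_norm_sub_lt hF hg (fun p => by
      rw [mem_S3.1 (hS p)]
      exact ((hgF p).trans_le (min_le_right _ _)).trans (by norm_num))
    have H2 := H.comp_left (Q := (S3 : Set ℍ[ℝ])) (fun v => ‖v‖⁻¹ • v)
      ((continuousOn_id.norm.inv₀ fun v hv => norm_ne_zero_iff.2 hv).smul continuousOn_id)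
      (fun v hv => normalize_mem hv)
    simp only [fun p => normalize_of_mem (hS p)] at H2
    exact H2.mono subset_rfl fun p hp => by
      rw [Set.mem_ofPred_eq] at hp ⊢
      rw [hp, hgi p hp]
  · have hf1 := eq_one_of_re (hfS _) h
    have hux : u x = 0 := hu0 ⟨(x, t), hf1, rfl⟩
    have : t = 0 := le_antisymm (ht.trans (Subtype.coe_le_coe.1 hux.le)) t.2.1
    rw [this, hfi _ (h0 x)] at hf1
    exact hq1 hf1
  · have hf1 := eq_neg_one_of_re (hfS _) h
    have hux : u x = 1 := hu1 ⟨(x, t), hf1, rfl⟩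
    have : t = 1 := le_antisymm t.2.2 (le_trans (Subtype.coe_le_coe.1 hux.ge) ht)
    rw [this, hfi _ (h1 x)] at hf1
    exact hq2 hf1

/-! ### Retraction of the complement of the real line to the two-sphere -/

/-- The normalised imaginary part. -/
def imn (q : ℍ[ℝ]) : ℍ[ℝ] := ‖q.im‖⁻¹ • q.im

theorem continuousOn_imn : ContinuousOn imn {q | q.im ≠ 0} := by
  unfold imn
  exact ((Continuous.continuousOn (by fun_prop)).inv₀ fun q hq => norm_ne_zero_iff.2 hq).smul
    (Continuous.continuousOn (by fun_prop))

theorem imn_mem {q : ℍ[ℝ]} (h : q.im ≠ 0) : imn q ∈ S2 :=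
  mul_self_eq_neg_one (by simp [imn]) (normalize_mem h)

theorem S2.re {q : ℍ[ℝ]} (h : q ∈ S2) : q.re = 0 := by
  have h1 := S3.star_mul (S2.mem_S3 h)
  have h2 : q * q = -1 := h
  have h3 : (star q + q) * q = 0 := by rw [add_mul, h1, h2, add_neg_cancel]
  have hq : q ≠ 0 := fun h0 => by
    have := S2.mem_S3 h
    rw [h0, PiThree.mem_S3, norm_zero] at this
    exact zero_ne_one this
  have h4 := (mul_eq_zero.1 h3).resolve_right hq
  have := congrArg (fun q : ℍ[ℝ] => q.re) h4
  simp at this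
  linarith

theorem S2.im {q : ℍ[ℝ]} (h : q ∈ S2) : q.im = q := by
  ext <;> simp [S2.re h]

theorem imn_of_mem {q : ℍ[ℝ]} (h : q ∈ S2) : imn q = q := by
  rw [imn, S2.im h, normalize_of_mem (S2.mem_S3 h)]

theorem qi_mem_S2 : qi ∈ S2 := qi_mul_qi

theorem S2_subset : S2 ⊆ S3Y := fun q hq => by
  refine ⟨S2.mem_S3 hq, ?_, ?_⟩ <;> rw [S2.re hq] <;> norm_num

theorem hrel_imn {X : Type*} [TopologicalSpace X] [CompactSpace X] {C : Set X} {w : X → ℍ[ℝ]} (hw : Continuous w)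
    (hY : ∀ x, w x ∈ S3Y) (hC : ∀ x ∈ C, w x = qi) : HRel S3Y C w (fun x => imn (w x)) := by
  have hi : Continuous fun x => (w x).im := by fun_prop
  have H := hrel_segment (P := {q : ℍ[ℝ] | q.im ≠ 0}) hw hi fun x t => by
    have : ((1 - (t : ℝ)) • w x + (t : ℝ) • (w x).im).im = (w x).im := by
      ext <;> simp <;> ring
    rw [Set.mem_ofPred_eq, this]
    exact im_ne_zero (hY x)
  have H2 := H.comp_left (Q := S3Y) (fun v => ‖v‖⁻¹ • v)
    ((continuousOn_id.norm.inv₀ fun (v : ℍ[ℝ]) (hv : v.im ≠ 0) =>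
      norm_ne_zero_iff.2 fun h : v = 0 => hv (by rw [h]; simp)).smul continuousOn_id)
    (fun v hv => by
      have hv0 : v ≠ 0 := fun h => hv (by rw [h]; simp)
      refine S3Y_of_im (normalize_mem hv0) ?_
      rw [im_smul]
      exact smul_ne_zero (inv_ne_zero (norm_ne_zero_iff.2 hv0)) hv)
  simp only [fun x => normalize_of_mem (hY x).1] at H2
  exact H2.mono subset_rfl fun x hx => by
    rw [Set.mem_ofPred_eq, hC x hx, S2.im qi_mem_S2]

end

section

/-! ### The Freudenthal suspension -/

open Quaternion

theorem continuous_fin_cons {n : ℕ} : Continuous fun p : (Fin n → I) × I =>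
    (Fin.cons p.2 p.1 : Fin (n + 1) → I) := by
  refine continuous_pi fun i => ?_
  cases i using Fin.cases with
  | zero => exact continuous_snd
  | succ i => simp only [Fin.cons_succ]; fun_prop

theorem cons_mem_bd_of {n : ℕ} {u : Fin n → I} {t : I} (h : t = 0 ∨ t = 1 ∨ u ∈ bd n) :
    (Fin.cons t u : Fin (n + 1) → I) ∈ bd (n + 1) := by
  rcases h with h | h | ⟨j, hj⟩
  · exact ⟨0, Or.inl h⟩
  · exact ⟨0, Or.inr h⟩
  · exact ⟨j.succ, by simpa using hj⟩

/-- A reparametrisation of the interval sending `1 / 2` to `c`. -/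
def bend (c t : ℝ) : ℝ := min (2 * t) 1 * c + max (2 * t - 1) 0 * (1 - c)

theorem bend_of_le {c t : ℝ} (h : t ≤ 1 / 2) : bend c t = 2 * t * c := by
  rw [bend, min_eq_left (by linarith), max_eq_right (by linarith)]; ring

theorem bend_of_ge {c t : ℝ} (h : 1 / 2 ≤ t) : bend c t = c + (2 * t - 1) * (1 - c) := by
  rw [bend, min_eq_right (by linarith), max_eq_left (by linarith)]; ring

theorem exists_susp {g : (Fin 3 → I) → ℍ[ℝ]} (hg : Continuous g) (hgS : ∀ k, g k ∈ S3)
    (hgb : ∀ k ∈ bd 3, g k = qi) :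
    ∃ w n, WRel w n ∧ HRel (S3 : Set ℍ[ℝ]) (bd 3) g (susp w) := by
  have htail := continuous_tail (n := 2)
  obtain ⟨f, τ, hf, hfS, -, hfi, H, hτ, hA, hB⟩ := exists_split (continuous_cubeIncl 2)
    (cubeIncl_injective 2) (by simp) (F := fun p => g (Fin.cons p.2 p.1))
    (hg.comp continuous_fin_cons) (fun _ => hgS _)
    (fun u => hgb _ (cons_mem_bd_of (Or.inl rfl)))
    (fun u => hgb _ (cons_mem_bd_of (Or.inr (Or.inl rfl)))) one_pos
  have hfb : ∀ u t, (t = 0 ∨ t = 1 ∨ u ∈ bd 2) → f (u, t) = qi := fun u t h =>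
    hfi _ (hgb _ (cons_mem_bd_of h))
  have H1 : HRel (S3 : Set ℍ[ℝ]) (bd 3) g (fun k => f (Fin.tail k, k 0)) := by
    have := H.comp_right (D := bd 3) (fun k : Fin 3 → I => (Fin.tail k, k 0)) (by fun_prop)
      (fun k hk => by
        rw [Set.mem_ofPred_eq]
        exact hgb _ (by rwa [Fin.cons_self_tail]))
    simpa only [Fin.cons_self_tail] using this
  let f₂ : (Fin 3 → I) → ℍ[ℝ] := fun k =>
    f (Fin.tail k, Set.projIcc 0 1 zero_le_one (bend (τ (Fin.tail k)) (k 0)))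
  have hf₂ : Continuous f₂ := by
    simp only [f₂, bend]
    fun_prop
  have hb0 : ∀ c, bend c 0 = 0 := fun c => by simp [bend]
  have hb1 : ∀ c, bend c 1 = 1 := fun c => by norm_num [bend]
  have hP0 : Set.projIcc (0 : ℝ) 1 zero_le_one 0 = 0 := Set.projIcc_left _
  have hP1 : Set.projIcc (0 : ℝ) 1 zero_le_one 1 = 1 := Set.projIcc_right _
  have hf₂b : ∀ k ∈ bd 3, f₂ k = qi := fun k hk => by
    rcases bd_succ_cases hk with h0 | h0 | h0
    · exact hfb _ _ (Or.inl (by rw [h0, Set.Icc.coe_zero, hb0, hP0]))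
    · exact hfb _ _ (Or.inr (Or.inl (by rw [h0, Set.Icc.coe_one, hb1, hP1])))
    · exact hfb _ _ (Or.inr (Or.inr h0))
  have H2 : HRel (S3 : Set ℍ[ℝ]) (bd 3) (fun k => f (Fin.tail k, k 0)) f₂ := by
    refine ⟨fun p => f (Fin.tail p.1, Set.projIcc 0 1 zero_le_one
      ((1 - p.2) * p.1 0 + p.2 * bend (τ (Fin.tail p.1)) (p.1 0))), ?_, fun k => by simp,
      fun k => by simp [f₂], fun _ => hfS _, fun k hk t => ?_⟩
    · simp only [bend]; fun_prop
    · rcases bd_succ_cases hk with h0 | h0 | h0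
      · refine Eq.trans ?_ (hfb _ (k 0) (Or.inl h0)).symm
        exact hfb _ _ (Or.inl (by
          change Set.projIcc 0 1 zero_le_one ((1 - (t : ℝ)) * k 0 + t * bend (τ (Fin.tail k)) (k 0)) = 0
          rw [h0, Set.Icc.coe_zero, hb0, mul_zero, mul_zero, add_zero, hP0]))
      · refine Eq.trans ?_ (hfb _ (k 0) (Or.inr (Or.inl h0))).symm
        exact hfb _ _ (Or.inr (Or.inl (by
          change Set.projIcc 0 1 zero_le_one ((1 - (t : ℝ)) * k 0 + t * bend (τ (Fin.tail k)) (k 0)) = 1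
          rw [h0, Set.Icc.coe_one, hb1, mul_one, mul_one, sub_add_cancel, hP1])))
      · exact (hfb _ _ (Or.inr (Or.inr h0))).trans (hfb _ (k 0) (Or.inr (Or.inr h0))).symm
  let w₀ : (Fin 2 → I) → ℍ[ℝ] := fun u => f (u, τ u)
  have hw₀ : Continuous w₀ := by fun_prop
  have hw₀Y : ∀ u, w₀ u ∈ S3Y := fun u => ⟨hfS _, hA _ _ le_rfl, hB _ _ le_rfl⟩
  have hw₀b : ∀ u ∈ bd 2, w₀ u = qi := fun u hu => hfb _ _ (Or.inr (Or.inr hu))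
  have H3 : HRel (S3 : Set ℍ[ℝ]) (bd 3) f₂ (susp w₀) := by
    refine (hrel_of_halves (a := fun k => (k 0 : ℝ)) (b := fun _ => 1 / 2) hf₂
      (continuous_sloop (by fun_prop) (by fun_prop) fun _ => hw₀Y _) (fun _ => hfS _)
      (fun _ => sloop_mem _ _) (by fun_prop) (by fun_prop) (fun k hk => ⟨?_, ?_⟩)
      (fun k hk => ⟨?_, ?_⟩) fun k hk => ?_).mono subset_rfl fun k hk => ?_
    · refine hA _ _ ?_
      rw [bend_of_le hk]
      have h1 := (τ (Fin.tail k)).2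
      have h2 := (k 0).2
      beta_reduce at hk
      rw [← Subtype.coe_le_coe, Set.coe_projIcc]
      exact max_le h1.1 ((min_le_right _ _).trans (by nlinarith [h1.1]))
    · exact sloop_re_ne_one hk _
    · refine hB _ _ ?_
      rw [bend_of_ge hk]
      have h1 := (τ (Fin.tail k)).2
      have h2 := (k 0).2
      beta_reduce at hk
      rw [← Subtype.coe_le_coe, Set.coe_projIcc]
      exact le_max_of_le_right (le_min h1.2 (by nlinarith [h1.2]))
    · exact sloop_re_ne_neg_one hk (hw₀Y _)
    · beta_reduce at hk
      rw [sloop_half hk (hw₀Y _)]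
      simp only [f₂, w₀]
      rw [bend_of_le hk.le, hk]
      norm_num
    · exact (hf₂b k hk).trans (susp_bd hw₀b k hk).symm
  have H4 := (hrel_imn hw₀ hw₀Y hw₀b)
  obtain ⟨n, hn⟩ := WRel.total H4.continuous_right
    (fun k => imn_mem (im_ne_zero (hw₀Y k))) (fun k hk => by
      rw [H4.eqOn k hk, hw₀b k hk])
  exact ⟨_, n, hn, H1.trans (H2.trans (H3.trans H4.susp))⟩

theorem susp_injective {w : (Fin 2 → I) → ℍ[ℝ]} (hw : Continuous w) (hwS : ∀ k, w k ∈ S2)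
    (hwb : ∀ k ∈ bd 2, w k = qi)
    (H : HRel (S3 : Set ℍ[ℝ]) (bd 3) (susp w) (fun _ => qi)) :
    HRel S2 (bd 2) w (fun _ => qi) := by
  have hwY : ∀ k, w k ∈ S3Y := fun k => S2_subset (hwS k)
  obtain ⟨F, hF, hF0, hF1, hFS, hFC⟩ := H
  have hFb : ∀ u t s, (t = 0 ∨ t = 1 ∨ u ∈ bd 2) → F (Fin.cons t u, s) = qi := fun u t s h => by
    rw [hFC _ (cons_mem_bd_of h), susp_bd hwb _ (cons_mem_bd_of h)]
  have hF0' : ∀ u t, F (Fin.cons t u, 0) = sloop t (w u) := fun u t => by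
    rw [hF0]; simp [susp]
  have hsl : Continuous fun p : (Fin 2 → I) × I => sloop p.2 (w p.1) :=
    continuous_sloop (by fun_prop) (by fun_prop) fun _ => hwY _
  obtain ⟨ε₁, hε₁, hε₁'⟩ : ∃ ε > 0, ∀ (u : Fin 2 → I) (t : I), (t : ℝ) ≤ 1 / 2 → (sloop t (w u)).re ≤ 1 - ε := by
    have hK : IsCompact {p : (Fin 2 → I) × I | (p.2 : ℝ) ≤ 1 / 2} :=
      (isClosed_le (by fun_prop) (by fun_prop)).isCompact
    obtain ⟨p, hp, hmax⟩ := hK.exists_isMaxOn ⟨(0, 0), by norm_num⟩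
      (continuous_re' hsl).continuousOn
    have h1 : (sloop p.2 (w p.1)).re ≤ 1 := by
      have := mem_S3_iff_normSq.1 (sloop_mem p.2 (w p.1))
      rw [normSq_def'] at this
      nlinarith [sq_nonneg (sloop p.2 (w p.1)).imI, sq_nonneg (sloop p.2 (w p.1)).imJ,
        sq_nonneg (sloop p.2 (w p.1)).imK]
    refine ⟨1 - (sloop p.2 (w p.1)).re, sub_pos.2 (h1.lt_of_ne (sloop_re_ne_one hp _)),
      fun u t ht => ?_⟩
    have := hmax (show (u, t) ∈ {p : (Fin 2 → I) × I | (p.2 : ℝ) ≤ 1 / 2} from ht)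
    simp only [Set.mem_ofPred_eq] at this
    linarith
  obtain ⟨ε₂, hε₂, hε₂'⟩ : ∃ ε > 0, ∀ (u : Fin 2 → I) (t : I), 1 / 2 ≤ (t : ℝ) → -1 + ε ≤ (sloop t (w u)).re := by
    have hK : IsCompact {p : (Fin 2 → I) × I | 1 / 2 ≤ (p.2 : ℝ)} :=
      (isClosed_le (by fun_prop) (by fun_prop)).isCompact
    obtain ⟨p, hp, hmin⟩ := hK.exists_isMinOn ⟨(0, 1), by norm_num⟩
      (continuous_re' hsl).continuousOn
    have h1 : -1 ≤ (sloop p.2 (w p.1)).re := by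
      have := mem_S3_iff_normSq.1 (sloop_mem p.2 (w p.1))
      rw [normSq_def'] at this
      nlinarith [sq_nonneg (sloop p.2 (w p.1)).imI, sq_nonneg (sloop p.2 (w p.1)).imJ,
        sq_nonneg (sloop p.2 (w p.1)).imK]
    refine ⟨(sloop p.2 (w p.1)).re + 1, by
      have := h1.lt_of_ne (Ne.symm (sloop_re_ne_neg_one hp (hwY p.1)))
      linarith, fun u t ht => ?_⟩
    have := hmin (show (u, t) ∈ {p : (Fin 2 → I) × I | 1 / 2 ≤ (p.2 : ℝ)} from ht)
    simp only [Set.mem_ofPred_eq] at this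
    linarith
  obtain ⟨f, τ, hf, hfS, hfF, hfi, -, hτ, hA, hB⟩ := exists_split
    (X := (Fin 2 → I) × I) (E := (Fin 2 → ℝ) × ℝ)
    (j := fun p => (cubeIncl 2 p.1, (p.2 : ℝ)))
    (by have := continuous_cubeIncl 2; fun_prop)
    (fun p q h => by
      rw [Prod.mk.injEq] at h
      exact Prod.ext (cubeIncl_injective 2 h.1) (Subtype.ext h.2))
    (by simp) (F := fun p => F (Fin.cons p.2 p.1.1, p.1.2))
    (hF.comp ((continuous_fin_cons.comp (by fun_prop : Continuous fun p : ((Fin 2 → I) × I) × I =>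
      (p.1.1, p.2))).prodMk (by fun_prop))) (fun _ => hFS _)
    (fun u => hFb _ _ _ (Or.inl rfl)) (fun u => hFb _ _ _ (Or.inr (Or.inl rfl)))
    (ε := min (min ε₁ ε₂) 1) (by positivity)
  have hre : ∀ q : ℍ[ℝ], |q.re| ≤ ‖q‖ := fun q => by
    refine abs_le_of_sq_le_sq ?_ (norm_nonneg q)
    rw [sq ‖q‖, ← normSq_eq_norm_mul_self, normSq_def']
    nlinarith [sq_nonneg q.imI, sq_nonneg q.imJ, sq_nonneg q.imK]
  have hlow : ∀ (u : Fin 2 → I) (t : I), (t : ℝ) ≤ 1 / 2 → (f ((u, 0), t)).re ≠ 1 := fun u t ht h => by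
    have h1 := (hre _).trans_lt ((hfF ((u, 0), t)).trans_le ((min_le_left _ _).trans (min_le_left _ _)))
    have h2 := hε₁' u t ht
    rw [hF0', re_sub, h] at h1
    linarith [(abs_lt.1 h1).2]
  have hhigh : ∀ (u : Fin 2 → I) (t : I), 1 / 2 ≤ (t : ℝ) → (f ((u, 0), t)).re ≠ -1 := fun u t ht h => by
    have h1 := (hre _).trans_lt ((hfF ((u, 0), t)).trans_le ((min_le_left _ _).trans (min_le_right _ _)))
    have h2 := hε₂' u t ht
    rw [hF0', re_sub, h] at h1
    linarith [(abs_lt.1 h1).1]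
  let mid : I := ⟨1 / 2, by norm_num, by norm_num⟩
  have hfb : ∀ u t s, (t = 0 ∨ t = 1 ∨ u ∈ bd 2) → f ((u, s), t) = qi := fun u t s h =>
    hfi _ (hFb _ _ _ h)
  have H1 : HRel {q : ℍ[ℝ] | q.im ≠ 0} (bd 2) w (fun u => f ((u, 0), mid)) := by
    refine (hrel_segment (P := {q : ℍ[ℝ] | q.im ≠ 0}) (g := fun u => f ((u, 0), mid)) hw
      (by fun_prop) fun u t h0 => ?_).mono subset_rfl fun u hu => by
        rw [Set.mem_ofPred_eq, hwb u hu, hfb _ _ _ (Or.inr (Or.inr hu))]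
    have h1 := (hfF ((u, 0), mid)).trans_le (min_le_right _ _)
    rw [hF0', sloop_half rfl (hwY u)] at h1
    have h2 : w u = -((t : ℝ) • (f ((u, 0), mid) - w u).im) := by
      rw [im_add, im_smul, im_smul, S2.im (hwS u)] at h0
      rw [im_sub, S2.im (hwS u), eq_neg_iff_add_eq_zero, ← h0]
      module
    have him : ∀ q : ℍ[ℝ], ‖q.im‖ ≤ ‖q‖ := fun q => by
      refine abs_le_of_sq_le_sq' ?_ (norm_nonneg q) |>.2
      rw [sq, sq, ← normSq_eq_norm_mul_self, ← normSq_eq_norm_mul_self, normSq_def', normSq_def']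
      simp
      nlinarith [sq_nonneg q.re]
    have h3 : (1 : ℝ) ≤ ‖f ((u, 0), mid) - w u‖ := by
      calc (1 : ℝ) = ‖w u‖ := (hwY u).1.symm
        _ = t * ‖(f ((u, 0), mid) - w u).im‖ := by
          conv_lhs => rw [h2, norm_neg, norm_smul, Real.norm_of_nonneg t.2.1]
        _ ≤ ‖(f ((u, 0), mid) - w u).im‖ := mul_le_of_le_one_left (norm_nonneg _) t.2.2
        _ ≤ _ := him _
    linarith
  have H2 : HRel {q : ℍ[ℝ] | q.im ≠ 0} (bd 2) (fun u => f ((u, 0), mid))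
      (fun u => f ((u, 0), τ (u, 0))) := by
    refine ⟨fun p => f ((p.1, 0), Set.projIcc 0 1 zero_le_one
      ((1 - p.2) * (1 / 2) + p.2 * τ (p.1, 0))), by fun_prop, fun u => ?_, fun u => ?_,
      fun p => im_ne_zero ⟨hfS _, ?_, ?_⟩, fun u hu t => ?_⟩
    · have : Set.projIcc (0 : ℝ) 1 zero_le_one (1 / 2) = mid := Set.projIcc_of_mem _ mid.2
      simp [← this]
    · simp
    · obtain ⟨u, s⟩ := p
      have h1 := (τ (u, 0)).2
      have h2 := s.2
      by_cases h : (1 - (s : ℝ)) * (1 / 2) + s * τ (u, 0) ≤ 1 / 2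
      · refine hlow _ _ ?_
        rw [Set.coe_projIcc]
        exact max_le (by norm_num) ((min_le_right _ _).trans h)
      · refine hA _ _ ?_
        rw [← Subtype.coe_le_coe, Set.coe_projIcc]
        refine max_le h1.1 ((min_le_right _ _).trans ?_)
        change (1 - (s : ℝ)) * (1 / 2) + s * τ (u, 0) ≤ τ (u, 0)
        push Not at h
        have : (1 : ℝ) / 2 ≤ τ (u, 0) := by
          by_contra h'
          push Not at h'
          nlinarith [h2.1, h2.2]
        nlinarith [h2.1, h2.2]
    · obtain ⟨u, s⟩ := p
      have h1 := (τ (u, 0)).2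
      have h2 := s.2
      by_cases h : 1 / 2 ≤ (1 - (s : ℝ)) * (1 / 2) + s * τ (u, 0)
      · refine hhigh _ _ ?_
        rw [Set.coe_projIcc]
        exact le_max_of_le_right (le_min (by norm_num) h)
      · refine hB _ _ ?_
        rw [← Subtype.coe_le_coe, Set.coe_projIcc]
        refine le_max_of_le_right (le_min h1.2 ?_)
        change (τ (u, 0) : ℝ) ≤ (1 - (s : ℝ)) * (1 / 2) + s * τ (u, 0)
        push Not at h
        have : (τ (u, 0) : ℝ) ≤ 1 / 2 := by
          by_contra h'
          push Not at h'
          nlinarith [h2.1, h2.2]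
        nlinarith [h2.1, h2.2]
    · exact (hfb _ _ _ (Or.inr (Or.inr hu))).trans (hfb _ _ _ (Or.inr (Or.inr hu))).symm
  have H3 : HRel {q : ℍ[ℝ] | q.im ≠ 0} (bd 2) (fun u => f ((u, 0), τ (u, 0))) (fun _ => qi) := by
    refine ⟨fun p => f (p, τ p), by fun_prop, fun u => rfl, fun u => ?_,
      fun p => im_ne_zero ⟨hfS _, hA _ _ le_rfl, hB _ _ le_rfl⟩, fun u hu t => ?_⟩
    · exact hfi _ (hF1 _)
    · exact (hfb _ _ _ (Or.inr (Or.inr hu))).trans (hfb _ _ _ (Or.inr (Or.inr hu))).symm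
  have := (H1.trans (H2.trans H3)).comp_left (Q := S2) imn continuousOn_imn fun q hq => imn_mem hq
  simpa only [imn_of_mem qi_mem_S2, imn_of_mem (hwS _)] using this

end

section

open Quaternion

/-! ### The degree of a loop of unit quaternions -/

/-- `Deg f n`: the map `f` from the three-cube to the unit quaternions has degree `n`. -/
def Deg (f : (Fin 3 → I) → ℍ[ℝ]) (n : ℤ) : Prop :=
  ∃ w, WRel w n ∧ HRel (S3 : Set ℍ[ℝ]) (bd 3) (fun k => qi * f k) (susp w)

theorem qi_mem_S3 : qi ∈ S3 := S2.mem_S3 qi_mem_S2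

theorem neg_qi_mul_qi_mul (q : ℍ[ℝ]) : -qi * (qi * q) = q := by
  rw [← mul_assoc, neg_mul, qi_mul_qi, neg_neg, one_mul]

theorem qi_mul_neg_qi_mul (q : ℍ[ℝ]) : qi * (-qi * q) = q := by
  rw [← mul_assoc, mul_neg, qi_mul_qi, neg_neg, one_mul]

theorem neg_qi_mem_S3 : -qi ∈ S3 := by
  rw [← star_qi]; exact S3.star_mem qi_mem_S3

theorem HRel.S3_mul_left {X : Type*} [TopologicalSpace X] {C : Set X} {f g : X → ℍ[ℝ]}
    (H : HRel (S3 : Set ℍ[ℝ]) C f g) {q : ℍ[ℝ]} (hq : q ∈ S3) :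
    HRel (S3 : Set ℍ[ℝ]) C (fun x => q * f x) (fun x => q * g x) :=
  H.comp_left (q * ·) (by fun_prop) fun _ h => S3.mul_mem hq h

theorem HRel.S3_mul {X : Type*} [TopologicalSpace X] {C : Set X} {f g f' g' : X → ℍ[ℝ]}
    (H : HRel (S3 : Set ℍ[ℝ]) C f g) (H' : HRel (S3 : Set ℍ[ℝ]) C f' g') :
    HRel (S3 : Set ℍ[ℝ]) C (fun x => f x * f' x) (fun x => g x * g' x) :=
  H.mul H' fun _ h _ h' => S3.mul_mem h h'

namespace Deg
variable {f g : (Fin 3 → I) → ℍ[ℝ]} {n m : ℤ}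

theorem continuous (h : Deg f n) : Continuous f := by
  obtain ⟨w, -, H⟩ := h
  simpa only [neg_qi_mul_qi_mul] using (H.S3_mul_left neg_qi_mem_S3).continuous_left

theorem mem (h : Deg f n) (k) : f k ∈ S3 := by
  obtain ⟨w, -, H⟩ := h
  simpa only [neg_qi_mul_qi_mul, SetLike.mem_coe] using (H.S3_mul_left neg_qi_mem_S3).mem_left k

theorem bd (h : Deg f n) : ∀ k ∈ bd 3, f k = 1 := by
  obtain ⟨w, hw, H⟩ := h
  intro k hk
  have := H.eqOn k hk
  rw [susp_bd hw.bd k hk] at this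
  rw [← neg_qi_mul_qi_mul (f k), ← this, neg_mul, qi_mul_qi, neg_neg]

theorem total (hf : Continuous f) (hS : ∀ k, f k ∈ S3) (h1 : ∀ k ∈ PiThree.bd 3, f k = 1) :
    ∃ n, Deg f n := by
  obtain ⟨w, n, hw, H⟩ := exists_susp (g := fun k => qi * f k) (by fun_prop)
    (fun k => S3.mul_mem qi_mem_S3 (hS k)) fun k hk => by rw [h1 k hk, mul_one]
  exact ⟨n, w, hw, H⟩

theorem congr (h : Deg f n) (H : HRel (S3 : Set ℍ[ℝ]) (PiThree.bd 3) f g) : Deg g n := by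
  obtain ⟨w, hw, H'⟩ := h
  exact ⟨w, hw, (H.S3_mul_left qi_mem_S3).symm.trans H'⟩

theorem exists_of_int (n : ℤ) : ∃ f, Deg f n := by
  obtain ⟨w, hw⟩ := WRel.exists_of_int n
  refine ⟨fun k => -qi * susp w k, w, hw, ?_⟩
  simp only [qi_mul_neg_qi_mul]
  have hwY := fun k => S2_subset (hw.mem k)
  exact (HRel.susp (HRel.refl hw.continuous hwY))

theorem cc_two (h : Deg f n) (h' : Deg g m) : Deg (cc 2 f g) (n + m) := by
  have hf := h.bd
  have hg := h'.bd
  obtain ⟨w, hw, H⟩ := h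
  obtain ⟨w', hw', H'⟩ := h'
  refine ⟨cc 1 w w', hw.add hw', ?_⟩
  rw [susp_cc]
  have := H.cc (i := 2) (y := qi) H' (fun k hk => by rw [hf k hk, mul_one])
    (fun k hk => by rw [hg k hk, mul_one])
  convert this using 1
  funext k
  exact (cc_comp 2 f g (qi * ·) k).symm

theorem hrel_cc (h : Deg f n) (h' : Deg g m) (i : Fin 3) :
    HRel (S3 : Set ℍ[ℝ]) (PiThree.bd 3) (fun k => f k * g k) (PiThree.cc i f g) :=
  HRel.mul_cc h.continuous h.mem h.bd h'.continuous h'.mem h'.bd fun _ h _ h' => S3.mul_mem h h'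

theorem mul (h : Deg f n) (h' : Deg g m) : Deg (fun k => f k * g k) (n + m) :=
  (h.cc_two h').congr (h.hrel_cc h' 2).symm

theorem cc (h : Deg f n) (h' : Deg g m) (i : Fin 3) : Deg (PiThree.cc i f g) (n + m) :=
  (h.mul h').congr (h.hrel_cc h' i)

theorem null (h : Deg f 0) : HRel (S3 : Set ℍ[ℝ]) (PiThree.bd 3) f (fun _ => 1) := by
  obtain ⟨w, hw, H⟩ := h
  have := (H.trans (HRel.susp (hw.null.mono S2_subset subset_rfl))).S3_mul_left neg_qi_mem_S3
  simp only [neg_qi_mul_qi_mul, susp, sloop_qi] at this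
  simpa only [neg_mul, qi_mul_qi, neg_neg] using this

theorem eq_zero (h : Deg f n) (H : HRel (S3 : Set ℍ[ℝ]) (PiThree.bd 3) f (fun _ => 1)) :
    n = 0 := by
  obtain ⟨w, hw, H'⟩ := h
  have := H'.symm.trans (H.S3_mul_left qi_mem_S3)
  simp only [mul_one] at this
  exact hw.eq_zero (susp_injective hw.continuous hw.mem hw.bd this)

theorem one_eq_zero (h : Deg (fun _ => 1) n) : n = 0 :=
  h.eq_zero (HRel.refl h.continuous h.mem)

theorem exists_star (h : Deg f n) : ∃ m, Deg (fun k => star (f k)) m := by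
  have hf := h.continuous
  exact total (by fun_prop) (fun k => S3.star_mem (h.mem k)) fun k hk => by
    rw [h.bd k hk, star_one]

theorem unique (h : Deg f n) (h' : Deg f m) : n = m := by
  obtain ⟨l, hl⟩ := h.exists_star
  have h1 := h.mul hl
  have h2 := h'.mul hl
  simp only [S3.mul_star (h.mem _)] at h1 h2
  linarith [h1.one_eq_zero, h2.one_eq_zero]

theorem hrel (h : Deg f n) (h' : Deg g n) : HRel (S3 : Set ℍ[ℝ]) (PiThree.bd 3) f g := by
  obtain ⟨l, hl⟩ := h'.exists_star
  have h1 := h'.mul hl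
  simp only [S3.mul_star (h'.mem _)] at h1
  have h2 := h.mul hl
  rw [h1.one_eq_zero] at h2
  have := h2.null.S3_mul (HRel.refl h'.continuous h'.mem)
  simpa only [mul_assoc, S3.star_mul (h'.mem _), mul_one, one_mul] using this

/-- A loop of unit quaternions is homotopic to a square if and only if its degree is even. -/
theorem exists_sq_iff (h : Deg f n) :
    (∃ r : (Fin 3 → I) → ℍ[ℝ], Continuous r ∧ (∀ k, r k ∈ S3) ∧ (∀ k ∈ PiThree.bd 3, r k = 1) ∧
      HRel (S3 : Set ℍ[ℝ]) (PiThree.bd 3) f (fun k => r k * r k)) ↔ Even n := by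
  constructor
  · rintro ⟨r, hr, hrS, hr1, H⟩
    obtain ⟨m, hm⟩ := total hr hrS hr1
    exact ⟨m, (h.congr H).unique (hm.mul hm)⟩
  · rintro ⟨m, rfl⟩
    obtain ⟨r, hr⟩ := exists_of_int m
    exact ⟨r, hr.continuous, hr.mem, hr.bd, h.hrel (hr.mul hr)⟩

end Deg

/-- A correspondence between groups which is functional and bijective in the sense of
homomorphisms is the graph of an isomorphism. -/
theorem nonempty_mulEquiv_of_rel {G H : Type*} [Group G] [Group H] (R : G → H → Prop)
    (total : ∀ g, ∃ h, R g h) (surj : ∀ h, ∃ g, R g h)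
    (mul : ∀ g h g' h', R g h → R g' h' → R (g * g') (h * h'))
    (left : ∀ h, R 1 h → h = 1) (right : ∀ g, R g 1 → g = 1) : Nonempty (G ≃* H) := by
  have uniq : ∀ g h h', R g h → R g h' → h = h' := fun g h h' r r' => by
    obtain ⟨k, hk⟩ := total g⁻¹
    have h1 := mul _ _ _ _ r hk
    have h2 := mul _ _ _ _ r' hk
    rw [mul_inv_cancel] at h1 h2
    exact mul_right_cancel ((left _ h1).trans (left _ h2).symm)
  choose φ hφ using total
  let Φ : G →* H := MonoidHom.mk' φ fun a b => uniq _ _ _ (hφ _) (mul _ _ _ _ (hφ a) (hφ b))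
  refine ⟨MulEquiv.ofBijective Φ ⟨(injective_iff_map_eq_one Φ).2 fun g hg => ?_, fun h => ?_⟩⟩
  · have : φ g = 1 := hg
    exact right g (this ▸ hφ g)
  · obtain ⟨g, hg⟩ := surj h
    exact ⟨g, uniq _ _ _ (hφ g) hg⟩

end

section

open Quaternion

/-! ### The coset space as a space of symmetric matrices -/

section Coset
variable {N : ℕ}

/-- The matrix underlying an element of `SU N`. -/
def suVal (A : SU N) : Matrix (Fin N) (Fin N) ℂ := ((A : Matrix.unitaryGroup (Fin N) ℂ) : Matrix _ _ ℂ)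

theorem suVal_mul (A B : SU N) : suVal (A * B) = suVal A * suVal B := rfl

theorem suVal_inv (A : SU N) : suVal A⁻¹ = (suVal A)ᴴ := rfl

theorem suVal_one : suVal (1 : SU N) = 1 := rfl

theorem continuous_suVal : Continuous (suVal (N := N)) :=
  continuous_subtype_val.comp continuous_subtype_val

theorem suVal_mem (A : SU N) : suVal A ∈ SUon ℂ (Finset.univ : Finset (Fin N)) :=
  mem_SUon_univ'.2 ⟨Matrix.mem_unitaryGroup_iff'.1 A.1.2, A.2⟩

theorem exists_suVal {A : Matrix (Fin N) (Fin N) ℂ} (hA : A ∈ SUon ℂ (Finset.univ : Finset (Fin N))) :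
    ∃ B : SU N, suVal B = A :=
  ⟨⟨⟨A, Matrix.mem_unitaryGroup_iff'.2 (mem_SUon_univ'.1 hA).1⟩, (mem_SUon_univ'.1 hA).2⟩, rfl⟩

theorem mem_SOinSU_iff {A : SU N} : A ∈ SOinSU N ↔ suVal A * (suVal A)ᵀ = 1 := by
  constructor
  · rintro ⟨B, hB⟩
    have h : (suVal A)ᵀ = (suVal A)ᴴ := by
      ext i j
      have : ∀ i j, suVal A i j = (B i j : ℂ) := fun i j => congrFun (congrFun hB i) j
      simp [this]
    rw [h]
    exact Matrix.mem_unitaryGroup_iff.1 A.1.2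
  · intro h
    exact ⟨_, (exists_real (suVal_mem A) h).2.symm⟩

theorem inv_mul_mem_SOinSU_iff {A B : SU N} :
    A⁻¹ * B ∈ SOinSU N ↔ suVal A * (suVal A)ᵀ = suVal B * (suVal B)ᵀ := by
  have h1 : (suVal A)ᴴ * suVal A = 1 := (mem_SUon_univ'.1 (suVal_mem A)).1
  have h2 : suVal A * (suVal A)ᴴ = 1 := mul_eq_one_comm.1 h1
  have h3 : (suVal A)ᴴᵀ * (suVal A)ᵀ = 1 := by rw [← transpose_mul, h2, transpose_one]
  have h4 : (suVal A)ᵀ * (suVal A)ᴴᵀ = 1 := mul_eq_one_comm.1 h3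
  rw [mem_SOinSU_iff, suVal_mul, suVal_inv, transpose_mul]
  constructor
  · intro h
    calc suVal A * (suVal A)ᵀ
        = suVal A * ((suVal A)ᴴ * suVal B * ((suVal B)ᵀ * (suVal A)ᴴᵀ)) * (suVal A)ᵀ := by
          rw [h, Matrix.mul_one]
      _ = (suVal A * (suVal A)ᴴ) * (suVal B * (suVal B)ᵀ) * ((suVal A)ᴴᵀ * (suVal A)ᵀ) := by
          simp only [Matrix.mul_assoc]
      _ = _ := by rw [h2, h3, Matrix.one_mul, Matrix.mul_one]
  · intro h
    calc (suVal A)ᴴ * suVal B * ((suVal B)ᵀ * (suVal A)ᴴᵀ)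
        = (suVal A)ᴴ * (suVal B * (suVal B)ᵀ) * (suVal A)ᴴᵀ := by simp only [Matrix.mul_assoc]
      _ = (suVal A)ᴴ * suVal A * ((suVal A)ᵀ * (suVal A)ᴴᵀ) := by
          rw [← h]; simp only [Matrix.mul_assoc]
      _ = 1 := by rw [h1, h4, Matrix.one_mul]

/-- The map `A ↦ A Aᵀ` on the coset space. -/
def cosetSym : SU N ⧸ SOinSU N → Matrix (Fin N) (Fin N) ℂ :=
  Quotient.lift (fun A => suVal A * (suVal A)ᵀ) fun _ _ h =>
    inv_mul_mem_SOinSU_iff.1 (QuotientGroup.leftRel_apply.1 h)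

theorem cosetSym_mk (A : SU N) : cosetSym (QuotientGroup.mk A) = suVal A * (suVal A)ᵀ := rfl

theorem cosetSym_one : cosetSym (QuotientGroup.mk (1 : SU N)) = 1 := by
  rw [cosetSym_mk, suVal_one, transpose_one, Matrix.one_mul]

theorem continuous_cosetSym : Continuous (cosetSym (N := N)) := by
  have := continuous_suVal (N := N)
  exact Continuous.quotient_lift (by fun_prop) _

theorem cosetSym_injective : Function.Injective (cosetSym (N := N)) := by
  intro x y h
  induction x using QuotientGroup.induction_on with | H A =>
  induction y using QuotientGroup.induction_on with | H B =>
  exact QuotientGroup.eq.2 (inv_mul_mem_SOinSU_iff.2 h)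

theorem range_cosetSym : Set.range (cosetSym (N := N)) = SymT (Fin N) := by
  ext S
  constructor
  · rintro ⟨x, rfl⟩
    induction x using QuotientGroup.induction_on with | H A =>
    exact mul_transpose_mem_SymT (suVal_mem A)
  · rintro ⟨A, hA, rfl⟩
    obtain ⟨B, rfl⟩ := exists_suVal hA
    exact ⟨QuotientGroup.mk B, rfl⟩

theorem isCompact_SUon : IsCompact (SUon ℂ (Finset.univ : Finset (Fin N)) : Set (Matrix (Fin N) (Fin N) ℂ)) := by
  have hc : IsCompact (Set.pi Set.univ fun _ : Fin N => Set.pi Set.univ fun _ : Fin N =>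
      Metric.closedBall (0 : ℂ) 1) :=
    isCompact_univ_pi fun _ => isCompact_univ_pi fun _ => isCompact_closedBall _ _
  refine hc.of_isClosed_subset ?_ fun A hA i _ j _ => ?_
  · have : (SUon ℂ (Finset.univ : Finset (Fin N)) : Set (Matrix (Fin N) (Fin N) ℂ)) =
        {A | Aᴴ * A = 1} ∩ {A | A.det = 1} := by
      ext A; exact mem_SUon_univ'
    rw [this]
    exact (isClosed_eq (by fun_prop) continuous_const).inter
      (isClosed_eq (by fun_prop) continuous_const)
  · rw [mem_closedBall_zero_iff]
    exact entry_norm_bound_of_unitary (Matrix.mem_unitaryGroup_iff'.2 (mem_SUon_univ'.1 hA).1) i j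

instance : CompactSpace (SU N) := by
  have h : Topology.IsInducing (suVal (N := N)) :=
    Topology.IsInducing.subtypeVal.comp Topology.IsInducing.subtypeVal
  rw [← isCompact_univ_iff, h.isCompact_iff, Set.image_univ]
  convert isCompact_SUon (N := N)
  ext A
  exact ⟨fun ⟨B, hB⟩ => hB ▸ suVal_mem B, exists_suVal⟩

theorem isEmbedding_cosetSym : Topology.IsEmbedding (cosetSym (N := N)) :=
  (continuous_cosetSym.isClosedEmbedding cosetSym_injective).isEmbedding

theorem exists_cosetSym_lift {K : Type*} [TopologicalSpace K] {F : K → Matrix (Fin N) (Fin N) ℂ}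
    (hF : Continuous F) (hFT : ∀ k, F k ∈ SymT (Fin N)) :
    ∃ G : K → SU N ⧸ SOinSU N, Continuous G ∧ ∀ k, cosetSym (G k) = F k := by
  simp only [← range_cosetSym, Set.mem_range] at hFT
  choose G hG using hFT
  refine ⟨G, isEmbedding_cosetSym.continuous_iff.2 ?_, hG⟩
  rwa [show cosetSym ∘ G = F from funext hG]

theorem homotopic_iff_hrel (γ γ' : GenLoop (Fin 3) (SU N ⧸ SOinSU N) (QuotientGroup.mk 1)) :
    GenLoop.Homotopic γ γ' ↔
    HRel (SymT (Fin N)) (bd 3) (fun k => cosetSym (γ k)) (fun k => cosetSym (γ' k)) := by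
  constructor
  · rintro ⟨H⟩
    have hc : Continuous (cosetSym (N := N)) := continuous_cosetSym
    refine ⟨fun p => cosetSym (H (p.2, p.1)), by fun_prop, fun k => ?_, fun k => ?_, fun p => ?_,
      fun k hk t => ?_⟩
    · beta_reduce; rw [H.apply_zero]; rfl
    · beta_reduce; rw [H.apply_one]; rfl
    · rw [← range_cosetSym]; exact ⟨_, rfl⟩
    · beta_reduce; rw [H.eq_fst t hk]; rfl
  · rintro ⟨F, hF, h0, h1, hP, hC⟩
    obtain ⟨G, hG, hGF⟩ := exists_cosetSym_lift hF hP
    refine ⟨⟨⟨⟨fun p => G (p.2, p.1), by fun_prop⟩, fun k => ?_, fun k => ?_⟩, fun t k hk => ?_⟩⟩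
    · exact cosetSym_injective ((hGF _).trans (h0 k))
    · exact cosetSym_injective ((hGF _).trans (h1 k))
    · exact cosetSym_injective ((hGF _).trans (hC k hk t))

theorem exists_genLoop {F : (Fin 3 → I) → Matrix (Fin N) (Fin N) ℂ}
    (hF : Continuous F) (hFT : ∀ k, F k ∈ SymT (Fin N)) (hF1 : ∀ k ∈ bd 3, F k = 1) :
    ∃ γ : GenLoop (Fin 3) (SU N ⧸ SOinSU N) (QuotientGroup.mk 1), ∀ k, cosetSym (γ k) = F k := by
  obtain ⟨G, hG, hGF⟩ := exists_cosetSym_lift hF hFT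
  exact ⟨⟨⟨G, hG⟩, fun k hk => cosetSym_injective (by
    rw [cosetSym_one]; exact (hGF k).trans (hF1 k hk))⟩, hGF⟩

end Coset

section Main
variable {N : ℕ} {μ : Type} [Fintype μ] [DecidableEq μ]

/-- The correspondence between homotopy classes of loops in the coset space and degrees mod 2. -/
def ClassRel (e : (Fin 2 ⊕ Fin 2) ⊕ μ ≃ Fin N)
    (x : π_ 3 (SU N ⧸ SOinSU N) (QuotientGroup.mk 1)) (z : Multiplicative (ZMod 2)) : Prop :=
  ∃ (γ : GenLoop (Fin 3) (SU N ⧸ SOinSU N) (QuotientGroup.mk 1)) (f : (Fin 3 → I) → ℍ[ℝ]) (n : ℤ),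
    x = (⟦γ⟧ : HomotopyGroup (Fin 3) _ _) ∧ Deg f n ∧
    HRel (SymT (Fin N)) (bd 3) (fun k => cosetSym (γ k)) (fun k => symLoop e (f k)) ∧
    z = Multiplicative.ofAdd (n : ZMod 2)

theorem cosetSym_genLoop_mem (γ : GenLoop (Fin 3) (SU N ⧸ SOinSU N) (QuotientGroup.mk 1)) (k) :
    cosetSym (γ k) ∈ SymT (Fin N) := by
  rw [← range_cosetSym]; exact ⟨_, rfl⟩

theorem continuous_cosetSym_genLoop
    (γ : GenLoop (Fin 3) (SU N ⧸ SOinSU N) (QuotientGroup.mk 1)) :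
    Continuous fun k => cosetSym (γ k) := continuous_cosetSym.comp γ.1.continuous

theorem cosetSym_genLoop_bd (γ : GenLoop (Fin 3) (SU N ⧸ SOinSU N) (QuotientGroup.mk 1)) :
    ∀ k ∈ bd 3, cosetSym (γ k) = 1 := fun k hk => by
  rw [GenLoop.boundary γ k hk, cosetSym_one]

theorem cosetSym_transAt (i : Fin 3)
    (γ γ' : GenLoop (Fin 3) (SU N ⧸ SOinSU N) (QuotientGroup.mk 1)) :
    (fun k => cosetSym (GenLoop.transAt i γ γ' k)) =
      cc i (fun k => cosetSym (γ k)) (fun k => cosetSym (γ' k)) := by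
  funext k
  rw [cc_comp i γ γ' cosetSym k]
  rfl

theorem symLoop_one (e : (Fin 2 ⊕ Fin 2) ⊕ μ ≃ Fin N) : symLoop e 1 = 1 := by
  simp [symLoop]

theorem hrel_symLoop_of_zmod_eq (e : (Fin 2 ⊕ Fin 2) ⊕ μ ≃ Fin N) {f : (Fin 3 → I) → ℍ[ℝ]}
    {n : ℤ} (h : Deg f n) :
    HRel (SymT (Fin N)) (bd 3) (fun k => symLoop e (f k)) (fun _ => 1) ↔ (n : ZMod 2) = 0 := by
  rw [symLoop_null_iff e h.continuous h.mem h.bd, h.exists_sq_iff,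
    ZMod.intCast_eq_zero_iff_even]

theorem ClassRel.mul (e : (Fin 2 ⊕ Fin 2) ⊕ μ ≃ Fin N)
    {x x' : π_ 3 (SU N ⧸ SOinSU N) (QuotientGroup.mk 1)} {z z' : Multiplicative (ZMod 2)}
    (h : ClassRel e x z) (h' : ClassRel e x' z') : ClassRel e (x * x') (z * z') := by
  obtain ⟨γ, f, n, rfl, hf, H, rfl⟩ := h
  obtain ⟨γ', f', n', rfl, hf', H', rfl⟩ := h'
  refine ⟨GenLoop.transAt 0 γ' γ, cc 0 f' f, n' + n, HomotopyGroup.mul_spec, hf'.cc hf 0, ?_, ?_⟩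
  · rw [cosetSym_transAt]
    have := H'.cc (i := 0) H (cosetSym_genLoop_bd γ') (cosetSym_genLoop_bd γ)
    convert this using 1
    funext k
    exact (cc_comp 0 f' f (symLoop e) k).symm
  · rw [add_comm, Int.cast_add]; rfl

theorem nonempty_pi_three_mulEquiv (e : (Fin 2 ⊕ Fin 2) ⊕ μ ≃ Fin N) :
    Nonempty ((π_ 3 (SU N ⧸ SOinSU N) (QuotientGroup.mk 1)) ≃* Multiplicative (ZMod 2)) := by
  refine nonempty_mulEquiv_of_rel (ClassRel e) (fun x => ?_) (fun z => ?_)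
    (fun _ _ _ _ => ClassRel.mul e) ?_ ?_
  · induction x using Quotient.inductionOn with | h γ =>
    obtain ⟨r, hr, hrS, hr1, H⟩ := exists_symLoop e (continuous_cosetSym_genLoop γ)
      (cosetSym_genLoop_mem γ) (cosetSym_genLoop_bd γ)
    obtain ⟨n, hn⟩ := Deg.total hr hrS hr1
    exact ⟨_, γ, r, n, rfl, hn, H, rfl⟩
  · obtain ⟨n, hn⟩ := ZMod.intCast_surjective (Multiplicative.toAdd z)
    obtain ⟨f, hf⟩ := Deg.exists_of_int n
    have hfc := hf.continuous
    have hT : ∀ k, symLoop e (f k) ∈ SymT (Fin N) := fun k =>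
      mul_transpose_mem_SymT (emb_psi_mem e (hf.mem k))
    have hc : Continuous fun k => symLoop e (f k) := by unfold symLoop; fun_prop
    obtain ⟨γ, hγ⟩ := exists_genLoop hc hT fun k hk => by rw [hf.bd k hk, symLoop_one]
    refine ⟨_, γ, f, n, rfl, hf, ?_, by rw [hn]; rfl⟩
    simp only [hγ]
    exact HRel.refl hc hT
  · rintro z ⟨γ, f, n, h1, hf, H, rfl⟩
    have h2 := (homotopic_iff_hrel _ _).1 (Quotient.exact (h1.symm.trans HomotopyGroup.one_def))
    have h3 := H.symm.trans h2
    simp only [GenLoop.const_apply, cosetSym_one] at h3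
    rw [(hrel_symLoop_of_zmod_eq e hf).1 h3]
    rfl
  · rintro x ⟨γ, f, n, rfl, hf, H, h1⟩
    have h2 := H.trans ((hrel_symLoop_of_zmod_eq e hf).2 (Multiplicative.ofAdd.injective h1.symm))
    rw [HomotopyGroup.one_def]
    refine Quotient.sound ((homotopic_iff_hrel _ _).2 ?_)
    simpa only [GenLoop.const_apply, cosetSym_one] using h2

end Main

end

end PiThree

/-- **Instantons in Partially Broken Gauge Groups**: for `N ≥ 5`,
`π₃(SU(N)/SO(N)) ≅ ℤ/2ℤ`. -/
theorem pi3_SU_quotient_SO (N : ℕ) (hN : 5 ≤ N) :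
    Nonempty ((π_ 3 ((↥(SU N)) ⧸ SOinSU N) (QuotientGroup.mk 1)) ≃* Multiplicative (ZMod 2)) := by
  obtain ⟨M, rfl⟩ := Nat.exists_eq_add_of_le (show 4 ≤ N by omega)
  exact PiThree.nonempty_pi_three_mulEquiv (μ := Fin M)
    ((finSumFinEquiv.sumCongr (Equiv.refl _)).trans finSumFinEquiv)

end
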